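/- Let F be an algebraically closed field of characteristic 0 and let Q be a maximal finite abelian subgroup of Aut(𝔢₈). Then either Q is an elementary abelian p-group for some p ∈ {2, 3, 5}, or the exponent of Q is 4 or 6. Moreover, for every θ ∈ Q the fixed subalgebra 𝔢₈^θ is a semisimple Lie algebra. -/

import Mathlib

open LieAlgebra

/-- The group of automorphisms of a Lie algebra, realized as the subgroup of the group
of linear automorphisms consisting of those preserving the bracket. -/
def lieAut (R L : Type*) [CommRing R] [LieRing L] [LieAlgebra R L] :
    Subgroup (L ≃ₗ[R] L) where
  carrier := {e | ∀ x y : L, e ⁅x, y⁆ = ⁅e x, e y⁆}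
  one_mem' := fun _ _ => rfl
  mul_mem' := by
    intro f g hf hg x y
    show f (g ⁅x, y⁆) = _
    rw [hg]
    exact hf _ _
  inv_mem' := by
    intro f hf x y
    apply f.injective
    show f (f.symm ⁅x, y⁆) = f ⁅f.symm x, f.symm y⁆
    rw [hf (f.symm x) (f.symm y), f.apply_symm_apply, f.apply_symm_apply, f.apply_symm_apply]

/-- The subalgebra of fixed points of an automorphism of a Lie algebra. -/
def fixedSubalgebra {R L : Type*} [CommRing R] [LieRing L] [LieAlgebra R L]
    (θ : lieAut R L) : LieSubalgebra R L where
  carrier := {x | (θ : L ≃ₗ[R] L) x = x}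
  add_mem' := by
    intro a b ha hb
    simp only [Set.mem_setOf_eq] at *
    rw [map_add, ha, hb]
  zero_mem' := map_zero _
  smul_mem' := by
    intro c a ha
    simp only [Set.mem_setOf_eq] at *
    rw [map_smul, ha]
  lie_mem' := by
    intro a b ha hb
    simp only [Set.mem_setOf_eq] at *
    rw [θ.2 a b, ha, hb]

/-- A maximal finite abelian subgroup: a finite abelian subgroup which is maximal among
all abelian subgroups. -/
def IsMaximalFiniteAbelian {G : Type*} [Group G] (Q : Subgroup G) : Prop :=
  Finite Q ∧ (∀ a b, a ∈ Q → b ∈ Q → a * b = b * a) ∧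
    ∀ Q' : Subgroup G, (∀ a b, a ∈ Q' → b ∈ Q' → a * b = b * a) → Q ≤ Q' → Q' = Q

/-- Two subgroups are conjugate. -/
def SubgroupIsConj {G : Type*} [Group G] (Q₁ Q₂ : Subgroup G) : Prop :=
  ∃ g : G, Q₂ = Q₁.map (MulAut.conj g).toMonoidHom

namespace E8P

/-- Cartan pairing with the simple coroots. -/
def cc (w : Fin 8 → ℤ) : Fin 8 → ℤ := CartanMatrix.E₈.mulVec w

/-- The symmetric bilinear form of the root lattice. -/
def bil (v w : Fin 8 → ℤ) : ℤ := ∑ i, v i * cc w i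

/-- simple root -/
def al (i : Fin 8) : Fin 8 → ℤ := Pi.single i 1

/-- highest root -/
def hi : Fin 8 → ℤ := ![2,3,4,6,5,4,3,2]

/-- norm two vectors -/
def IsRt (v : Fin 8 → ℤ) : Prop := bil v v = 2

lemma cc0 (w) : cc w 0 = 2 * w 0 - w 2 := by
  simp [cc, CartanMatrix.E₈, Matrix.mulVec, dotProduct, Fin.sum_univ_eight]; ring
lemma cc1 (w) : cc w 1 = 2 * w 1 - w 3 := by
  simp [cc, CartanMatrix.E₈, Matrix.mulVec, dotProduct, Fin.sum_univ_eight]; ring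
lemma cc2 (w) : cc w 2 = 2 * w 2 - w 0 - w 3 := by
  simp [cc, CartanMatrix.E₈, Matrix.mulVec, dotProduct, Fin.sum_univ_eight]; ring
lemma cc3 (w) : cc w 3 = 2 * w 3 - w 1 - w 2 - w 4 := by
  simp [cc, CartanMatrix.E₈, Matrix.mulVec, dotProduct, Fin.sum_univ_eight]; ring
lemma cc4 (w) : cc w 4 = 2 * w 4 - w 3 - w 5 := by
  simp [cc, CartanMatrix.E₈, Matrix.mulVec, dotProduct, Fin.sum_univ_eight]; ring
lemma cc5 (w) : cc w 5 = 2 * w 5 - w 4 - w 6 := by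
  simp [cc, CartanMatrix.E₈, Matrix.mulVec, dotProduct, Fin.sum_univ_eight]; ring
lemma cc6 (w) : cc w 6 = 2 * w 6 - w 5 - w 7 := by
  simp [cc, CartanMatrix.E₈, Matrix.mulVec, dotProduct, Fin.sum_univ_eight]; ring
lemma cc7 (w) : cc w 7 = 2 * w 7 - w 6 := by
  simp [cc, CartanMatrix.E₈, Matrix.mulVec, dotProduct, Fin.sum_univ_eight]; ring

lemma cc_add (v w) : cc (v + w) = cc v + cc w := Matrix.mulVec_add _ _ _
lemma cc_sub (v w) : cc (v - w) = cc v - cc w := Matrix.mulVec_sub _ _ _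
lemma cc_neg (v) : cc (-v) = - cc v := Matrix.mulVec_neg _ _
lemma cc_smul (k : ℤ) (v) : cc (k • v) = k • cc v := Matrix.mulVec_smul _ _ _
lemma cc_zero : cc 0 = 0 := Matrix.mulVec_zero _

lemma cc_al (i j : Fin 8) : cc (al j) i = CartanMatrix.E₈ i j := by
  simp [cc, al]

lemma bil_add_left (u v w) : bil (u + v) w = bil u w + bil v w := by
  simp [bil, add_mul, Finset.sum_add_distrib]
lemma bil_add_right (u v w) : bil u (v + w) = bil u v + bil u w := by
  simp [bil, cc_add, mul_add, Finset.sum_add_distrib]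
lemma bil_smul_left (k : ℤ) (v w) : bil (k • v) w = k * bil v w := by
  simp [bil, Finset.mul_sum, mul_assoc]
lemma bil_smul_right (k : ℤ) (v w) : bil v (k • w) = k * bil v w := by
  simp only [bil, cc_smul, Pi.smul_apply, smul_eq_mul, Finset.mul_sum, mul_left_comm]
lemma bil_neg_left (v w) : bil (-v) w = - bil v w := by simp [bil]
lemma bil_neg_right (v w) : bil v (-w) = - bil v w := by simp [bil, cc_neg]
lemma bil_sub_left (u v w) : bil (u - v) w = bil u w - bil v w := by
  simp [bil, sub_mul]
lemma bil_sub_right (u v w) : bil u (v - w) = bil u v - bil u w := by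
  simp [bil, cc_sub, mul_sub]
lemma bil_comm (v w) : bil v w = bil w v := by
  simp only [bil, Fin.sum_univ_eight, cc0, cc1, cc2, cc3, cc4, cc5, cc6, cc7]; ring
lemma bil_al_left (i) (w) : bil (al i) w = cc w i := by
  simp [bil, al, Pi.single_apply]
lemma bil_al_right (i) (w) : bil w (al i) = cc w i := by rw [bil_comm, bil_al_left]

lemma cc_hi : cc hi = al 7 := by
  ext i; fin_cases i <;> simp [cc, hi, al, CartanMatrix.E₈, Matrix.mulVec, dotProduct, Fin.sum_univ_eight, Pi.single_apply]
lemma bil_hi_right (w) : bil w hi = w 7 := by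
  simp [bil, cc_hi, al, Pi.single_apply]
lemma bil_hi_left (w) : bil hi w = w 7 := by rw [bil_comm, bil_hi_right]

lemma sum_al (v : Fin 8 → ℤ) : ∑ i, v i • al i = v := by
  ext j; simp [al, Finset.sum_apply, Pi.single_apply]

/-- half the norm -/
def hn (v : Fin 8 → ℤ) : ℤ :=
  v 0 ^2 + v 1 ^2 + v 2 ^2+ v 3 ^2+ v 4 ^2+ v 5 ^2+ v 6 ^2+ v 7 ^2 - v 0 * v 2 - v 1 * v 3
   - v 2 * v 3 - v 3 * v 4 - v 4 * v 5 - v 5 * v 6 - v 6 * v 7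

lemma bil_self (v) : bil v v = 2 * hn v := by
  simp only [bil, Fin.sum_univ_eight, cc0, cc1, cc2, cc3, cc4, cc5, cc6, cc7, hn]; ring

lemma hn_sos (v) : 120 * hn v = 30 * (2 * v 0 - v 2)^2 + 30 * (2 * v 1 - v 3)^2 
    + 10 * (3 * v 2 - 2 * v 3)^2 + 2 * (5 * v 3 - 6 * v 4)^2
    + 3 * (4 * v 4 - 5 * v 5)^2 + 5 * (3 * v 5 - 4 * v 6)^2 + 10 * (2 * v 6 - 3 * v 7)^2
    + 30 * v 7 ^2 := by
  simp only [hn]; ring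

lemma hn_nonneg (v) : 0 ≤ hn v := by
  have := hn_sos v
  have : 0 ≤ 120 * hn v := by rw [this]; positivity
  omega

lemma eq_zero_of_hn (v) (h : hn v = 0) : v = 0 := by
  have h1 := hn_sos v
  rw [h] at h1
  have p0 := sq_nonneg (2 * v 0 - v 2)
  have p1 := sq_nonneg (2 * v 1 - v 3)
  have p2 := sq_nonneg (3 * v 2 - 2 * v 3)
  have p3 := sq_nonneg (5 * v 3 - 6 * v 4)
  have p4 := sq_nonneg (4 * v 4 - 5 * v 5)
  have p5 := sq_nonneg (3 * v 5 - 4 * v 6)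
  have p6 := sq_nonneg (2 * v 6 - 3 * v 7)
  have p7 := sq_nonneg (v 7)
  have q0 : (2 * v 0 - v 2)^2 = 0 := by linarith
  have q1 : (2 * v 1 - v 3)^2 = 0 := by linarith
  have q2 : (3 * v 2 - 2 * v 3)^2 = 0 := by linarith
  have q3 : (5 * v 3 - 6 * v 4)^2 = 0 := by linarith
  have q4 : (4 * v 4 - 5 * v 5)^2 = 0 := by linarith
  have q5 : (3 * v 5 - 4 * v 6)^2 = 0 := by linarith
  have q6 : (2 * v 6 - 3 * v 7)^2 = 0 := by linarith
  have q7 : (v 7)^2 = 0 := by linarith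
  rw [sq_eq_zero_iff] at q0 q1 q2 q3 q4 q5 q6 q7
  ext i
  fin_cases i <;> simp <;> omega

lemma hn_pos (v) (h : v ≠ 0) : 0 < hn v :=
  lt_of_le_of_ne (hn_nonneg v) fun h' => h (eq_zero_of_hn v h'.symm)

lemma isRt_iff (v) : IsRt v ↔ hn v = 1 := by
  rw [IsRt, bil_self]; omega

lemma IsRt.ne_zero {v} (h : IsRt v) : v ≠ 0 := by
  rintro rfl; simp [IsRt, bil] at h

lemma isRt_neg {v} : IsRt (-v) ↔ IsRt v := by simp [IsRt, bil_neg_left, bil_neg_right]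

lemma isRt_al (i) : IsRt (al i) := by
  rw [IsRt, bil_al_left, cc_al]; fin_cases i <;> rfl

lemma isRt_hi : IsRt hi := by
  rw [IsRt, bil_hi_right]; rfl

lemma al_apply_nonneg (i j) : 0 ≤ al i j := by
  simp only [al, Pi.single_apply]; split_ifs <;> simp

lemma cc_nonpos_of (v : Fin 8 → ℤ) (hv : 0 ≤ v) (i) (hi : v i = 0) : cc v i ≤ 0 := by
  have := hv 0; have := hv 1; have := hv 2; have := hv 3; have := hv 4
  have := hv 5; have := hv 6; have := hv 7
  simp only [Pi.zero_apply] at *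
  fin_cases i <;> simp [cc0, cc1, cc2, cc3, cc4, cc5, cc6, cc7] at hi ⊢ <;> omega

/-- sign coherence -/
lemma IsRt.sign {v} (h : IsRt v) : 0 ≤ v ∨ v ≤ 0 := by
  by_contra hcon
  push Not at hcon
  obtain ⟨h1, h2⟩ := hcon
  have hv : v = v⁺ - v⁻ := (posPart_sub_negPart v).symm
  have hp : v⁺ ≠ 0 := fun h0 => h2 (by simpa using h0)
  have hm : v⁻ ≠ 0 := fun h0 => h1 (by simpa using h0)
  have hpm : bil v⁺ v⁻ ≤ 0 := by
    apply Finset.sum_nonpos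
    intro i _
    have h5 : 0 ≤ v⁺ i := posPart_nonneg v i
    rcases eq_or_ne (v⁺ i) 0 with h0 | h0
    · simp [h0]
    · have : v⁻ i = 0 := by
        have hh : (v⁺ i) = (v i)⁺ := rfl
        have hh' : (v⁻ i) = (v i)⁻ := rfl
        rw [hh] at h0; rw [hh']
        rw [Ne, posPart_eq_zero, not_le] at h0
        exact negPart_eq_zero.2 h0.le
      exact mul_nonpos_of_nonneg_of_nonpos h5 (cc_nonpos_of _ (negPart_nonneg v) i this)
  have e1 : bil v v = bil v⁺ v⁺ + bil v⁻ v⁻ - 2 * bil v⁺ v⁻ := by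
    conv_lhs => rw [hv]
    rw [bil_sub_left, bil_sub_right, bil_sub_right, bil_comm v⁻ v⁺]; ring
  rw [h, bil_self, bil_self] at e1
  have := hn_pos _ hp
  have := hn_pos _ hm
  omega

lemma hn_add_al (v i) : hn (v + al i) = hn v + 1 + cc v i := by
  have : 2 * hn (v + al i) = 2 * (hn v + 1 + cc v i) := by
    rw [← bil_self, bil_add_left, bil_add_right, bil_add_right, bil_al_left, bil_al_right, isRt_al i,
      bil_self]; ring
  omega

lemma step_adj (i j : Fin 8) (hij : CartanMatrix.E₈ i j = -1)
    (T : ∀ v, IsRt v → 0 ≤ v → 1 ≤ v i → v ≤ hi) :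
    ∀ v, IsRt v → 0 ≤ v → 1 ≤ v j → v ≤ hi := by
  intro v hv h0 hj
  by_cases h : 1 ≤ v i
  · exact T v hv h0 h
  have hi0 : v i = 0 := by have := h0 i; simp at this; omega
  have hc : cc v i ≤ -1 := by
    have := h0 0; have := h0 1; have := h0 2; have := h0 3; have := h0 4
    have := h0 5; have := h0 6; have := h0 7
    simp only [Pi.zero_apply] at *
    fin_cases i <;> fin_cases j <;> (first | (exfalso; revert hij; decide) | skip) <;>
      simp [cc0, cc1, cc2, cc3, cc4, cc5, cc6, cc7] at hi0 hj ⊢ <;> omega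
  have hne : v + al i ≠ 0 := by
    intro h'
    have := congrFun h' i
    simp [al, hi0] at this
  have h1 := hn_pos _ hne
  rw [hn_add_al] at h1
  have h2 := (isRt_iff v).1 hv
  have h3 : IsRt (v + al i) := by rw [isRt_iff, hn_add_al]; omega
  have := T _ h3 (fun k => add_nonneg (h0 k) (al_apply_nonneg i k)) (by simp [al, hi0])
  exact fun k => le_trans (by simpa using al_apply_nonneg i k) (this k)

lemma IsRt.le_hi {v} (hv : IsRt v) (h0 : 0 ≤ v) : v ≤ hi := by
  have T7 : ∀ v, IsRt v → 0 ≤ v → 1 ≤ v 7 → v ≤ hi := by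
    intro v hv h0 h7
    by_cases h : hi - v = 0
    · rw [sub_eq_zero] at h; exact h.ge
    have e : hn (hi - v) = 2 - v 7 := by
      have : 2 * hn (hi - v) = 2 * (2 - v 7) := by
        rw [← bil_self, bil_sub_left, bil_sub_right, bil_sub_right, bil_hi_left, bil_hi_left, bil_hi_right, hv]
        simp [hi]; ring
      omega
    have := hn_pos _ h
    have h71 : v 7 = 1 := by omega
    have hr : IsRt (hi - v) := by rw [isRt_iff]; omega
    rcases hr.sign with hs | hs
    · exact sub_nonneg.1 hs
    · have := hs 7
      simp [hi, h71] at this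
  have T6 := step_adj 7 6 (by decide) T7
  have T5 := step_adj 6 5 (by decide) T6
  have T4 := step_adj 5 4 (by decide) T5
  have T3 := step_adj 4 3 (by decide) T4
  have T2 := step_adj 3 2 (by decide) T3
  have T1 := step_adj 3 1 (by decide) T3
  have T0 := step_adj 2 0 (by decide) T2
  by_contra hcon
  apply hv.ne_zero
  ext i
  by_contra hi'
  have : 1 ≤ v i := by
    have := h0 i
    simp at this hi'; omega
  apply hcon
  fin_cases i
  exacts [T0 v hv h0 this, T1 v hv h0 this, T2 v hv h0 this, T3 v hv h0 this, T4 v hv h0 this,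
    T5 v hv h0 this, T6 v hv h0 this, T7 v hv h0 this]

/-- reflection in a vector -/
def rfl' (r v : Fin 8 → ℤ) : Fin 8 → ℤ := v - bil v r • r

lemma bil_rfl' (r v w) : bil (rfl' r v) w = bil v (rfl' r w) := by
  simp only [rfl', bil_sub_left, bil_sub_right, bil_smul_left, bil_smul_right, bil_comm r w]; ring

lemma rfl'_rfl' {r} (hr : IsRt r) (v) : rfl' r (rfl' r v) = v := by
  have : bil r r = 2 := hr
  simp only [rfl', bil_sub_left, bil_smul_left, this]
  ext i; simp; ring

lemma IsRt.rfl' {r} (hr : IsRt r) {v} (hv : IsRt v) : IsRt (rfl' r v) := by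
  rw [IsRt, bil_rfl', rfl'_rfl' hr, hv]

lemma rfl'_add (r v w) : rfl' r (v + w) = rfl' r v + rfl' r w := by
  simp only [rfl', bil_add_left, add_smul]; abel

/-- reflection as an additive equivalence -/
def rflE (r) (hr : IsRt r) : (Fin 8 → ℤ) ≃+ (Fin 8 → ℤ) where
  toFun := rfl' r
  invFun := rfl' r
  left_inv := rfl'_rfl' hr
  right_inv := rfl'_rfl' hr
  map_add' := rfl'_add r

/-- Induction principle: every norm 2 vector is obtained from simple roots by simple reflections. -/
lemma rt_induction {P : (Fin 8 → ℤ) → Prop} (h1 : ∀ i, P (al i))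
    (h2 : ∀ i v, IsRt v → P v → P (rfl' (al i) v)) : ∀ v, IsRt v → P v := by
  have pos : ∀ n : ℕ, ∀ v, IsRt v → 0 ≤ v → ∑ i, v i ≤ n → P v := by
    intro n
    induction n with
    | zero =>
      intro v hv h0 hs
      exfalso
      apply hv.ne_zero
      have h3 : ∑ i, v i = 0 := le_antisymm (by simpa using hs) (Finset.sum_nonneg fun i _ => h0 i)
      rw [Finset.sum_eq_zero_iff_of_nonneg (fun i _ => h0 i)] at h3
      ext i; exact h3 i (Finset.mem_univ i)
    | succ n ih =>
      intro v hv h0 hs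
      obtain ⟨i, hi⟩ : ∃ i, 0 < cc v i := by
        by_contra hcon
        push Not at hcon
        have : bil v v ≤ 0 := Finset.sum_nonpos fun i _ => mul_nonpos_of_nonneg_of_nonpos (h0 i) (hcon i)
        rw [hv] at this; omega
      by_cases hval : v = al i
      · rw [hval]; exact h1 i
      have hr := (isRt_al i).rfl' hv
      have hvi : P (rfl' (al i) v) := by
        apply ih _ hr
        · rcases hr.sign with h | h
          · exact h
          exfalso
          -- v is a multiple of al i
          have hz : ∀ j, j ≠ i → v j = 0 := by
            intro j hj
            have := h j
            simp [rfl', al, Pi.single_apply, hj] at this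
            exact le_antisymm this (h0 j)
          have hve : v = v i • al i := by
            ext j
            by_cases hj : j = i
            · subst hj; simp [al]
            · simp [al, hj, hz j hj]
          have h4 : bil v v = v i * (v i * 2) := by
            conv_lhs => rw [hve]
            rw [bil_smul_left, bil_smul_right, isRt_al i]
          rw [hv] at h4
          have h5 : v i * v i = 1 := by linarith
          have h6 : v i = 1 := by
            rcases Int.mul_eq_one_iff_eq_one_or_neg_one.1 h5 with h | h
            · exact h.1
            · have := h0 i; simp at this; omega
          apply hval
          rw [hve, h6, one_smul]
        · have : ∑ j, rfl' (al i) v j = ∑ j, v j - cc v i := by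
            simp only [rfl', bil_al_right]; simp [al, Finset.sum_sub_distrib, Pi.single_apply]
          rw [this]; push_cast at hs; omega
      have := h2 i _ hr hvi
      rwa [rfl'_rfl' (isRt_al i)] at this
  intro v hv
  rcases hv.sign with h | h
  · exact pos (∑ i, v i).toNat v hv h (Int.self_le_toNat _)
  · -- negative: reflect chain; use P' = fun v => P (-v)
    have neg : ∀ n : ℕ, ∀ v, IsRt v → 0 ≤ v → ∑ i, v i ≤ n → P (-v) := by
      intro n
      induction n with
      | zero =>
        intro v hv h0 hs
        exfalso
        apply hv.ne_zero
        have h3 : ∑ i, v i = 0 := le_antisymm (by simpa using hs) (Finset.sum_nonneg fun i _ => h0 i)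
        rw [Finset.sum_eq_zero_iff_of_nonneg (fun i _ => h0 i)] at h3
        ext i; exact h3 i (Finset.mem_univ i)
      | succ n ih =>
        intro v hv h0 hs
        obtain ⟨i, hi⟩ : ∃ i, 0 < cc v i := by
          by_contra hcon
          push Not at hcon
          have : bil v v ≤ 0 := Finset.sum_nonpos fun i _ => mul_nonpos_of_nonneg_of_nonpos (h0 i) (hcon i)
          rw [hv] at this; omega
        have hr := (isRt_al i).rfl' hv
        have hneg : rfl' (al i) (-v) = - rfl' (al i) v := by
          simp [rfl', bil_neg_left]; abel
        rcases hr.sign with h | h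
        · have h7 := ih _ hr h (by
            have : ∑ j, rfl' (al i) v j = ∑ j, v j - cc v i := by
              simp only [rfl', bil_al_right]; simp [al, Finset.sum_sub_distrib, Pi.single_apply]
            rw [this]; push_cast at hs; omega)
          have := h2 i _ (isRt_neg.2 hr) h7
          rwa [← hneg, rfl'_rfl' (isRt_al i)] at this
        · have h8 : P (rfl' (al i) (-v)) := by
            rw [hneg]
            exact pos _ _ (isRt_neg.2 hr) (by simpa using h) (Int.self_le_toNat _)
          have := h2 i _ ((isRt_al i).rfl' (isRt_neg.2 hv)) h8
          rwa [rfl'_rfl' (isRt_al i)] at this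
    have := neg (∑ i, (-v) i).toNat (-v) (isRt_neg.2 hv) (by simpa using h) (Int.self_le_toNat _)
    rwa [neg_neg] at this

end E8P

namespace E8P

/-- Weyl vector -/
def rho : Fin 8 → ℤ := ![46, 68, 91, 135, 110, 84, 57, 29]

lemma cc_rho (i) : cc rho i = 1 := by
  fin_cases i <;> simp [cc0, cc1, cc2, cc3, cc4, cc5, cc6, cc7, rho]

/-- fundamental weights -/
def om : Fin 8 → Fin 8 → ℤ := ![![4,5,7,10,8,6,4,2],![5,8,10,15,12,9,6,3],![7,10,14,20,16,12,8,4],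
  ![10,15,20,30,24,18,12,6],![8,12,16,24,20,15,10,5],![6,9,12,18,15,12,8,4],![4,6,8,12,10,8,6,3],
  ![2,3,4,6,5,4,3,2]]

lemma cc_om (i) : cc (om i) = al i := by
  ext j
  fin_cases j <;> fin_cases i <;>
    simp [cc0, cc1, cc2, cc3, cc4, cc5, cc6, cc7, om, al, Pi.single_apply]

lemma bil_om (i) (w) : bil (om i) w = w i := by
  rw [bil_comm, bil, cc_om]; simp [al, Pi.single_apply]

lemma bil_nondeg {u} (h : ∀ i, cc u i = 0) : u = 0 := by
  ext i; rw [← bil_om i u, bil]; simp [h]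

lemma hi_pos (i) : 2 ≤ hi i := by fin_cases i <;> simp [hi]
lemma hi_le (i) : hi i ≤ 6 := by fin_cases i <;> simp [hi]

lemma alcove_ind {m : ℤ} (hm : 0 < m) {P : (Fin 8 → ℤ) → Prop}
    (ht : ∀ v, (∀ i, 0 ≤ cc v i) → v 7 ≤ m → P v)
    (hs : ∀ v i, P (rfl' (al i) v) → P v)
    (h0 : ∀ v, P (v - (v 7 - m) • hi) → P v) : ∀ v, P v := by
  have key : ∀ n : ℕ, ∀ v, hn ((30:ℤ) • v - m • rho) ≤ n → P v := by
    intro n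
    induction n with
    | zero =>
      intro v hv
      have h1 := eq_zero_of_hn _ (le_antisymm (by simpa using hv) (hn_nonneg _))
      have h2 : (30:ℤ) • v = m • rho := sub_eq_zero.1 h1
      apply ht
      · intro i
        have := congrArg (fun u => cc u i) h2
        simp only [cc_smul, Pi.smul_apply, smul_eq_mul, cc_rho] at this
        omega
      · have := congrFun h2 7
        simp [rho] at this
        omega
    | succ n ih =>
      intro v hv
      by_cases h1 : ∀ i, 0 ≤ cc v i
      · by_cases h2 : v 7 ≤ m
        · exact ht v h1 h2
        · apply h0
          apply ih
          push Not at h2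
          set a := v 7 - m with ha
          have : bil ((30:ℤ) • (v - a • hi) - m • rho) ((30:ℤ) • (v - a • hi) - m • rho)
            = bil ((30:ℤ) • v - m • rho) ((30:ℤ) • v - m • rho) - 60 * a * m := by
            simp only [bil_sub_left, bil_sub_right, bil_smul_left, bil_smul_right, bil_hi_left, bil_hi_right, Pi.sub_apply, Pi.smul_apply, smul_eq_mul]
            have e1 : rho 7 = 29 := rfl
            have e2 : hi 7 = 2 := rfl
            have e3 : v 7 = a + m := by omega
            rw [e1, e2, e3]; ring
          rw [bil_self, bil_self] at this
          have h3 : 0 < a * m := mul_pos (by omega) hm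
          push_cast at hv
          nlinarith
      · push Not at h1
        obtain ⟨i, hi⟩ := h1
        apply hs v i
        apply ih
        have : bil ((30:ℤ) • (rfl' (al i) v) - m • rho) ((30:ℤ) • (rfl' (al i) v) - m • rho)
            = bil ((30:ℤ) • v - m • rho) ((30:ℤ) • v - m • rho) + 60 * cc v i * m := by
          simp only [rfl', bil_sub_left, bil_sub_right, bil_smul_left, bil_smul_right, bil_al_left,
            bil_al_right, cc_rho, cc_al, cc_sub, cc_smul, Pi.sub_apply, Pi.smul_apply, smul_eq_mul]
          have : CartanMatrix.E₈ i i = 2 := by fin_cases i <;> rfl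
          rw [this]; ring
        rw [bil_self, bil_self] at this
        have h3 : 0 < - cc v i * m := mul_pos (by omega) hm
        push_cast at hv
        nlinarith
  intro v
  exact key (hn ((30:ℤ) • v - m • rho)).toNat v (Int.self_le_toNat _)

lemma bil_pos_le {v : Fin 8 → ℤ} (h : ∀ i, 0 ≤ cc v i) {l} (hl : IsRt l) (h0 : 0 ≤ l) :
    0 ≤ bil v l ∧ bil v l ≤ v 7 := by
  constructor
  · rw [bil_comm]; exact Finset.sum_nonneg fun i _ => mul_nonneg (h0 i) (h i)
  · rw [← bil_hi_right v, bil_comm, bil_comm v]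
    exact Finset.sum_le_sum fun i _ => mul_le_mul_of_nonneg_right (hl.le_hi h0 i) (h i)

/-- additive maps determined on simple roots -/
lemma map_eq_sum (w : (Fin 8 → ℤ) ≃+ (Fin 8 → ℤ)) (v) : w v = ∑ i, v i • w (al i) := by
  conv_lhs => rw [← sum_al v, map_sum]
  simp only [map_zsmul]

lemma nonneg_map (w : (Fin 8 → ℤ) ≃+ (Fin 8 → ℤ)) (h : ∀ i, 0 ≤ w (al i)) {v} (hv : 0 ≤ v) : 0 ≤ w v := by
  rw [map_eq_sum]
  intro j
  rw [Finset.sum_apply]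
  exact Finset.sum_nonneg fun i _ => mul_nonneg (hv i) (h i j)

lemma perm_of_cone (w : (Fin 8 → ℤ) ≃+ (Fin 8 → ℤ)) (h : ∀ i, 0 ≤ w (al i))
    (h' : ∀ i, 0 ≤ w.symm (al i)) (i) : ∃ j, w (al i) = al j := by
  have hp : ∀ j, 1 ≤ ∑ k, w.symm (al j) k := by
    intro j
    by_contra hcon
    have h3 : ∑ k, w.symm (al j) k = 0 := by
      have := Finset.sum_nonneg fun k (_ : k ∈ Finset.univ) => h' j k
      have h9 : 0 ≤ ∑ k, w.symm (al j) k := this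
      omega
    rw [Finset.sum_eq_zero_iff_of_nonneg (fun k _ => h' j k)] at h3
    have : w.symm (al j) = 0 := by ext k; exact h3 k (Finset.mem_univ k)
    rw [EmbeddingLike.map_eq_zero_iff] at this
    exact (isRt_al j).ne_zero this
  have e1 : al i = ∑ j, w (al i) j • w.symm (al j) := by
    rw [← map_eq_sum w.symm, w.symm_apply_apply]
  have e2 : ∑ k, al i k = ∑ j, w (al i) j * ∑ k, w.symm (al j) k := by
    conv_lhs => rw [e1]
    simp only [Finset.sum_apply, Pi.smul_apply, smul_eq_mul]
    rw [Finset.sum_comm]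
    simp only [Finset.mul_sum]
  have e3 : ∑ k, al i k = 1 := by simp [al]
  have e4 : ∑ j, w (al i) j ≤ 1 := by
    rw [← e3, e2]
    exact Finset.sum_le_sum fun j _ => le_mul_of_one_le_right (h i j) (hp j)
  obtain ⟨j, hj⟩ : ∃ j, w (al i) j ≠ 0 := by
    by_contra hcon
    push Not at hcon
    have : w (al i) = 0 := funext hcon
    rw [EmbeddingLike.map_eq_zero_iff] at this
    exact (isRt_al i).ne_zero this
  refine ⟨j, ?_⟩
  have hj1 : 1 ≤ w (al i) j := by have := h i j; simp only [Pi.zero_apply] at this; omega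
  have h5 : ∑ k ∈ Finset.univ.erase j, w (al i) k + w (al i) j = ∑ k, w (al i) k :=
    Finset.sum_erase_add _ _ (Finset.mem_univ j)
  have h6 : 0 ≤ ∑ k ∈ Finset.univ.erase j, w (al i) k := Finset.sum_nonneg fun k _ => h i k
  have h7 : ∑ k ∈ Finset.univ.erase j, w (al i) k = 0 := by omega
  rw [Finset.sum_eq_zero_iff_of_nonneg (fun k _ => h i k)] at h7
  ext k
  by_cases hk : k = j
  · subst hk
    have : al k k = 1 := by simp [al]
    omega
  · rw [h7 k (by simp [hk])]; simp [al, hk]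

lemma perm_trivial (w : (Fin 8 → ℤ) ≃+ (Fin 8 → ℤ)) (s : Fin 8 → Fin 8) (hs : ∀ i, w (al i) = al (s i))
    (hr : ∀ l, IsRt l ↔ IsRt (w l)) : ∀ v, w v = v := by
  have hinj : Function.Injective s := by
    intro i j hij
    have : w (al i) = w (al j) := by rw [hs, hs, hij]
    have := w.injective this
    have := congrFun this i
    by_contra hne
    simp [al, hne] at this
  have hadj : ∀ i j, CartanMatrix.E₈ i j = -1 → CartanMatrix.E₈ (s i) (s j) = -1 := by
    intro i j hij
    have h1 : IsRt (al j + al i) := by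
      rw [isRt_iff, hn_add_al, cc_al, hij, (isRt_iff _).1 (isRt_al j)]; norm_num
    rw [hr, map_add, hs, hs, isRt_iff, hn_add_al, cc_al, (isRt_iff _).1 (isRt_al _)] at h1
    omega
  have hwhi : w hi = hi := by
    have h0 : 0 ≤ w hi := nonneg_map w (fun i => by rw [hs]; exact al_apply_nonneg _)
      (fun i => by have := hi_pos i; simp; omega)
    have hle := ((hr hi).1 isRt_hi).le_hi h0
    have hsum : ∑ k, w hi k = ∑ k, hi k := by
      rw [map_eq_sum]
      simp only [Finset.sum_apply, hs, Pi.smul_apply, smul_eq_mul]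
      rw [Finset.sum_comm]
      simp only [← Finset.mul_sum]
      simp [al]
    ext k
    exact (Finset.sum_eq_sum_iff_of_le (fun i _ => hle i)).1 hsum k (Finset.mem_univ k)
  have hhi : ∀ i, hi (s i) = hi i := by
    intro i
    conv_lhs => rw [← hwhi, map_eq_sum]
    simp only [Finset.sum_apply, Pi.smul_apply, smul_eq_mul]
    simp only [hs]
    simp only [al, Pi.single_apply, hinj.eq_iff]
    simp
  have s3 : s 3 = 3 := by
    have := hhi 3; revert this; generalize s 3 = t; revert t; decide
  have s4 : s 4 = 4 := by
    have := hhi 4; revert this; generalize s 4 = t; revert t; decide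
  have s5 : s 5 = 5 := by
    have := hhi 5; have h2 := hadj 4 5 (by decide); rw [s4] at h2
    revert this h2; generalize s 5 = t; revert t; decide
  have s6 : s 6 = 6 := by
    have := hhi 6; have h2 := hadj 5 6 (by decide); rw [s5] at h2
    revert this h2; generalize s 6 = t; revert t; decide
  have s7 : s 7 = 7 := by
    have := hhi 7; have h2 := hadj 6 7 (by decide); rw [s6] at h2
    revert this h2; generalize s 7 = t; revert t; decide
  have s1 : s 1 = 1 := by
    have := hhi 1; have h2 := hadj 3 1 (by decide); rw [s3] at h2
    revert this h2; generalize s 1 = t; revert t; decide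
  have s2 : s 2 = 2 := by
    have := hhi 2; have h2 := hadj 3 2 (by decide); rw [s3] at h2
    revert this h2; generalize s 2 = t; revert t; decide
  have s0 : s 0 = 0 := by
    have := hhi 0; have h2 := hadj 2 0 (by decide); rw [s2] at h2
    revert this h2; generalize s 0 = t; revert t; decide
  have hsid : ∀ i, s i = i := by
    intro i; fin_cases i <;> assumption
  intro v
  rw [map_eq_sum]
  simp only [hs, hsid, sum_al]

theorem c1 {m : ℤ} (hm : 0 < m) : ∀ v : Fin 8 → ℤ, ∀ w : (Fin 8 → ℤ) ≃+ (Fin 8 → ℤ),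
    (∀ l, IsRt l ↔ IsRt (w l)) → (∀ l, IsRt l → ¬ m ∣ bil v l) →
    (∀ l, IsRt l → m ∣ bil v (w l) - bil v l) → ∀ l, w l = l := by
  have conj : ∀ (r) (hr : IsRt r) (v : Fin 8 → ℤ) (c : ℤ), 
      (∀ w : (Fin 8 → ℤ) ≃+ (Fin 8 → ℤ),
        (∀ l, IsRt l ↔ IsRt (w l)) → (∀ l, IsRt l → ¬ m ∣ bil (rfl' r v + (m * c) • r) l) →
        (∀ l, IsRt l → m ∣ bil (rfl' r v + (m * c) • r) (w l) - bil (rfl' r v + (m * c) • r) l) → 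
          ∀ l, w l = l) → 
      (∀ w : (Fin 8 → ℤ) ≃+ (Fin 8 → ℤ),
        (∀ l, IsRt l ↔ IsRt (w l)) → (∀ l, IsRt l → ¬ m ∣ bil v l) →
        (∀ l, IsRt l → m ∣ bil v (w l) - bil v l) → ∀ l, w l = l) := by
    intro r hr v c H w h1 h2 h3 l
    have hrr : ∀ l, IsRt l ↔ IsRt (rfl' r l) := fun l => 
      ⟨fun h => hr.rfl' h, fun h => by simpa [rfl'_rfl' hr] using hr.rfl' h⟩
    have e : ∀ l, bil (rfl' r v + (m * c) • r) l = bil v (rfl' r l) + m * (c * bil r l) := by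
      intro l; rw [bil_add_left, bil_rfl', bil_smul_left]; ring
    have := H ((rflE r hr).trans (w.trans (rflE r hr)))
      (fun l => by
        show _ ↔ IsRt (rfl' r (w (rfl' r l)))
        rw [← hrr, ← h1, ← hrr])
      (fun l hl hd => by
        rw [e] at hd
        exact h2 _ (hr.rfl' hl) ((dvd_add_left (dvd_mul_right _ _)).1 hd))
      (fun l hl => by
        show m ∣ bil _ (rfl' r (w (rfl' r l))) - _
        rw [e, e, rfl'_rfl' hr]
        have := h3 _ (hr.rfl' hl)
        have e2 : bil v (w (rfl' r l)) + m * (c * bil r (rfl' r (w (rfl' r l)))) -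
            (bil v (rfl' r l) + m * (c * bil r l)) = (bil v (w (rfl' r l)) - bil v (rfl' r l)) +
            m * ((c * bil r (rfl' r (w (rfl' r l)))) - (c * bil r l)) := by ring
        rw [e2]
        exact dvd_add this (dvd_mul_right _ _)) (rfl' r l)
    have h4 : rfl' r (w (rfl' r (rfl' r l))) = rfl' r l := this
    rw [rfl'_rfl' hr] at h4
    have := congrArg (rfl' r) h4
    rwa [rfl'_rfl' hr, rfl'_rfl' hr] at this
  refine alcove_ind (P := fun v => ∀ w : (Fin 8 → ℤ) ≃+ (Fin 8 → ℤ),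
    (∀ l, IsRt l ↔ IsRt (w l)) → (∀ l, IsRt l → ¬ m ∣ bil v l) →
    (∀ l, IsRt l → m ∣ bil v (w l) - bil v l) → ∀ l, w l = l) hm ?_ ?_ ?_
  · intro v hv h7 w hr hnd hcong
    have hpos : ∀ l, IsRt l → 0 ≤ l → 0 < bil v l ∧ bil v l < m := by
      intro l hl h0
      have h1 := bil_pos_le hv hl h0
      have h2 := hnd l hl
      constructor
      · rcases h1.1.lt_or_eq with h | h
        · exact h
        · exact absurd (by rw [← h]; simp) h2
      · rcases (h1.2.trans h7).lt_or_eq with h | h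
        · exact h
        · exact absurd (by rw [← h]) h2
    -- positive root: value preserved up to sign
    have hval : ∀ l, IsRt l → 0 ≤ l → (0 ≤ w l ∧ bil v (w l) = bil v l) ∨
        (¬ 0 ≤ w l ∧ bil v (w l) = bil v l - m) := by
      intro l hl h0
      obtain ⟨k, hk⟩ := hcong l hl
      have a1 := hpos l hl h0
      by_cases hs : 0 ≤ w l
      · left; refine ⟨hs, ?_⟩
        have a2 := hpos _ ((hr l).1 hl) hs
        have : k = 0 := by
          have b1 : m * k < m * 1 := by linarith
          have b2 : m * (-1) < m * k := by linarith
          have := lt_of_mul_lt_mul_left b1 hm.le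
          have := lt_of_mul_lt_mul_left b2 hm.le
          omega
        rw [this] at hk; linarith
      · right; refine ⟨hs, ?_⟩
        have hn : 0 ≤ - w l := by
          rcases ((hr l).1 hl).sign with h | h
          · exact absurd h hs
          · simpa using h
        have a2 := hpos _ (isRt_neg.2 ((hr l).1 hl)) hn
        rw [bil_neg_right] at a2
        have : k = -1 := by
          have b1 : m * k < m * 0 := by linarith
          have b2 : m * (-2) < m * k := by linarith
          have := lt_of_mul_lt_mul_left b1 hm.le
          have := lt_of_mul_lt_mul_left b2 hm.le
          omega
        rw [this] at hk; linarith
    have hhi0 : (0 : Fin 8 → ℤ) ≤ hi := fun i => by have := hi_pos i; simp; omega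
    classical
    have hsum : bil v (w hi) = bil v hi - m * ∑ i, (if 0 ≤ w (al i) then 0 else hi i) := by
      have : ∀ u : Fin 8 → ℤ, bil v (∑ i, hi i • w (al i)) = ∑ i, hi i * bil v (w (al i)) := by
        intro u
        have : ∀ (t : Finset (Fin 8)), bil v (∑ i ∈ t, hi i • w (al i)) = ∑ i ∈ t, hi i * bil v (w (al i)) := by
          intro t
          induction t using Finset.induction_on with
          | empty => simp [bil, cc_zero]
          | insert a t ha ih => rw [Finset.sum_insert ha, Finset.sum_insert ha, bil_add_right, ih, bil_smul_right]
        exact this _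
      rw [map_eq_sum, this 0, bil_comm v hi, bil, Finset.mul_sum, ← Finset.sum_sub_distrib]
      apply Finset.sum_congr rfl
      intro i _
      rcases hval (al i) (isRt_al i) (al_apply_nonneg i) with ⟨h, h'⟩ | ⟨h, h'⟩
      · rw [if_pos h, h', bil_al_right]; ring
      · rw [if_neg h, h', bil_al_right]; ring
    have hall : ∀ i, 0 ≤ w (al i) := by
      by_contra hcon
      push Not at hcon
      obtain ⟨i, hi'⟩ := hcon
      have h2 : 2 ≤ ∑ i, (if 0 ≤ w (al i) then 0 else hi i) := by
        refine le_trans ?_ (Finset.single_le_sum (f := fun i => if 0 ≤ w (al i) then 0 else hi i) (fun j _ => ?_) (Finset.mem_univ i))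
        · simp only [if_neg hi', hi_pos i]
        · split_ifs
          · exact le_rfl
          · have := hi_pos j; omega
      rcases hval hi isRt_hi hhi0 with ⟨_, h'⟩ | ⟨_, h'⟩ <;> rw [hsum] at h' <;> nlinarith
    have hall' : ∀ i, 0 ≤ w.symm (al i) := by
      intro i
      have h1 : IsRt (w.symm (al i)) := by rw [hr, w.apply_symm_apply]; exact isRt_al i
      rcases h1.sign with h | h
      · exact h
      · have h2 := nonneg_map w hall (v := - w.symm (al i)) (by simpa using h)
        rw [map_neg, w.apply_symm_apply] at h2
        have := h2 i
        simp [al] at this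
    choose s hs using perm_of_cone w hall hall'
    exact perm_trivial w s hs hr
  · intro v i h
    apply conj (al i) (isRt_al i) v 0
    simpa using h
  · intro v h
    apply conj hi isRt_hi v 1
    have : v - (v 7 - m) • hi = rfl' hi v + (m * 1) • hi := by
      rw [rfl', bil_hi_right, mul_one, sub_smul]; abel
    rwa [this] at h

theorem c2 {m : ℤ} (hm : 0 < m) : ∀ v : Fin 8 → ℤ,
    (∀ u, (∀ l, IsRt l → m ∣ bil v l → bil u l = 0) → u = 0) →
    ∃ j : ℕ, 1 ≤ j ∧ j ≤ 6 ∧ ∀ l, m ∣ j * bil v l := by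
  have conj : ∀ (r) (hr : IsRt r) (v : Fin 8 → ℤ) (c : ℤ), 
    ((∀ u, (∀ l, IsRt l → m ∣ bil (rfl' r v + (m * c) • r) l → bil u l = 0) → u = 0) →
    ∃ j : ℕ, 1 ≤ j ∧ j ≤ 6 ∧ ∀ l, m ∣ j * bil (rfl' r v + (m * c) • r) l) → 
    ((∀ u, (∀ l, IsRt l → m ∣ bil v l → bil u l = 0) → u = 0) →
    ∃ j : ℕ, 1 ≤ j ∧ j ≤ 6 ∧ ∀ l, m ∣ j * bil v l) := by
    intro r hr v c H h
    have e : ∀ l, bil (rfl' r v + (m * c) • r) l = bil v (rfl' r l) + m * (c * bil r l) := by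
      intro l; rw [bil_add_left, bil_rfl', bil_smul_left]; ring
    obtain ⟨j, h1, h2, h3⟩ := H (by
      intro u hu
      have : rfl' r u = 0 := by
        apply h
        intro l hl hd
        rw [bil_rfl']
        apply hu _ (hr.rfl' hl)
        rw [e, rfl'_rfl' hr]
        exact dvd_add hd (dvd_mul_right _ _)
      have h5 := congrArg (rfl' r) this
      rw [rfl'_rfl' hr] at h5
      rw [h5]; simp [rfl', bil])
    refine ⟨j, h1, h2, fun l => ?_⟩
    have := h3 (rfl' r l)
    rw [e, rfl'_rfl' hr, mul_add, mul_left_comm] at this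
    exact (dvd_add_left (dvd_mul_right _ _)).1 this
  refine alcove_ind (P := fun v => 
    (∀ u, (∀ l, IsRt l → m ∣ bil v l → bil u l = 0) → u = 0) →
    ∃ j : ℕ, 1 ≤ j ∧ j ≤ 6 ∧ ∀ l, m ∣ j * bil v l) hm ?_ ?_ ?_
  · intro v hv h7 hspan
    have hsig : ∀ u, (∀ l, IsRt l → 0 ≤ l → m ∣ bil v l → bil u l = 0) → u = 0 := by
      intro u hu
      apply hspan
      intro l hl hd
      rcases hl.sign with h | h
      · exact hu l hl h hd
      · have := hu (-l) (isRt_neg.2 hl) (by simpa using h) (by rw [bil_neg_right]; exact hd.neg_right)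
        rw [bil_neg_right] at this; omega
    have hz : ∀ l : Fin 8 → ℤ, 0 ≤ l → bil v l = 0 → ∀ i, 0 < cc v i → l i = 0 := by
      intro l h0 hb i hi
      rw [bil_comm, bil, Finset.sum_eq_zero_iff_of_nonneg (fun i _ => mul_nonneg (h0 i) (hv i))] at hb
      have := hb i (Finset.mem_univ i)
      rcases mul_eq_zero.1 this with h | h
      · exact h
      · omega
    by_cases hv7 : v 7 < m
    · -- only zero
      have hall : ∀ i, cc v i = 0 := by
        intro i
        by_contra hne
        have hpos : 0 < cc v i := lt_of_le_of_ne (hv i) (Ne.symm hne)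
        have : om i = 0 := by
          apply hsig
          intro l hl h0 hd
          rw [bil_om]
          have b := bil_pos_le hv hl h0
          exact hz l h0 (Int.eq_zero_of_dvd_of_nonneg_of_lt b.1 (by omega) hd) i hpos
        have h2 := cc_om i
        rw [this, cc_zero] at h2
        exact (isRt_al i).ne_zero h2.symm
      refine ⟨1, le_rfl, by norm_num, fun l => ?_⟩
      rw [bil_nondeg hall]; simp [bil]
    · have hv7' : v 7 = m := by omega
      have hs7 : v 7 = ∑ i, hi i * cc v i := by rw [← bil_hi_left v]; rfl
      obtain ⟨i, hi0⟩ : ∃ i, 0 < cc v i := by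
        by_contra hcon
        push Not at hcon
        have : v 7 ≤ 0 := by
          rw [hs7]
          exact Finset.sum_nonpos fun i _ => mul_nonpos_of_nonneg_of_nonpos (by have := hi_pos i; omega) (hcon i)
        omega
      have huniq : ∀ j, j ≠ i → cc v j = 0 := by
        intro j hj
        by_contra hne
        have hpos : 0 < cc v j := lt_of_le_of_ne (hv j) (Ne.symm hne)
        have : hi j • om i - hi i • om j = 0 := by
          apply hsig
          intro l hl h0 hd
          rw [bil_sub_left, bil_smul_left, bil_smul_left, bil_om, bil_om]
          have b := bil_pos_le hv hl h0
          rcases (b.2.trans h7).lt_or_eq with hlt | heq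
          · have h8 := hz l h0 (Int.eq_zero_of_dvd_of_nonneg_of_lt b.1 hlt hd)
            rw [h8 i hi0, h8 j hpos]; ring
          · have h8 := hz (hi - l) (sub_nonneg.2 (hl.le_hi h0)) (by
              rw [bil_sub_right, bil_hi_right, heq, hv7', sub_self])
            have e1 := h8 i hi0
            have e2 := h8 j hpos
            simp only [Pi.sub_apply] at e1 e2
            have e1' : l i = hi i := by omega
            have e2' : l j = hi j := by omega
            rw [e1', e2']; ring
        have h2 := congrArg (fun u => cc u i) this
        simp only [cc_sub, cc_smul, cc_om, cc_zero] at h2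
        simp [al, hj.symm] at h2
        have := hi_pos j
        omega
      have hmi : m = hi i * cc v i := by
        rw [← hv7', hs7]
        apply Finset.sum_eq_single i
        · intro j _ hj; rw [huniq j hj]; ring
        · simp
      refine ⟨(hi i).toNat, ?_, ?_, fun l => ?_⟩
      · have := hi_pos i; omega
      · have := hi_le i; omega
      · have : bil v l = l i * cc v i := by
          rw [bil_comm]
          apply Finset.sum_eq_single i
          · intro j _ hj; rw [huniq j hj]; ring
          · simp
        have h9 : ((hi i).toNat : ℤ) = hi i := Int.toNat_of_nonneg (by have := hi_pos i; omega)
        rw [this, hmi, h9]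
        exact ⟨l i, by ring⟩
  · intro v i h
    apply conj (al i) (isRt_al i) v 0
    simpa using h
  · intro v h
    apply conj hi isRt_hi v 1
    have : v - (v 7 - m) • hi = rfl' hi v + (m * 1) • hi := by
      rw [rfl', bil_hi_right, mul_one, sub_smul]; abel
    rwa [this] at h

end E8P

namespace E8P

section exp

lemma sum_antidiag {M : Type*} [AddCommMonoid M] (n : ℕ) (f : ℕ → ℕ → M)
    (h : ∀ i j, n ≤ i ∨ n ≤ j → f i j = 0) :
    ∑ m ∈ Finset.range (2 * n), ∑ p ∈ Finset.HasAntidiagonal.antidiagonal m, f p.1 p.2 =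
      ∑ i ∈ Finset.range n, ∑ j ∈ Finset.range n, f i j := by
  rw [← Finset.sum_product', ← Finset.sum_fiberwise_of_maps_to
    (s := Finset.range n ×ˢ Finset.range n) (t := Finset.range (2 * n)) (g := fun p => p.1 + p.2)]
  · apply Finset.sum_congr rfl
    intro m _
    symm
    apply Finset.sum_subset
    · intro p hp
      simp only [Finset.mem_filter] at hp
      simpa using hp.2
    · intro p hp hp'
      apply h
      by_contra hcon
      push Not at hcon
      apply hp'
      simp only [Finset.mem_filter, Finset.mem_product, Finset.mem_range]
      exact ⟨hcon, by simpa using hp⟩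
  · intro p hp
    simp only [Finset.mem_product, Finset.mem_range] at hp ⊢
    omega

variable {F : Type*} [Field F] [CharZero F] {L : Type*} [LieRing L] [LieAlgebra F L]

/-- locally nilpotent -/
def LocNil (D : L →ₗ[F] L) : Prop := ∀ x, ∃ n, (D ^ n) x = 0

/-- exponential of a locally nilpotent map -/
noncomputable def expFun (D : L →ₗ[F] L) (x : L) : L := ∑ᶠ k : ℕ, ((k.factorial : F)⁻¹) • (D ^ k) x

lemma pow_zero_of_le {D : L →ₗ[F] L} {x : L} {n m : ℕ} (h : (D ^ n) x = 0) (hnm : n ≤ m) : (D ^ m) x = 0 := by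
  obtain ⟨k, rfl⟩ := Nat.exists_eq_add_of_le hnm
  rw [add_comm, pow_add, Module.End.mul_apply, h, map_zero]

lemma expFun_eq {D : L →ₗ[F] L} {x : L} {n : ℕ} (h : (D ^ n) x = 0) :
    expFun D x = ∑ k ∈ Finset.range n, ((k.factorial : F)⁻¹) • (D ^ k) x := by
  apply finsum_eq_sum_of_support_subset
  intro k hk
  simp only [Finset.coe_range, Set.mem_Iio]
  by_contra hcon
  apply hk
  simp only
  rw [pow_zero_of_le h (not_lt.1 hcon), smul_zero]

lemma expFun_add {D : L →ₗ[F] L} (hD : LocNil D) (x y : L) : expFun D (x + y) = expFun D x + expFun D y := by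
  obtain ⟨n, hn⟩ := hD x
  obtain ⟨m, hm⟩ := hD y
  have h1 := pow_zero_of_le hn (le_max_left n m)
  have h2 := pow_zero_of_le hm (le_max_right n m)
  have h3 : (D ^ (max n m)) (x + y) = 0 := by rw [map_add, h1, h2, add_zero]
  rw [expFun_eq h1, expFun_eq h2, expFun_eq h3, ← Finset.sum_add_distrib]
  simp

lemma expFun_smul {D : L →ₗ[F] L} (hD : LocNil D) (c : F) (x : L) : expFun D (c • x) = c • expFun D x := by
  obtain ⟨n, hn⟩ := hD x
  have h3 : (D ^ n) (c • x) = 0 := by rw [map_smul, hn, smul_zero]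
  rw [expFun_eq hn, expFun_eq h3, Finset.smul_sum]
  simp [smul_comm c]

lemma pow_neg_apply (D : L →ₗ[F] L) (k : ℕ) (x : L) : ((-D) ^ k) x = (-1 : F) ^ k • (D ^ k) x := by
  induction k generalizing x with
  | zero => simp
  | succ k ih => rw [pow_succ, Module.End.mul_apply, ih, pow_succ D, Module.End.mul_apply]; simp [pow_succ]

lemma LocNil.neg {D : L →ₗ[F] L} (hD : LocNil D) : LocNil (-D) := by
  intro x
  obtain ⟨n, hn⟩ := hD x
  exact ⟨n, by rw [pow_neg_apply, hn, smul_zero]⟩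

lemma expFun_neg {D : L →ₗ[F] L} (hD : LocNil D) (x : L) : expFun (-D) (expFun D x) = x := by
  obtain ⟨n, hn⟩ := hD x
  have h1 : (D ^ n) (expFun D x) = 0 := by
    rw [expFun_eq hn, map_sum]
    apply Finset.sum_eq_zero
    intro k _
    rw [map_smul, ← Module.End.mul_apply, ← pow_add, pow_zero_of_le hn (by omega), smul_zero]
  have h2 : ((-D) ^ n) (expFun D x) = 0 := by rw [pow_neg_apply, h1, smul_zero]
  rw [expFun_eq h2, expFun_eq hn]
  have e : ∀ k ∈ Finset.range n, ((k.factorial : F)⁻¹) • ((-D) ^ k) (∑ l ∈ Finset.range n, ((l.factorial : F)⁻¹) • (D ^ l) x)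
      = ∑ l ∈ Finset.range n, ((k.factorial : F)⁻¹ * (l.factorial : F)⁻¹ * (-1)^k) • (D ^ (k + l)) x := by
    intro k _
    rw [pow_neg_apply, map_sum, Finset.smul_sum, Finset.smul_sum]
    apply Finset.sum_congr rfl
    intro l _
    rw [map_smul, smul_smul, smul_smul, pow_add, Module.End.mul_apply]
    congr 1; ring
  rw [Finset.sum_congr rfl e, ← sum_antidiag n (fun k l => ((k.factorial : F)⁻¹ * (l.factorial : F)⁻¹ * (-1)^k) • (D ^ (k + l)) x)]
  · have e2 : ∀ m ∈ Finset.range (2 * n), ∑ p ∈ Finset.HasAntidiagonal.antidiagonal m, ((p.1.factorial : F)⁻¹ * (p.2.factorial : F)⁻¹ * (-1)^p.1) • (D ^ (p.1 + p.2)) x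
        = if m = 0 then x else 0 := by
      intro m _
      have : ∀ p ∈ Finset.HasAntidiagonal.antidiagonal m, ((p.1.factorial : F)⁻¹ * (p.2.factorial : F)⁻¹ * (-1)^p.1) • (D ^ (p.1 + p.2)) x
          = (((m.factorial : F)⁻¹) * ((m.choose p.1 : F) * (-1)^p.1)) • (D ^ m) x := by
        intro p hp
        rw [Finset.HasAntidiagonal.mem_antidiagonal] at hp
        subst hp
        congr 1
        rw [Nat.cast_add_choose]
        have := Nat.cast_ne_zero (R := F).2 (Nat.factorial_ne_zero (p.1 + p.2))
        field_simp
      rw [Finset.sum_congr rfl this, ← Finset.sum_smul, ← Finset.mul_sum]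
      have h4 : ∑ p ∈ Finset.HasAntidiagonal.antidiagonal m, ((m.choose p.1 : F) * (-1)^p.1) = if m = 0 then 1 else 0 := by
        rw [Finset.Nat.sum_antidiagonal_eq_sum_range_succ_mk]
        have := Int.alternating_sum_range_choose (n := m)
        have := congrArg (Int.cast : ℤ → F) this
        push_cast at this
        simp only [mul_comm _ ((-1 : F) ^ _)]
        simpa using this
      rw [h4]
      split_ifs with h0
      · subst h0; simp
      · simp
    rw [Finset.sum_congr rfl e2]
    rw [Finset.sum_ite_eq']
    split_ifs with h0
    · rfl
    · have : n = 0 := by simpa using h0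
      subst this; simpa using hn.symm
  · intro i j hij
    rw [pow_zero_of_le hn (by omega), smul_zero]

lemma expFun_lie {D : LieDerivation F L L} (hD : LocNil (D : L →ₗ[F] L)) (x y : L) :
    expFun (D : L →ₗ[F] L) ⁅x, y⁆ = ⁅expFun (D : L →ₗ[F] L) x, expFun (D : L →ₗ[F] L) y⁆ := by
  obtain ⟨n', hn'⟩ := hD x
  obtain ⟨m', hm'⟩ := hD y
  set n := max n' m'
  have h1 := pow_zero_of_le hn' (le_max_left n' m')
  have h2 := pow_zero_of_le hm' (le_max_right n' m')
  have hl : ∀ m, ((D : L →ₗ[F] L) ^ m) ⁅x, y⁆ = ∑ p ∈ Finset.HasAntidiagonal.antidiagonal m, (m.choose p.1) • ⁅((D : L →ₗ[F] L) ^ p.1) x, ((D : L →ₗ[F] L) ^ p.2) y⁆ := by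
    intro m
    have := LieDerivation.iterate_apply_lie D m x y
    simp only [Module.End.pow_apply]
    exact this
  have hz : ∀ i j, n ≤ i ∨ n ≤ j → ⁅((D : L →ₗ[F] L) ^ i) x, ((D : L →ₗ[F] L) ^ j) y⁆ = 0 := by
    rintro i j (h | h)
    · rw [pow_zero_of_le h1 h, zero_lie]
    · rw [pow_zero_of_le h2 h, lie_zero]
  have h3 : ((D : L →ₗ[F] L) ^ (2 * n)) ⁅x, y⁆ = 0 := by
    rw [hl]
    apply Finset.sum_eq_zero
    intro p hp
    rw [Finset.HasAntidiagonal.mem_antidiagonal] at hp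
    rw [hz _ _ (by omega), smul_zero]
  rw [expFun_eq h1, expFun_eq h2, expFun_eq h3]
  simp only [sum_lie, lie_sum]
  have := sum_antidiag n (fun i j => ((i.factorial : F)⁻¹ * (j.factorial : F)⁻¹) • ⁅((D : L →ₗ[F] L) ^ i) x, ((D : L →ₗ[F] L) ^ j) y⁆)
    (fun i j hij => by rw [hz i j hij, smul_zero])
  have e1 : ∀ m ∈ Finset.range (2 * n), ((m.factorial : F)⁻¹) • ((D : L →ₗ[F] L) ^ m) ⁅x, y⁆ = ∑ p ∈ Finset.HasAntidiagonal.antidiagonal m, ((p.1.factorial : F)⁻¹ * (p.2.factorial : F)⁻¹) • ⁅((D : L →ₗ[F] L) ^ p.1) x, ((D : L →ₗ[F] L) ^ p.2) y⁆ := by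
    intro m _
    rw [hl, Finset.smul_sum]
    apply Finset.sum_congr rfl
    intro p hp
    rw [Finset.HasAntidiagonal.mem_antidiagonal] at hp
    subst hp
    rw [← Nat.cast_smul_eq_nsmul F, smul_smul]
    congr 1
    rw [Nat.cast_add_choose]
    have := Nat.cast_ne_zero (R := F).2 (Nat.factorial_ne_zero (p.1 + p.2))
    field_simp
  rw [Finset.sum_congr rfl e1, this, Finset.sum_comm]
  simp only [smul_lie, lie_smul, smul_smul]
  exact Finset.sum_congr rfl fun _ _ => Finset.sum_congr rfl fun _ _ => by rw [mul_comm]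

/-- exponential of a locally nilpotent derivation, as an automorphism -/
noncomputable def expAut (D : LieDerivation F L L) (hD : LocNil (D : L →ₗ[F] L)) : L ≃ₗ⁅F⁆ L where
  toFun := expFun (D : L →ₗ[F] L)
  map_add' := expFun_add hD
  map_smul' := expFun_smul hD
  map_lie' := expFun_lie hD _ _
  invFun := expFun (-(D : L →ₗ[F] L))
  left_inv := expFun_neg hD
  right_inv := fun x => by
    have := expFun_neg hD.neg x
    rwa [neg_neg] at this

lemma expAut_apply (D : LieDerivation F L L) (hD : LocNil (D : L →ₗ[F] L)) (x : L) :
    expAut D hD x = expFun (D : L →ₗ[F] L) x := rfl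

end exp
end E8P

namespace E8P
open MvPolynomial

section dominant
variable {F : Type*} [Field F] [CharZero F] {ι : Type*} [Fintype ι] [DecidableEq ι]

lemma pderiv_aeval (f : ι → MvPolynomial ι F) (j : ι) (P : MvPolynomial ι F) :
    pderiv j (aeval f P) = ∑ i, aeval f (pderiv i P) * pderiv j (f i) := by
  induction P using MvPolynomial.induction_on with
  | C a => simp [algebraMap_eq]
  | add p q hp hq => simp only [map_add, hp, hq, add_mul, Finset.sum_add_distrib]
  | mul_X p k hp =>
    simp only [map_mul, aeval_X, pderiv_mul, hp, map_add, pderiv_X, add_mul, Finset.sum_add_distrib,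
      Finset.sum_mul]
    congr 1
    · exact Finset.sum_congr rfl fun i _ => by ring
    · simp [Pi.single_apply, apply_ite, Finset.sum_ite_eq]

lemma aeval_injective (f : ι → MvPolynomial ι F) (a : ι → F)
    (hJ : (Matrix.of fun i j => eval a (pderiv j (f i))).det ≠ 0) :
    Function.Injective (aeval f : MvPolynomial ι F →ₐ[F] MvPolynomial ι F) := by
  rw [injective_iff_map_eq_zero]
  have hst : ∀ P : MvPolynomial ι F, aeval f P = 0 → ∀ i, aeval f (pderiv i P) = 0 := by
    intro P hP
    set J : Matrix ι ι (MvPolynomial ι F) := Matrix.of fun i j => pderiv j (f i) with hJd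
    have hdet : J.det ≠ 0 := by
      intro h0
      apply hJ
      have := congrArg (eval a) h0
      rw [RingHom.map_det, map_zero] at this
      exact this
    have hv : Matrix.vecMul (fun i => aeval f (pderiv i P)) J = 0 := by
      ext1 j
      have := pderiv_aeval f j P
      rw [hP, map_zero] at this
      rw [Matrix.vecMul, dotProduct]
      exact this.symm
    have := Matrix.eq_zero_of_vecMul_eq_zero hdet hv
    exact fun i => congrFun this i
  have key : ∀ n : ℕ, ∀ P : MvPolynomial ι F, aeval f P = 0 →
      (∀ s : ι →₀ ℕ, n ≤ s.degree → coeff s P = 0) → P = 0 := by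
    intro n
    induction n with
    | zero => intro P _ h; ext s; simpa using h s (Nat.zero_le _)
    | succ n ih =>
      intro P hP h
      have hd : ∀ i, pderiv i P = 0 := by
        intro i
        apply ih _ (hst P hP i)
        intro s hs
        rw [coeff_pderiv, h, zero_mul]
        simpa using hs
      have hc : P = C (coeff 0 P) := by
        ext s
        rw [coeff_C]
        split_ifs with h0
        · rw [h0]
        · obtain ⟨i, hi⟩ : ∃ i, s i ≠ 0 := by
            by_contra hcon
            push Not at hcon
            exact h0 (Finsupp.ext fun i => (hcon i).symm)
          have h1 := coeff_pderiv (i := i) P (s - Finsupp.single i 1)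
          rw [hd i, coeff_zero] at h1
          have h2 : s - Finsupp.single i 1 + Finsupp.single i 1 = s := by
            ext k
            by_cases hk : k = i
            · subst hk; simp; omega
            · simp [Finsupp.single_apply, Ne.symm hk]
          rw [h2] at h1
          rcases mul_eq_zero.1 h1.symm with h3 | h3
          · exact h3
          · exact absurd h3 (Nat.cast_add_one_ne_zero _)
      rw [hc] at hP ⊢
      rw [aeval_C, algebraMap_eq, C_eq_zero] at hP
      rw [hP, C_0]
  intro P hP
  refine key (P.totalDegree + 1) P hP fun s hs => ?_
  by_contra hne
  have := le_totalDegree (mem_support_iff.2 hne)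
  have h2 : s.degree = s.sum fun _ e => e := rfl
  omega

theorem dominant [IsAlgClosed F] (f : ι → MvPolynomial ι F) (a : ι → F)
    (hJ : (Matrix.of fun i j => eval a (pderiv j (f i))).det ≠ 0) :
    ∃ P : MvPolynomial ι F, P ≠ 0 ∧ ∀ v, eval v P ≠ 0 → ∃ u, ∀ i, eval u (f i) = v i := by
  set φ : MvPolynomial ι F →ₐ[F] MvPolynomial ι F := aeval f with hφ
  have hinj : Function.Injective φ := aeval_injective f a hJ
  have hfp : φ.toRingHom.FinitePresentation := by
    rw [← RingHom.FinitePresentation.of_finiteType]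
    have h1 : (φ.toRingHom.comp (C : F →+* MvPolynomial ι F)).FiniteType := by
      have : φ.toRingHom.comp (C : F →+* MvPolynomial ι F) = algebraMap F _ := by
        ext x; simp [hφ]
      rw [this]
      exact RingHom.finiteType_algebraMap.2 inferInstance
    exact RingHom.FiniteType.of_comp_finiteType h1
  have hcons := PrimeSpectrum.isConstructible_range_comap hfp
  have key : ∀ S : Set (PrimeSpectrum (MvPolynomial ι F)), Topology.IsConstructible S →
      ((⊥ ∈ S → ∃ P : MvPolynomial ι F, P ≠ 0 ∧ (PrimeSpectrum.basicOpen P : Set _) ⊆ S) ∧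
       (⊥ ∉ S → ∃ P : MvPolynomial ι F, P ≠ 0 ∧ (PrimeSpectrum.basicOpen P : Set _) ⊆ Sᶜ)) := by
    intro S hS
    induction hS using Topology.IsConstructible.empty_union_induction with
    | open_retrocompact U hU _ =>
      constructor
      · intro hb
        obtain ⟨_, ⟨P, rfl⟩, h1, h2⟩ := PrimeSpectrum.isTopologicalBasis_basic_opens.exists_subset_of_mem_open hb hU
        refine ⟨P, ?_, h2⟩
        rintro rfl
        simp at h1
      · intro hb
        have : U = ∅ := by
          by_contra hne
          obtain ⟨x, hx⟩ := Set.nonempty_iff_ne_empty.2 hne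
          apply hb
          have : (⊥ : PrimeSpectrum (MvPolynomial ι F)) ⤳ x := by
            rw [← PrimeSpectrum.le_iff_specializes]; exact bot_le
          exact this.mem_open hU hx
        exact ⟨1, one_ne_zero, by simp [this]⟩
    | union s hs t ht h1 h2 =>
      constructor
      · rintro (h | h)
        · obtain ⟨P, hP, hs⟩ := h1.1 h
          exact ⟨P, hP, hs.trans Set.subset_union_left⟩
        · obtain ⟨P, hP, hs⟩ := h2.1 h
          exact ⟨P, hP, hs.trans Set.subset_union_right⟩
      · intro h
        obtain ⟨P, hP, hs⟩ := h1.2 (fun h' => h (Or.inl h'))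
        obtain ⟨P', hP', hs'⟩ := h2.2 (fun h' => h (Or.inr h'))
        refine ⟨P * P', mul_ne_zero hP hP', ?_⟩
        rw [Set.compl_union]
        refine Set.subset_inter ?_ ?_
        · exact fun x hx => hs (PrimeSpectrum.basicOpen_mul_le_left _ _ hx)
        · exact fun x hx => hs' (PrimeSpectrum.basicOpen_mul_le_right _ _ hx)
    | compl s hs h =>
      refine ⟨fun h' => h.2 h', fun h' => ?_⟩
      rw [compl_compl]
      exact h.1 (by simpa using h')
  obtain ⟨P, hP, hsub⟩ := (key _ hcons).1 ⟨⊥, by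
    ext x
    simp only [PrimeSpectrum.comap_asIdeal, Ideal.mem_comap]
    show φ x ∈ (⊥ : Ideal _) ↔ x ∈ (⊥ : Ideal _)
    rw [Ideal.mem_bot, Ideal.mem_bot, map_eq_zero_iff φ hinj]⟩
  refine ⟨P, hP, fun v hv => ?_⟩
  have hmax : (RingHom.ker (eval v)).IsMaximal := RingHom.ker_isMaximal_of_surjective _ (fun c => ⟨C c, by simp⟩)
  obtain ⟨q, hq⟩ := hsub (show (⟨RingHom.ker (eval v), hmax.isPrime⟩ : PrimeSpectrum (MvPolynomial ι F)) ∈ _ from hv)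
  obtain ⟨M, hM, hqM⟩ := Ideal.exists_le_maximal q.asIdeal q.2.ne_top
  obtain ⟨u, hu⟩ := isMaximal_iff_eq_vanishingIdeal_singleton.1 hM
  refine ⟨u, fun i => ?_⟩
  have h1 : X i - C (v i) ∈ RingHom.ker (eval v) := by simp [RingHom.mem_ker]
  have h2 : φ (X i - C (v i)) ∈ q.asIdeal := by
    have := congrArg PrimeSpectrum.asIdeal hq
    simp only [PrimeSpectrum.comap_asIdeal] at this
    rw [← this] at h1
    exact h1
  have h3 := hqM h2
  rw [hu, mem_vanishingIdeal_singleton_iff] at h3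
  simpa [hφ, sub_eq_zero, coe_aeval_eq_eval] using h3

end dominant
end E8P

namespace E8P
open MvPolynomial

section conj
variable {F : Type*} [Field F] [CharZero F] {L : Type*} [LieRing L] [LieAlgebra F L]

lemma eigen_zero {ι : Type*} (b : Module.Basis ι F L) (y : L) (μ : ι → F)
    (hb : ∀ i, ⁅y, b i⁆ = μ i • b i) (ν : F) (hν : ∀ i, μ i ≠ ν) (x : L) (hx : ⁅y, x⁆ = ν • x) : x = 0 := by
  apply b.ext_elem
  intro i
  have h1 : ∀ x, b.repr ⁅y, x⁆ i = μ i * b.repr x i := by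
    intro x
    have : (b.coord i) ∘ₗ (LieAlgebra.ad F L y : L →ₗ[F] L) = μ i • b.coord i := by
      apply b.ext
      intro j
      by_cases hji : j = i
      · subst hji; simp [hb]
      · simp [hb, Finsupp.single_apply, hji]
    exact LinearMap.congr_fun this x
  have h2 := h1 x
  rw [hx] at h2
  simp only [map_smul, Finsupp.smul_apply, smul_eq_mul] at h2
  have : (ν - μ i) * b.repr x i = 0 := by rw [sub_mul, h2, sub_self]
  rcases mul_eq_zero.1 this with h | h
  · exact absurd (sub_eq_zero.1 h).symm (hν i)
  · simpa using h

lemma locNil_of_basis {ι : Type*} (b : Module.Basis ι F L) (D : L →ₗ[F] L) (h : ∀ i, ∃ n, (D ^ n) (b i) = 0) :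
    LocNil D := by
  intro x
  induction b.mem_span x using Submodule.span_induction with
  | zero => exact ⟨0, by simp⟩
  | mem x hx => obtain ⟨i, rfl⟩ := hx; exact h i
  | add x y _ _ hx hy =>
    obtain ⟨n, hn⟩ := hx
    obtain ⟨m, hm⟩ := hy
    exact ⟨max n m, by rw [map_add, pow_zero_of_le hn (le_max_left _ _), pow_zero_of_le hm (le_max_right _ _), add_zero]⟩
  | smul c x _ hx =>
    obtain ⟨n, hn⟩ := hx
    exact ⟨n, by rw [map_smul, hn, smul_zero]⟩

lemma locNil_uniform [Module.Finite F L] (D : L →ₗ[F] L) (h : LocNil D) : ∃ n, D ^ n = 0 := by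
  let b := Module.finBasis F L
  choose n hn using fun i => h (b i)
  refine ⟨∑ i, n i, b.ext fun i => ?_⟩
  exact pow_zero_of_le (hn i) (Finset.single_le_sum (f := n) (fun _ _ => Nat.zero_le _) (Finset.mem_univ i))

lemma locNil_of_eigen {ι : Type*} [Finite ι] (b : Module.Basis ι F L) (y : L) (μ : ι → F)
    (hb : ∀ i, ⁅y, b i⁆ = μ i • b i) (ν : F) (hν : ν ≠ 0) (x : L) (hx : ⁅y, x⁆ = ν • x) :
    LocNil (LieAlgebra.ad F L x : L →ₗ[F] L) := by
  apply locNil_of_basis b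
  intro i
  have h1 : ∀ k : ℕ, ⁅y, ((LieAlgebra.ad F L x : L →ₗ[F] L) ^ k) (b i)⁆ = (μ i + k * ν) • ((LieAlgebra.ad F L x : L →ₗ[F] L) ^ k) (b i) := by
    intro k
    induction k with
    | zero => simp [hb]
    | succ k ih =>
      rw [pow_succ', Module.End.mul_apply, LieAlgebra.ad_apply, leibniz_lie, hx, ih, lie_smul, smul_lie, ← add_smul]
      congr 1; push_cast; ring
  obtain ⟨k, hk⟩ : ∃ k : ℕ, (μ i + k * ν) ∉ Set.range μ := by
    by_contra hcon
    push Not at hcon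
    have hinj : Function.Injective (fun k : ℕ => μ i + k * ν) := by
      intro a c hac
      have : (a : F) * ν = c * ν := by simpa using hac
      exact_mod_cast mul_right_cancel₀ hν this
    exact Set.infinite_range_of_injective hinj ((Set.finite_range μ).subset (Set.range_subset_iff.2 hcon))
  refine ⟨k, eigen_zero b y μ hb _ (fun j hj => hk ⟨j, hj⟩) _ (h1 k)⟩

/-- generic subsets -/
def Gen [Module.Finite F L] (S : Set L) : Prop :=
  ∃ P : MvPolynomial (Fin (Module.finrank F L)) F, P ≠ 0 ∧ ∀ v, eval ((Module.finBasis F L).repr v) P ≠ 0 → v ∈ S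

lemma exists_eval_ne {σ : Type*} {P : MvPolynomial σ F} (hP : P ≠ 0) : ∃ v, eval v P ≠ 0 := by
  by_contra hcon
  push Not at hcon
  exact hP (MvPolynomial.funext (by simpa using hcon))

lemma Gen.inter [Module.Finite F L] {S T : Set L} (hS : Gen (F := F) S) (hT : Gen (F := F) T) : Gen (F := F) (S ∩ T) := by
  obtain ⟨P, hP, h⟩ := hS
  obtain ⟨P', hP', h'⟩ := hT
  refine ⟨P * P', mul_ne_zero hP hP', fun v hv => ?_⟩
  rw [map_mul] at hv
  exact ⟨h v (left_ne_zero_of_mul hv), h' v (right_ne_zero_of_mul hv)⟩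

lemma Gen.nonempty [Module.Finite F L] {S : Set L} (hS : Gen (F := F) S) : S.Nonempty := by
  obtain ⟨P, hP, h⟩ := hS
  obtain ⟨v, hv⟩ := exists_eval_ne hP
  refine ⟨(Module.finBasis F L).equivFun.symm v, h _ ?_⟩
  convert hv
  ext i
  exact congrFun ((Module.finBasis F L).equivFun.apply_symm_apply v) i

lemma gen_of_basis [Module.Finite F L] {ι : Type*} [Fintype ι] (b : Module.Basis ι F L) {S : Set L}
    (P : MvPolynomial ι F) (hP : P ≠ 0) (h : ∀ v, eval (b.repr v) P ≠ 0 → v ∈ S) : Gen (F := F) S := by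
  let b' := Module.finBasis F L
  let P' : MvPolynomial (Fin (Module.finrank F L)) F := aeval (fun i => ∑ j, C (b.repr (b' j) i) * X j) P
  have e : ∀ v, eval (b'.repr v) P' = eval (b.repr v) P := by
    intro v
    have : (eval (b'.repr v : _ → F)) ((aeval (fun i => ∑ j, C (b.repr (b' j) i) * X j)) P) = _ := rfl
    have h2 : eval (b'.repr v) P' = eval (fun i => eval (b'.repr v) (∑ j, C (b.repr (b' j) i) * X j)) P := by
      simp only [P', aeval_def, eval_eval₂, algebraMap_eq]
      congr 1
      ext x; simp
    rw [h2]
    congr 2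
    ext i
    simp only [map_sum, map_mul, eval_C, eval_X]
    conv_rhs => rw [← b'.sum_repr v, map_sum, Finsupp.coe_finsetSum, Finset.sum_apply]
    simp only [map_smul, Finsupp.smul_apply, smul_eq_mul, mul_comm]
  refine ⟨P', ?_, fun v hv => h v (by rw [← e]; exact hv)⟩
  intro h0
  obtain ⟨u, hu⟩ := exists_eval_ne hP
  apply hu
  have := e (b.equivFun.symm u)
  rw [h0, map_zero] at this
  convert this.symm
  ext i
  exact (congrFun (b.equivFun.apply_symm_apply u) i).symm

section step
variable {ι : Type*} [Fintype ι] [DecidableEq ι] (b : Module.Basis ι F L) (N : ℕ)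

/-- coordinates of `exp (X i • ad (b i))` applied to a polynomial vector -/
noncomputable def stepv (i : ι) (g : ι → MvPolynomial ι F) (r : ι) : MvPolynomial ι F :=
  ∑ k ∈ Finset.range N, C ((k.factorial : F)⁻¹) * X i ^ k *
    ∑ s, C (b.repr (((LieAlgebra.ad F L (b i) : L →ₗ[F] L) ^ k) (b s)) r) * g s

/-- evaluation of a polynomial vector -/
noncomputable def evv (u : ι → F) (g : ι → MvPolynomial ι F) : L := ∑ s, eval u (g s) • b s

lemma repr_evv (u : ι → F) (g : ι → MvPolynomial ι F) (r : ι) : b.repr (evv b u g) r = eval u (g r) := by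
  rw [evv, b.repr_sum_self]

lemma apply_evv (T : L →ₗ[F] L) (u g r) : b.repr (T (evv b u g)) r = ∑ s, b.repr (T (b s)) r * eval u (g s) := by
  simp [evv, map_sum, mul_comm]

lemma evv_step (u : ι → F) (i : ι) (g : ι → MvPolynomial ι F)
    (hN : (LieAlgebra.ad F L (b i) : L →ₗ[F] L) ^ N = 0) :
    evv b u (stepv b N i g) = expFun (u i • (LieAlgebra.ad F L (b i) : L →ₗ[F] L)) (evv b u g) := by
  have h : ((u i • (LieAlgebra.ad F L (b i) : L →ₗ[F] L)) ^ N) (evv b u g) = 0 := by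
    rw [smul_pow, hN]; simp
  rw [expFun_eq h]
  apply b.ext_elem
  intro r
  rw [repr_evv]
  simp only [stepv, map_sum, map_mul, eval_C, eval_X, map_pow, map_smul, Finsupp.coe_finsetSum, Finset.sum_apply,
    Finsupp.smul_apply, smul_pow, LinearMap.smul_apply, smul_eq_mul, apply_evv, mul_assoc]

/-- evaluation of the derivative at zero -/
noncomputable def dvv (j : ι) (g : ι → MvPolynomial ι F) : L := ∑ s, eval 0 (pderiv j (g s)) • b s

lemma repr_dvv (j : ι) (g : ι → MvPolynomial ι F) (r : ι) : b.repr (dvv b j g) r = eval 0 (pderiv j (g r)) := by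
  rw [dvv, b.repr_sum_self]

lemma dvv_step (i j : ι) (g : ι → MvPolynomial ι F) (hN2 : 2 ≤ N) :
    dvv b j (stepv b N i g) = dvv b j g + (if i = j then ⁅b i, evv b 0 g⁆ else 0) := by
  obtain ⟨M, rfl⟩ := Nat.exists_eq_add_of_le' hN2
  apply b.ext_elem
  intro r
  rw [repr_dvv, stepv, Finset.sum_range_succ', Finset.sum_range_succ']
  simp only [map_add, map_sum]
  have hz : ∀ k, eval 0 (pderiv j (C (((k + 1 + 1).factorial : F)⁻¹) * X i ^ (k + 1 + 1) *
      ∑ s, C (b.repr (((LieAlgebra.ad F L (b i) : L →ₗ[F] L) ^ (k + 1 + 1)) (b s)) r) * g s)) = 0 := by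
    intro k
    rw [pderiv_mul, pderiv_mul, pderiv_pow]
    simp
  rw [Finset.sum_eq_zero (fun k _ => hz k)]
  have h0 : ∑ s, C (b.repr (((LieAlgebra.ad F L (b i) : L →ₗ[F] L) ^ 0) (b s)) r) * g s = g r := by
    simp [Finsupp.single_apply, apply_ite C]
  rw [h0]
  have h1 : b.repr ⁅b i, evv b 0 g⁆ r = ∑ s, b.repr ⁅b i, b s⁆ r * eval 0 (g s) := apply_evv b (LieAlgebra.ad F L (b i)) 0 g r
  rw [pderiv_mul, pderiv_mul]
  by_cases hij : i = j
  · subst hij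
    simp [h1, repr_dvv]
    ring
  · simp [pderiv_X_of_ne hij, repr_dvv, hij]

end step

theorem conj_dense [IsAlgClosed F] [Module.Finite F L] {ι : Type*} [Fintype ι] [DecidableEq ι]
    (b : Module.Basis ι F L) (y : L) (μ : ι → F)
    (hb : ∀ i, ⁅y, b i⁆ = μ i • b i) : Gen (F := F) {v : L | ∃ g : L ≃ₗ⁅F⁆ L, ⁅y, g v⁆ = 0} := by
  classical
  have hloc : ∀ i, μ i ≠ 0 → LocNil (LieAlgebra.ad F L (b i) : L →ₗ[F] L) := fun i hi =>
    locNil_of_eigen b y μ hb (μ i) hi (b i) (hb i)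
  have hex : ∀ i, ∃ n, μ i ≠ 0 → (LieAlgebra.ad F L (b i) : L →ₗ[F] L) ^ n = 0 := by
    intro i
    by_cases hi : μ i = 0
    · exact ⟨0, fun h => absurd hi h⟩
    · obtain ⟨n, hn⟩ := locNil_uniform _ (hloc i hi)
      exact ⟨n, fun _ => hn⟩
  choose n hn using hex
  set N := ∑ i, n i + 2 with hNd
  have hN : ∀ i, μ i ≠ 0 → (LieAlgebra.ad F L (b i) : L →ₗ[F] L) ^ N = 0 := by
    intro i hi
    have h1 : n i ≤ N := (Finset.single_le_sum (f := n) (fun _ _ => Nat.zero_le _) (Finset.mem_univ i)).trans (by omega)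
    obtain ⟨k, hk⟩ := Nat.exists_eq_add_of_le h1
    rw [hk, pow_add, hn i hi, zero_mul]
  let p0 : ι → MvPolynomial ι F := fun s => C (b.repr y s) + if μ s = 0 then X s else 0
  let G : List ι → ι → MvPolynomial ι F := fun l => l.foldr (fun i g => stepv b N i g) p0
  have hev0 : ∀ l : List ι, (∀ i ∈ l, μ i ≠ 0) → evv b 0 (G l) = y := by
    intro l
    induction l with
    | nil =>
      intro _
      apply b.ext_elem
      intro r
      rw [repr_evv]
      simp only [G, List.foldr_nil, p0]
      split_ifs <;> simp
    | cons i l ih =>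
      intro h
      have e : G (i :: l) = stepv b N i (G l) := rfl
      rw [e, evv_step b N 0 i _ (hN i (h i (by simp))), ih (fun j hj => h j (by simp [hj]))]
      rw [expFun_eq (n := 1) (by simp)]
      simp
  have hdv : ∀ l : List ι, (∀ i ∈ l, μ i ≠ 0) → l.Nodup → ∀ j, dvv b j (G l) = (if μ j = 0 then b j else 0) +
      if j ∈ l then ⁅b j, y⁆ else 0 := by
    intro l
    induction l with
    | nil =>
      intro _ _ j
      apply b.ext_elem
      intro r
      rw [repr_dvv]
      simp only [G, List.foldr_nil, p0]
      by_cases hr : μ r = 0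
      · simp only [hr, if_true, map_add, pderiv_C, pderiv_X]
        by_cases hrj : r = j
        · subst hrj; simp [hr]
        · by_cases hj : μ j = 0
          · simp [hj, Finsupp.single_apply, hrj, Ne.symm hrj]
          · simp [hj, hrj]
      · by_cases hj : μ j = 0
        · have : j ≠ r := by rintro rfl; exact hr hj
          simp [hr, hj, Finsupp.single_apply, this]
        · simp [hr, hj]
    | cons i l ih =>
      intro h hnd j
      have e : G (i :: l) = stepv b N i (G l) := rfl
      rw [List.nodup_cons] at hnd
      have hl : ∀ i ∈ l, μ i ≠ 0 := fun j hj => h j (by simp [hj])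
      rw [e, dvv_step b N i j _ (by omega), ih hl hnd.2, hev0 l hl]
      by_cases hij : i = j
      · subst hij
        simp [hnd.1]
      · simp [hij, Ne.symm hij]
  have hform : ∀ l : List ι, (∀ i ∈ l, μ i ≠ 0) → ∀ u, ∃ g : L ≃ₗ⁅F⁆ L, evv b u (G l) = g (evv b u p0) := by
    intro l
    induction l with
    | nil => intro _ u; exact ⟨LieEquiv.refl, rfl⟩
    | cons i l ih =>
      intro h u
      obtain ⟨g, hg⟩ := ih (fun j hj => h j (by simp [hj])) u
      have hi := h i (by simp)
      have hco : ((u i • LieDerivation.ad F L (b i) : LieDerivation F L L) : L →ₗ[F] L) = u i • (LieAlgebra.ad F L (b i) : L →ₗ[F] L) := by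
        ext x; simp
      have hlo : LocNil ((u i • LieDerivation.ad F L (b i) : LieDerivation F L L) : L →ₗ[F] L) := by
        intro x
        refine ⟨N, ?_⟩
        rw [hco, smul_pow, hN i hi]; simp
      refine ⟨g.trans (expAut _ hlo), ?_⟩
      have e : G (i :: l) = stepv b N i (G l) := rfl
      rw [e, evv_step b N u i _ (hN i hi), hg, LieEquiv.trans_apply, expAut_apply, hco]
  set l0 : List ι := (Finset.univ.filter fun i => μ i ≠ 0).toList with hl0
  have hl0m : ∀ i, i ∈ l0 ↔ μ i ≠ 0 := by intro i; simp [hl0]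
  have hl0' : ∀ i ∈ l0, μ i ≠ 0 := fun i hi => (hl0m i).1 hi
  obtain ⟨P, hP, hd⟩ := dominant (G l0) 0 (by
    have : (Matrix.of fun i j => eval 0 (pderiv j (G l0 i))) = Matrix.diagonal (fun j => if μ j = 0 then 1 else - μ j) := by
      ext r j
      rw [Matrix.of_apply, ← repr_dvv b, hdv l0 hl0' (Finset.nodup_toList _), Matrix.diagonal_apply]
      by_cases hj : μ j = 0
      · simp only [hj, hl0m]
        by_cases hrj : r = j
        · subst hrj; simp [hj]
        · simp [hrj, Finsupp.single_apply, Ne.symm hrj]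
      · rw [← lie_skew, hb]
        by_cases hrj : r = j
        · subst hrj; simp [hj, hl0m]
        · simp [hrj, Finsupp.single_apply, Ne.symm hrj, hj, hl0m]
    rw [this, Matrix.det_diagonal, Finset.prod_ne_zero_iff]
    intro i _
    split_ifs with h
    · exact one_ne_zero
    · exact neg_ne_zero.2 h)
  refine gen_of_basis b P hP fun v hv => ?_
  obtain ⟨u, hu⟩ := hd _ hv
  obtain ⟨g, hg⟩ := hform l0 hl0' u
  have hvu : v = evv b u (G l0) := by
    apply b.ext_elem
    intro r
    rw [repr_evv, hu]
  refine ⟨g.symm, ?_⟩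
  rw [hvu, hg, LieEquiv.symm_apply_apply]
  rw [evv, lie_sum]
  simp only [p0, map_add, eval_C, add_smul, lie_add, lie_smul, hb, Finset.sum_add_distrib]
  have h1 : ∑ s, b.repr y s • μ s • b s = 0 := by
    have h3 : ⁅y, ∑ i, b.repr y i • b i⁆ = 0 := by rw [b.sum_repr, lie_self]
    rw [lie_sum] at h3
    simpa only [lie_smul, hb] using h3
  rw [h1, zero_add]
  apply Finset.sum_eq_zero
  intro s _
  by_cases hs : μ s = 0
  · simp [hs]
  · simp [hs]

lemma gen_regular [IsAlgClosed F] [Module.Finite F L] : Gen (F := F) {v : L | LieAlgebra.IsRegular F v} := by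
  refine ⟨_, LieAlgebra.polyCharpoly_coeff_rank_ne_zero F L (Module.finBasis F L), fun v hv => ?_⟩
  exact (LieAlgebra.isRegular_iff_coeff_polyCharpoly_rank_ne_zero (R := F) (b := Module.finBasis F L) v).2 hv

/-- `ad y` diagonalizable -/
def Diag (F : Type*) [Field F] {L : Type*} [LieRing L] [LieAlgebra F L] (y : L) : Prop :=
  ∃ (n : ℕ) (b : Module.Basis (Fin n) F L) (μ : Fin n → F), ∀ i, ⁅y, b i⁆ = μ i • b i

lemma Diag.engel {y : L} (h : Diag F y) {x : L} (hx : x ∈ LieSubalgebra.engel F y) : ⁅y, x⁆ = 0 := by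
  obtain ⟨n, b, μ, hb⟩ := h
  obtain ⟨k, hk⟩ := (LieSubalgebra.mem_engel_iff F y x).1 hx
  have h1 : ∀ (k : ℕ) x, ((LieAlgebra.ad F L y : L →ₗ[F] L) ^ k) x = ∑ i, b.repr x i • (μ i ^ k) • b i := by
    intro k x
    conv_lhs => rw [← b.sum_repr x, map_sum]
    refine Finset.sum_congr rfl fun i _ => ?_
    rw [map_smul]
    congr 1
    induction k with
    | zero => simp
    | succ k ih => rw [pow_succ', Module.End.mul_apply, ih, map_smul, LieAlgebra.ad_apply, hb, smul_smul, ← pow_succ]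
  rw [h1] at hk
  have h2 : ∀ i, b.repr x i * μ i ^ k = 0 := by
    intro i
    have := congrArg (fun z => b.repr z i) hk
    simp only [smul_smul] at this
    rw [b.repr_sum_self] at this
    simpa using this
  have h3 := h1 1 x
  rw [pow_one, LieAlgebra.ad_apply] at h3
  rw [h3]
  apply Finset.sum_eq_zero
  intro i _
  rcases mul_eq_zero.1 (h2 i) with h | h
  · rw [h, zero_smul]
  · rw [eq_zero_of_pow_eq_zero h]; simp

lemma map_engel (g : L ≃ₗ⁅F⁆ L) (v x : L) : x ∈ LieSubalgebra.engel F v ↔ g x ∈ LieSubalgebra.engel F (g v) := by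
  rw [LieSubalgebra.mem_engel_iff, LieSubalgebra.mem_engel_iff]
  refine exists_congr fun n => ?_
  have : ∀ n, ((LieAlgebra.ad F L (g v) : L →ₗ[F] L) ^ n) (g x) = g (((LieAlgebra.ad F L v : L →ₗ[F] L) ^ n) x) := by
    intro n
    induction n with
    | zero => simp
    | succ n ih => rw [pow_succ', Module.End.mul_apply, ih, pow_succ', Module.End.mul_apply, LieAlgebra.ad_apply, LieAlgebra.ad_apply, LieEquiv.map_lie]
  rw [this]
  simp

lemma engel_eq_of_regular [Module.Finite F L] {y v : L} (hy : Diag F y)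
    (hab : ∀ a b : L, ⁅y, a⁆ = 0 → ⁅y, b⁆ = 0 → ⁅a, b⁆ = 0) (g : L ≃ₗ⁅F⁆ L) (hg : ⁅y, g v⁆ = 0)
    (hv : LieAlgebra.IsRegular F v) (x : L) : ⁅y, g x⁆ = 0 ↔ x ∈ LieSubalgebra.engel F v := by
  have hle : (LieSubalgebra.engel F y).toSubmodule ≤ (LieSubalgebra.engel F (g v)).toSubmodule := by
    intro a ha
    refine (LieSubalgebra.mem_engel_iff F (g v) a).2 ⟨1, ?_⟩
    rw [pow_one, LieAlgebra.ad_apply]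
    exact hab _ _ hg (hy.engel ha)
  have hfr : Module.finrank F (LieSubalgebra.engel F (g v)) = Module.finrank F (LieSubalgebra.engel F v) := by
    have e : (LieSubalgebra.engel F (g v)).toSubmodule = (LieSubalgebra.engel F v).toSubmodule.map (g.toLinearEquiv : L →ₗ[F] L) := by
      ext z
      constructor
      · intro hz
        refine ⟨g.symm z, (map_engel g v _).2 ?_, ?_⟩
        · rw [LieEquiv.apply_symm_apply]; exact hz
        · exact LieEquiv.apply_symm_apply g z
      · rintro ⟨w, hw, rfl⟩
        exact (map_engel g v w).1 hw
    change Module.finrank F (LieSubalgebra.engel F (g v)).toSubmodule = Module.finrank F (LieSubalgebra.engel F v).toSubmodule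
    rw [e, LinearEquiv.finrank_map_eq]
  have heq : (LieSubalgebra.engel F y).toSubmodule = (LieSubalgebra.engel F (g v)).toSubmodule := by
    apply Submodule.eq_of_le_of_finrank_le hle
    change Module.finrank F (LieSubalgebra.engel F (g v)) ≤ Module.finrank F (LieSubalgebra.engel F y)
    rw [hfr, (LieAlgebra.isRegular_iff_finrank_engel_eq_rank F v).1 hv]
    exact LieAlgebra.rank_le_finrank_engel F y
  rw [map_engel g v x]
  constructor
  · intro h
    have : g x ∈ (LieSubalgebra.engel F y).toSubmodule :=
      (LieSubalgebra.mem_engel_iff F y (g x)).2 ⟨1, by simpa using h⟩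
    rw [heq] at this
    exact this
  · intro h
    apply hy.engel
    have : g x ∈ (LieSubalgebra.engel F (g v)).toSubmodule := h
    rw [← heq] at this
    exact this

theorem conj_thm [IsAlgClosed F] [Module.Finite F L] {y y' : L} (hy : Diag F y) (hy' : Diag F y')
    (hab : ∀ a b : L, ⁅y, a⁆ = 0 → ⁅y, b⁆ = 0 → ⁅a, b⁆ = 0)
    (hab' : ∀ a b : L, ⁅y', a⁆ = 0 → ⁅y', b⁆ = 0 → ⁅a, b⁆ = 0) :
    ∃ g : L ≃ₗ⁅F⁆ L, ∀ x, ⁅y, x⁆ = 0 ↔ ⁅y', g x⁆ = 0 := by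
  have h1 : Gen (F := F) {v : L | ∃ g : L ≃ₗ⁅F⁆ L, ⁅y, g v⁆ = 0} := by
    obtain ⟨n, b, μ, hb⟩ := hy
    exact conj_dense b y μ hb
  have h2 : Gen (F := F) {v : L | ∃ g : L ≃ₗ⁅F⁆ L, ⁅y', g v⁆ = 0} := by
    obtain ⟨n, b, μ, hb⟩ := hy'
    exact conj_dense b y' μ hb
  obtain ⟨v, ⟨⟨g, hg⟩, ⟨g', hg'⟩⟩, hv⟩ := ((h1.inter h2).inter gen_regular).nonempty
  refine ⟨g.symm.trans g', fun x => ?_⟩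
  rw [LieEquiv.trans_apply, engel_eq_of_regular hy' hab' g' hg' hv, ← engel_eq_of_regular hy hab g hg hv,
    LieEquiv.apply_symm_apply]

end conj
end E8P

namespace E8P
open Module.End

section B
variable {F : Type*} [Field F] [CharZero F] [IsAlgClosed F]

lemma jacobson {V : Type*} [AddCommGroup V] [Module F V] [FiniteDimensional F V] (A B C : Module.End F V)
    (h : A * B - B * A = C) (hA : Commute A C) (hB : Commute B C) : IsNilpotent C := by
  obtain ⟨n, hn_adj, s, hns, hn, hs, hC⟩ := C.exists_isNilpotent_isSemisimple
  have hAs : Commute A s := Algebra.commute_of_mem_adjoin_singleton_of_commute hns hA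
  have hBs : Commute B s := Algebra.commute_of_mem_adjoin_singleton_of_commute hns hB
  have hCs : Commute C s := Algebra.commute_of_mem_adjoin_singleton_of_commute hns (Commute.refl C)
  have hns' : Commute n s := by
    have : n = C - s := by rw [hC]; abel
    rw [this]; exact hCs.sub_left (Commute.refl s)
  suffices s = 0 by rw [hC, this, add_zero]; exact hn
  rw [hs.eq_zero_iff_forall_eigenvalue]
  intro ν hν
  have mp : ∀ {f : Module.End F V}, Commute f s → ∀ x ∈ s.eigenspace ν, f x ∈ s.eigenspace ν := by
    intro f hf x hx
    rw [mem_eigenspace_iff] at hx ⊢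
    rw [← Module.End.mul_apply, ← hf.eq, Module.End.mul_apply, hx, map_smul]
  have e1 : C.restrict (mp hCs) = A.restrict (mp hAs) * B.restrict (mp hBs) - B.restrict (mp hBs) * A.restrict (mp hAs) := by
    ext x
    simp [LinearMap.restrict_apply, ← h]
  have e2 : C.restrict (mp hCs) = n.restrict (mp hns') + ν • 1 := by
    ext x
    have := mem_eigenspace_iff.1 x.2
    simp [LinearMap.restrict_apply, hC, this]
  have t1 : LinearMap.trace F _ (C.restrict (mp hCs)) = 0 := by
    rw [e1, map_sub, LinearMap.trace_mul_comm, sub_self]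
  have t2 : LinearMap.trace F _ (n.restrict (mp hns')) = 0 := by
    have : IsNilpotent (n.restrict (mp hns')) := Module.End.isNilpotent.restrict _ hn
    exact (LinearMap.isNilpotent_trace_of_isNilpotent this).eq_zero
  rw [e2, map_add, t2, zero_add, map_smul, LinearMap.trace_one, smul_eq_mul] at t1
  rcases mul_eq_zero.1 t1 with h | h
  · exact h
  · exfalso
    rw [Nat.cast_eq_zero, Submodule.finrank_eq_zero] at h
    exact hν h

variable {L : Type*} [LieRing L] [LieAlgebra F L] [Module.Finite F L]

/-- ad-semisimple -/
def SS (F : Type*) [Field F] {L : Type*} [LieRing L] [LieAlgebra F L] (x : L) : Prop :=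
  Module.End.IsSemisimple (LieAlgebra.ad F L x : Module.End F L)

lemma SS.diag {x : L} (hx : SS F x) : Diag F x := by
  classical
  set s : Module.End F L := LieAlgebra.ad F L x
  let eigenDecomp := DirectSum.isInternal_submodule_of_iSupIndep_of_iSup_eq_top
    s.eigenspaces_iSupIndep (IsSemisimple.iSup_eigenspace_eq_top hx)
  let I := (ν : F) × Fin (Module.finrank F (s.eigenspace ν))
  let v : Module.Basis I F L := eigenDecomp.collectedBasis fun μ ↦ Module.finBasis F (s.eigenspace μ)
  have : Fintype I := FiniteDimensional.fintypeBasisIndex v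
  have hsv (i : I) : s (v i) = i.1 • v i :=
    mem_eigenspace_iff.mp (eigenDecomp.collectedBasis_mem _ i)
  refine ⟨Fintype.card I, v.reindex (Fintype.equivFin I), fun i => ((Fintype.equivFin I).symm i).1, fun i => ?_⟩
  rw [Module.Basis.reindex_apply]
  exact hsv _

/-- Jordan decomposition -/
structure JD (F : Type*) [Field F] {L : Type*} [LieRing L] [LieAlgebra F L] (x s : L) : Prop where
  ss : SS F s
  nil : IsNilpotent (LieAlgebra.ad F L (x - s) : Module.End F L)
  comm : ⁅s, x⁆ = 0

lemma ad_commute {x y : L} (h : ⁅x, y⁆ = 0) :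
    Commute (LieAlgebra.ad F L x : Module.End F L) (LieAlgebra.ad F L y : Module.End F L) := by
  ext z
  simp only [Module.End.mul_apply, LieAlgebra.ad_apply]
  rw [leibniz_lie, h, zero_lie, zero_add]

lemma SS.add {x y : L} (hx : SS F x) (hy : SS F y) (h : ⁅x, y⁆ = 0) : SS F (x + y) := by
  unfold SS
  rw [map_add]
  exact hx.add_of_commute (ad_commute h) hy

lemma SS.smul {x : L} (hx : SS F x) (c : F) : SS F (c • x) := by
  unfold SS
  rw [map_smul]
  exact IsSemisimple_smul c hx

lemma SS.zero_of_nil {x : L} (hx : SS F x) (h : ∃ k, ∀ y, ((LieAlgebra.ad F L x : Module.End F L) ^ k) y = 0) (y : L) : ⁅x, y⁆ = 0 := by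
  obtain ⟨k, hk⟩ := h
  have := eq_zero_of_isNilpotent_isSemisimple ⟨k, LinearMap.ext hk⟩ hx
  exact LinearMap.congr_fun this y

lemma SS.map {x : L} (hx : SS F x) (g : L ≃ₗ⁅F⁆ L) : SS F (g x) := by
  unfold SS
  refine (LinearEquiv.isSemisimple_iff (LieAlgebra.ad F L x) _ g.toLinearEquiv ?_).1 hx
  ext y
  exact LieEquiv.map_lie g x y

lemma nil_map {x : L} (hx : IsNilpotent (LieAlgebra.ad F L x : Module.End F L)) (g : L ≃ₗ⁅F⁆ L) :
    IsNilpotent (LieAlgebra.ad F L (g x) : Module.End F L) := by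
  obtain ⟨k, hk⟩ := hx
  refine ⟨k, ?_⟩
  have : ∀ n y, ((LieAlgebra.ad F L (g x) : Module.End F L) ^ n) (g y) = g (((LieAlgebra.ad F L x : Module.End F L) ^ n) y) := by
    intro n y
    induction n with
    | zero => simp
    | succ n ih => rw [pow_succ', Module.End.mul_apply, ih, pow_succ', Module.End.mul_apply, LieAlgebra.ad_apply, LieAlgebra.ad_apply, LieEquiv.map_lie]
  ext y
  have h := this k (g.symm y)
  rw [hk, LieEquiv.apply_symm_apply] at h
  simpa using h

lemma JD.map {x s : L} (h : JD F x s) (g : L ≃ₗ⁅F⁆ L) : JD F (g x) (g s) :=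
  ⟨h.ss.map g, by rw [← map_sub]; exact nil_map h.nil g, by rw [← LieEquiv.map_lie, h.comm, map_zero]⟩

lemma JD.smul {x s : L} (h : JD F x s) (c : F) : JD F (c • x) (c • s) :=
  ⟨h.ss.smul c, by rw [← smul_sub, map_smul]; exact h.nil.smul c, by rw [smul_lie, lie_smul, h.comm, smul_zero, smul_zero]⟩

variable [LieAlgebra.IsKilling F L]

lemma ad_inj {x y : L} (h : (LieAlgebra.ad F L x : Module.End F L) = LieAlgebra.ad F L y) : x = y := by
  have : x - y ∈ LieAlgebra.center F L := by
    rw [LieModule.mem_maxTrivSubmodule]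
    intro z
    have := LinearMap.congr_fun h z
    simp only [LieAlgebra.ad_apply] at this
    rw [← lie_skew, sub_lie, this, sub_self, neg_zero]
  rw [LieAlgebra.center_eq_bot, LieSubmodule.mem_bot] at this
  exact sub_eq_zero.1 this

lemma JD.unique {x s t : L} (h : JD F x s) (h' : JD F x t) : s = t := by
  apply ad_inj (F := F)
  have hc : ∀ {s : L}, JD F x s → Commute (LieAlgebra.ad F L (x - s) : Module.End F L) (LieAlgebra.ad F L s) := by
    intro s h
    apply ad_commute
    rw [sub_lie, lie_self, sub_zero, ← lie_skew, h.comm, neg_zero]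
  refine (isNilpotent_isSemisimple_unique h.nil h.ss h'.nil h'.ss (hc h) (hc h') ?_).2
  rw [← map_add, ← map_add]
  simp

lemma JD.exist (x : L) : ∃ s, JD F x s ∧ ∀ a : L, ⁅x, a⁆ = 0 → ⁅s, a⁆ = 0 := by
  obtain ⟨N, -, S, hS₁, hN, hS, hSN⟩ := (LieAlgebra.ad F L x : Module.End F L).exists_isNilpotent_isSemisimple
  have hS₀ : Commute (LieAlgebra.ad F L x : Module.End F L) S := Algebra.commute_of_mem_adjoin_self hS₁
  have hN' := hN
  rw [eq_sub_of_add_eq hSN.symm] at hN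
  have aux {α : F} {y : L} (hy : y ∈ (LieAlgebra.ad F L x : Module.End F L).maxGenEigenspace α) : S y = α • y := by
    exact apply_eq_of_mem_of_comm_of_isFinitelySemisimple_of_isNil hy hS₀ hS.isFinitelySemisimple hN
  have htop := iSup_maxGenEigenspace_eq_top (LieAlgebra.ad F L x : Module.End F L)
  have h_der (y z : L) : S ⁅y, z⁆ = ⁅S y, z⁆ + ⁅y, S z⁆ := by
    have hy : y ∈ ⨆ α, (LieAlgebra.ad F L x : Module.End F L).maxGenEigenspace α := by rw [htop]; trivial
    have hz : z ∈ ⨆ α, (LieAlgebra.ad F L x : Module.End F L).maxGenEigenspace α := by rw [htop]; trivial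
    induction hy using Submodule.iSup_induction' with
    | mem α y hy =>
      induction hz using Submodule.iSup_induction' with
      | mem β z hz =>
        have hyz : ⁅y, z⁆ ∈ (LieAlgebra.ad F L x : Module.End F L).maxGenEigenspace (α + β) :=
          LieModule.lie_mem_maxGenEigenspace_toEnd (L := L) (M := L) hy hz
        rw [aux hy, aux hz, aux hyz, smul_lie, lie_smul, ← add_smul]
      | zero => simp
      | add _ _ _ _ h h' => simp only [lie_add, map_add, h, h']; abel
    | zero => simp
    | add _ _ _ _ h h' => simp only [add_lie, map_add, h, h']; abel
  replace h_der : ∀ y z : L, S ⁅y, z⁆ = ⁅y, S z⁆ - ⁅z, S y⁆ := by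
    simp_rw [← lie_skew (S _) _, add_comm, ← sub_eq_add_neg] at h_der; assumption
  let S' : LieDerivation F L L := ⟨S, h_der⟩
  obtain ⟨s, hs⟩ := LieDerivation.IsKilling.exists_eq_ad S'
  replace hs : S = LieAlgebra.ad F L s := by rw [← LieDerivation.coe_ad_apply_eq_ad_apply s, hs]
  have hxs : ⁅s, x⁆ = 0 := by
    have : LieAlgebra.ad F L ⁅s, x⁆ = (LieAlgebra.ad F L 0 : Module.End F L) := by
      ext z
      have h1 := LinearMap.congr_fun hS₀.eq z
      rw [hs] at h1
      simp only [Module.End.mul_apply, LieAlgebra.ad_apply] at h1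
      rw [LieAlgebra.ad_apply, lie_lie, h1, sub_self, LieAlgebra.ad_apply, zero_lie]
    exact ad_inj this
  refine ⟨s, ⟨?_, ?_, hxs⟩, ?_⟩
  · unfold SS; rw [← hs]; exact hS
  · rw [map_sub, ← hs]; exact hN
  · intro a ha
    obtain ⟨p, hp⟩ := Algebra.adjoin_singleton_eq_range_aeval F (LieAlgebra.ad F L x : Module.End F L) ▸ hS₁
    have key : ∀ b : L, ⁅x, b⁆ = 0 → S b = p.eval 0 • b := by
      intro b hb
      rw [← hp]
      change (Polynomial.aeval (LieAlgebra.ad F L x : Module.End F L) p) b = _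
      by_cases hb0 : b = 0
      · simp [hb0]
      have := Module.End.aeval_apply_of_hasEigenvector (f := (LieAlgebra.ad F L x : Module.End F L)) (p := p) (μ := 0) (x := b)
        ⟨by rw [mem_eigenspace_iff]; simpa using hb, hb0⟩
      exact this
    have h2 : ⁅s, a⁆ = p.eval 0 • a := by
      have := key a ha
      rw [hs] at this
      exact this
    have h3 : p.eval 0 • x = 0 := by
      rw [← key x (lie_self x), hs]; exact hxs
    rcases smul_eq_zero.1 h3 with h | h
    · rw [h2, h, zero_smul]
    · subst h
      have : N + S = 0 := by rw [← hSN, map_zero]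
      have hS0 : IsNilpotent S := by rw [eq_neg_of_add_eq_zero_right this]; exact hN'.neg
      have := eq_zero_of_isNilpotent_isSemisimple hS0 hS
      have h4 : S a = 0 := by rw [this]; rfl
      rw [hs] at h4
      exact h4

lemma JD.lie {x s a : L} (h : JD F x s) (ha : ⁅x, a⁆ = 0) : ⁅s, a⁆ = 0 := by
  obtain ⟨t, ht, h'⟩ := JD.exist (F := F) x
  rw [h.unique ht]
  exact h' a ha

lemma JD.eigen {x s : L} (h : JD F x s) (g : L ≃ₗ⁅F⁆ L) (c : F) (hg : g x = c • x) : g s = c • s :=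
  (h.map g).unique (hg ▸ h.smul c)

end B
end E8P

namespace E8P
open Module.End

section B2
variable {F : Type*} [Field F] [CharZero F] [IsAlgClosed F]
variable {L : Type*} [LieRing L] [LieAlgebra F L] [Module.Finite F L] [LieAlgebra.IsKilling F L]

lemma generic_comb {y s : L} (hy : SS F y) (hs : SS F s) (h : ⁅y, s⁆ = 0) :
    ∃ t : F, ∀ v : L, ⁅y + t • s, v⁆ = 0 → ⁅s, v⁆ = 0 := by
  set A : Module.End F L := LieAlgebra.ad F L y with hA
  set B : Module.End F L := LieAlgebra.ad F L s with hB
  have hAB : Commute A B := ad_commute h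
  have fin : (Set.image (fun p : F × F => - p.1 / p.2) ({μ | A.HasEigenvalue μ} ×ˢ {μ | B.HasEigenvalue μ})).Finite :=
    ((A.finite_hasEigenvalue).prod (B.finite_hasEigenvalue)).image _
  obtain ⟨t, ht⟩ := fin.infinite_compl.nonempty
  refine ⟨t, ?_⟩
  set W := LinearMap.ker (A + t • B) with hW
  have hst : W ∈ B.invtSubmodule := by
    intro v hv
    have hv' : (A + t • B) v = 0 := hv
    change (A + t • B) (B v) = 0
    have hc : Commute (A + t • B) B := hAB.add_left ((Commute.refl B).smul_left t)
    rw [← Module.End.mul_apply, hc.eq, Module.End.mul_apply, hv', map_zero]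
  have hss := Module.End.IsSemisimple.restrict hst hs
  have hst' : ∀ v ∈ W, B v ∈ W := fun v hv => hst hv
  have h0 : (LinearMap.restrict B hst' : Module.End F W) = 0 := by
    refine (Module.End.IsSemisimple.eq_zero_iff_forall_eigenvalue hss).2 fun β hβ => ?_
    by_contra hβ0
    obtain ⟨w, hw, hw0⟩ := hβ.exists_hasEigenvector
    rw [mem_eigenspace_iff] at hw
    have hw1 : B (w : L) = β • (w : L) := congrArg Subtype.val hw
    have hw2 : A (w : L) + t • B (w : L) = 0 := w.2
    have hw0' : (w : L) ≠ 0 := fun h => hw0 (Subtype.ext h)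
    have hw3 : A (w : L) = (-(t * β)) • (w : L) := by
      rw [hw1, smul_smul] at hw2
      rw [neg_smul]
      exact eq_neg_of_add_eq_zero_left hw2
    apply ht
    refine ⟨(-(t * β), β), ⟨hasEigenvalue_of_hasEigenvector ⟨mem_eigenspace_iff.2 hw3, hw0'⟩,
      hasEigenvalue_of_hasEigenvector ⟨mem_eigenspace_iff.2 hw1, hw0'⟩⟩, ?_⟩
    change - -(t * β) / β = t
    field_simp
  intro v hv
  have hv' : v ∈ W := by
    change (A + t • B) v = 0
    simpa [hA, hB] using hv
  exact congrArg Subtype.val (LinearMap.congr_fun h0 ⟨v, hv'⟩)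

lemma min_lemma (S : L → Prop) (N : Submodule F L) (hS : ∀ x, S x → SS F x) (h0 : ∃ x, S x)
    (hadd : ∀ x s (t : F), S x → S s → ⁅x, s⁆ = 0 → S (x + t • s)) :
    ∃ x, S x ∧ ∀ s, S s → ⁅x, s⁆ = 0 → ∀ v ∈ N, ⁅x, v⁆ = 0 → ⁅s, v⁆ = 0 := by
  let d : L → ℕ := fun x => Module.finrank F (N ⊓ LinearMap.ker (LieAlgebra.ad F L x : Module.End F L) : Submodule F L)
  obtain ⟨x0, hx0⟩ := h0
  obtain ⟨x, hx, hmin⟩ := WellFounded.has_min (InvImage.wf d Nat.lt_wfRel.wf) {x | S x} ⟨x0, hx0⟩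
  refine ⟨x, hx, fun s hs hxs v hv hxv => ?_⟩
  obtain ⟨t, ht⟩ := generic_comb (hS x hx) (hS s hs) hxs
  have hle : (N ⊓ LinearMap.ker (LieAlgebra.ad F L (x + t • s) : Module.End F L) : Submodule F L) ≤
      N ⊓ LinearMap.ker (LieAlgebra.ad F L x : Module.End F L) := by
    rintro w ⟨hw1, hw2⟩
    refine ⟨hw1, ?_⟩
    have hw3 : ⁅x + t • s, w⁆ = 0 := hw2
    have := ht w hw3
    rw [add_lie, smul_lie, this, smul_zero, add_zero] at hw3
    exact hw3
  have := Submodule.eq_of_le_of_finrank_le hle (not_lt.1 (hmin _ (hadd x s t hx hs hxs)))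
  have hv' : v ∈ (N ⊓ LinearMap.ker (LieAlgebra.ad F L x : Module.End F L) : Submodule F L) := ⟨hv, hxv⟩
  rw [← this] at hv'
  exact ht v hv'.2

lemma kap_zero {a b : L} (hab : ⁅a, b⁆ = 0) (ha : IsNilpotent (LieAlgebra.ad F L a : Module.End F L)) :
    killingForm F L a b = 0 := by
  rw [LieModule.traceForm_apply_apply]
  have : IsNilpotent ((LieAlgebra.ad F L a : Module.End F L) * LieAlgebra.ad F L b) :=
    (ad_commute hab).isNilpotent_mul_right ha
  exact (LinearMap.isNilpotent_trace_of_isNilpotent this).eq_zero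

lemma killing_nd {x : L} (h : ∀ y, killingForm F L x y = 0) : x = 0 := by
  have : x ∈ LinearMap.ker (killingForm F L) := by
    rw [LinearMap.mem_ker]; ext y; exact h y
  rw [LieAlgebra.IsKilling.ker_killingForm_eq_bot] at this
  exact this

/-- good subalgebras -/
structure Good (M : LieSubalgebra F L) : Prop where
  nd : ∀ x ∈ M, (∀ y ∈ M, killingForm F L x y = 0) → x = 0
  jc : ∀ x ∈ M, ∀ s, JD F x s → s ∈ M

lemma good_top : Good (⊤ : LieSubalgebra F L) :=
  ⟨fun x _ h => killing_nd fun y => h y (LieSubalgebra.mem_top y), fun _ _ s _ => LieSubalgebra.mem_top s⟩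

/-- fixed points inside a subalgebra -/
def fixIn (M : LieSubalgebra F L) (q : L ≃ₗ⁅F⁆ L) : LieSubalgebra F L where
  carrier := {x | x ∈ M ∧ q x = x}
  add_mem' := fun ha hb => ⟨add_mem ha.1 hb.1, by rw [map_add, ha.2, hb.2]⟩
  zero_mem' := ⟨zero_mem M, map_zero q⟩
  smul_mem' := fun c _ ha => ⟨M.smul_mem c ha.1, by rw [map_smul, ha.2]⟩
  lie_mem' := fun ha hb => ⟨M.lie_mem ha.1 hb.1, by rw [LieEquiv.map_lie, ha.2, hb.2]⟩

/-- centralizer inside a subalgebra -/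
def cenIn (M : LieSubalgebra F L) (x : L) : LieSubalgebra F L where
  carrier := {a | a ∈ M ∧ ⁅x, a⁆ = 0}
  add_mem' := fun ha hb => ⟨add_mem ha.1 hb.1, by rw [lie_add, ha.2, hb.2, add_zero]⟩
  zero_mem' := ⟨zero_mem M, lie_zero x⟩
  smul_mem' := fun c _ ha => ⟨M.smul_mem c ha.1, by rw [lie_smul, ha.2, smul_zero]⟩
  lie_mem' := fun ha hb => ⟨M.lie_mem ha.1 hb.1, by rw [leibniz_lie, ha.2, hb.2, zero_lie, lie_zero, add_zero]⟩

lemma killing_iter (q : L ≃ₗ⁅F⁆ L) (x y : L) (hx : q x = x) (i : ℕ) : killingForm F L x (q^[i] y) = killingForm F L x y := by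
  induction i with
  | zero => rfl
  | succ i ih =>
    rw [Function.iterate_succ_apply']
    conv_lhs => rw [← hx]
    rw [LieAlgebra.killingForm_of_equiv_apply, ih]

lemma iter_mem {M : LieSubalgebra F L} {q : L ≃ₗ⁅F⁆ L} (hq : ∀ x ∈ M, q x ∈ M) {x : L} (hx : x ∈ M) (i : ℕ) : q^[i] x ∈ M := by
  induction i with
  | zero => exact hx
  | succ i ih => rw [Function.iterate_succ_apply']; exact hq _ ih

lemma Good.fix {M : LieSubalgebra F L} (hM : Good M) {q : L ≃ₗ⁅F⁆ L} (hq : ∀ x ∈ M, q x ∈ M) {m : ℕ} (hm : 0 < m)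
    (hqm : ∀ x, q^[m] x = x) : Good (fixIn M q) := by
  refine ⟨fun x hx h => hM.nd x hx.1 fun y hy => ?_, fun x hx s hs => ⟨hM.jc x hx.1 s hs, ?_⟩⟩
  · have h1 : (∑ i ∈ Finset.range m, q^[i] y) ∈ fixIn M q := by
      refine ⟨sum_mem fun i _ => iter_mem hq hy i, ?_⟩
      rw [map_sum]
      simp only [← Function.iterate_succ_apply' q]
      have := Finset.sum_range_succ' (fun i => q^[i] y) m
      rw [Finset.sum_range_succ, hqm] at this
      simp only [Function.iterate_zero, id] at this
      exact (add_right_cancel this).symm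
    have h2 := h _ h1
    rw [map_sum, Finset.sum_congr rfl (fun i _ => killing_iter q x y hx.2 i), Finset.sum_const, Finset.card_range,
      nsmul_eq_mul] at h2
    exact (mul_eq_zero.1 h2).resolve_left (by exact_mod_cast hm.ne')
  · have := hs.eigen q 1 (by rw [one_smul]; exact hx.2)
    rwa [one_smul] at this

lemma Good.cen {M : LieSubalgebra F L} (hM : Good M) {x : L} (hx : x ∈ M) (hs : SS F x) : Good (cenIn M x) := by
  refine ⟨fun z hz h => hM.nd z hz.1 fun y hy => ?_, fun a ha s hs => ⟨hM.jc a ha.1 s hs, ?_⟩⟩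
  · have hst : M.toSubmodule ∈ (LieAlgebra.ad F L x : Module.End F L).invtSubmodule := fun v hv => M.lie_mem hx hv
    have hss := Module.End.IsSemisimple.restrict hst hs
    have hst' : ∀ v ∈ M.toSubmodule, (LieAlgebra.ad F L x : Module.End F L) v ∈ M.toSubmodule := fun v hv => hst hv
    set f : Module.End F M.toSubmodule := LinearMap.restrict (LieAlgebra.ad F L x : Module.End F L) hst' with hf
    change f.IsSemisimple at hss
    have hcompl : LinearMap.ker f ⊔ LinearMap.range f = ⊤ := by
      apply Submodule.eq_top_of_disjoint
      · rw [add_comm, LinearMap.finrank_range_add_finrank_ker]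
      · rw [Submodule.disjoint_def]
        rintro _ hw ⟨v, rfl⟩
        have h1 : v ∈ f.genEigenspace 0 (2 : ℕ) := by
          rw [mem_genEigenspace_nat]
          simpa [pow_two] using hw
        rw [(IsSemisimple.isFinitelySemisimple hss).genEigenspace_eq_eigenspace 0 (by simp)] at h1
        simpa [mem_eigenspace_iff] using h1
    have hy' : (⟨y, hy⟩ : M.toSubmodule) ∈ LinearMap.ker f ⊔ LinearMap.range f := by rw [hcompl]; trivial
    obtain ⟨k, hk, _, ⟨w, rfl⟩, hkw⟩ := Submodule.mem_sup.1 hy'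
    have e : y = k + ⁅x, (w : L)⁆ := (congrArg Subtype.val hkw).symm
    have hk' : ⁅x, (k : L)⁆ = 0 := congrArg Subtype.val hk
    rw [e, map_add, h _ ⟨k.2, hk'⟩, zero_add, ← LieModule.traceForm_apply_lie_apply, ← lie_skew, hz.2, neg_zero, map_zero,
      LinearMap.zero_apply]
  · rw [← lie_skew, hs.lie (by rw [← lie_skew, ha.2, neg_zero]), neg_zero]

lemma comm_nil {A B : Module.End F L} (h : Commute A B) {a b : ℕ} {y : L} (hA : (A ^ a) y = 0) (hB : B ^ b = 0) :
    ((A - B) ^ (a + b)) y = 0 := by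
  rw [sub_eq_add_neg, (h.neg_right).add_pow', LinearMap.sum_apply]
  apply Finset.sum_eq_zero
  rintro ⟨i, j⟩ hij
  have hij' : i + j = a + b := by simpa using hij
  rw [LinearMap.smul_apply]
  suffices (A ^ i * (-B) ^ j) y = 0 by rw [this]; apply smul_zero
  rcases le_total a i with hi | hi
  · rw [((h.neg_right).pow_pow i j).eq, Module.End.mul_apply, Module.End.pow_map_zero_of_le hi hA, map_zero]
  · have : (-B) ^ j = 0 := by
      rw [neg_pow]
      obtain ⟨c, rfl⟩ := Nat.exists_eq_add_of_le (show b ≤ j by omega)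
      rw [pow_add B, hB, zero_mul, mul_zero]
    rw [this, mul_zero]; rfl

lemma eig_ind {M : LieSubalgebra F L} {q : L ≃ₗ⁅F⁆ L} (hq : ∀ x ∈ M, q x ∈ M) {m : ℕ} (hm : 0 < m)
    (hqm : ∀ x, q^[m] x = x) {ζ : F} (hζ : IsPrimitiveRoot ζ m) (P : L → Prop) (h0 : P 0)
    (hadd : ∀ x y, P x → P y → P (x + y)) (h : ∀ y ∈ M, ∀ j < m, q y = ζ ^ j • y → P y) : ∀ y ∈ M, P y := by
  intro y hy
  set f : Module.End F M.toSubmodule := LinearMap.restrict (q.toLinearEquiv : L →ₗ[F] L) hq with hf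
  have hfm : f ^ m = 1 := by
    ext x
    have : ∀ i, (((f ^ i) x : M.toSubmodule) : L) = q^[i] x := by
      intro i
      induction i with
      | zero => rfl
      | succ i ih => rw [pow_succ', Module.End.mul_apply, Function.iterate_succ_apply', ← ih]; rfl
    rw [this, hqm]; rfl
  have hss : f.IsSemisimple := by
    refine isSemisimple_of_squarefree_aeval_eq_zero (p := Polynomial.X ^ m - 1) ?_ (by simp [hfm])
    have : (Polynomial.X ^ m - Polynomial.C (1 : F)).Separable :=
      Polynomial.separable_X_pow_sub_C 1 (by exact_mod_cast hm.ne') one_ne_zero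
    simpa using this.squarefree
  have htop := hss.iSup_eigenspace_eq_top
  have hmem : (⟨y, hy⟩ : M.toSubmodule) ∈ ⨆ μ : F, f.eigenspace μ := by rw [htop]; trivial
  suffices ∀ z : M.toSubmodule, z ∈ ⨆ μ : F, f.eigenspace μ → P z from this ⟨y, hy⟩ hmem
  intro z hz
  induction hz using Submodule.iSup_induction' with
  | mem μ z hz =>
    by_cases hz0 : z = 0
    · rw [hz0]; exact h0
    have hz' := mem_eigenspace_iff.1 hz
    have hpow : ∀ i : ℕ, (f ^ i) z = μ ^ i • z := by
      intro i
      induction i with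
      | zero => simp
      | succ i ih => rw [pow_succ', Module.End.mul_apply, ih, map_smul, hz', smul_smul, ← pow_succ]
    have hμ : μ ^ m = 1 := by
      have := hpow m
      rw [hfm] at this
      have h2 : (μ ^ m - 1) • z = 0 := by rw [sub_smul, ← this]; simp
      exact sub_eq_zero.1 ((smul_eq_zero.1 h2).resolve_right hz0)
    have : NeZero m := ⟨hm.ne'⟩
    obtain ⟨j, hj, rfl⟩ := hζ.eq_pow_of_pow_eq_one hμ
    exact h z z.2 j hj (congrArg Subtype.val hz')
  | zero => exact h0
  | add x y _ _ hx hy => exact hadd _ _ hx hy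

theorem lemmaN {M : LieSubalgebra F L} (hM : Good M) {q : L ≃ₗ⁅F⁆ L} (hq : ∀ x ∈ M, q x ∈ M) {m : ℕ} (hm : 0 < m)
    (hqm : ∀ x, q^[m] x = x) (hZ : ∀ x ∈ M, q x = x → ∀ y ∈ M, ⁅x, y⁆ = 0) : ∀ x ∈ M, ∀ y ∈ M, ⁅x, y⁆ = 0 := by
  have : NeZero (m : F) := ⟨by exact_mod_cast hm.ne'⟩
  obtain ⟨ζ, hζ⟩ := HasEnoughRootsOfUnity.exists_primitiveRoot F m
  suffices H : ∀ s < m, ∀ x ∈ M, q x = ζ ^ s • x → ∀ y ∈ M, ⁅x, y⁆ = 0 by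
    refine eig_ind hq hm hqm hζ _ (by simp) (fun x y hx hy z hz => by rw [add_lie, hx z hz, hy z hz, add_zero])
      fun x hx s hs hxs => H s hs x hx hxs
  intro s
  induction s using Nat.strong_induction_on with
  | _ s ih =>
  intro hsm x hx hxs
  rcases Nat.eq_zero_or_pos s with rfl | hs0
  · exact hZ x hx (by simpa using hxs)
  have hnil : ∀ y ∈ M, ∃ k : ℕ, ((LieAlgebra.ad F L x : Module.End F L) ^ k) y = 0 := by
    refine eig_ind hq hm hqm hζ _ ⟨0, by simp⟩ ?_ ?_
    · rintro u v ⟨a, ha⟩ ⟨b, hb⟩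
      exact ⟨max a b, by rw [map_add, Module.End.pow_map_zero_of_le (le_max_left a b) ha,
        Module.End.pow_map_zero_of_le (le_max_right a b) hb, add_zero]⟩
    · intro y hy j hj hyj
      have hk : ∀ k : ℕ, ((LieAlgebra.ad F L x : Module.End F L) ^ k) y ∈ M ∧
          q (((LieAlgebra.ad F L x : Module.End F L) ^ k) y) = ζ ^ (j + k * s) • ((LieAlgebra.ad F L x : Module.End F L) ^ k) y := by
        intro k
        induction k with
        | zero => simpa using ⟨hy, hyj⟩
        | succ k ihk =>
          rw [pow_succ', Module.End.mul_apply, LieAlgebra.ad_apply]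
          refine ⟨M.lie_mem hx ihk.1, ?_⟩
          rw [LieEquiv.map_lie, hxs, ihk.2, smul_lie, lie_smul, smul_smul, ← pow_add]
          congr 2; ring
      have hex : ∃ k, m ≤ j + k * s := ⟨m, by nlinarith⟩
      obtain ⟨k, hkm, hkmin⟩ : ∃ k, m ≤ j + k * s ∧ j + k * s < m + s := by
        classical
        refine ⟨Nat.find hex, Nat.find_spec hex, ?_⟩
        have h1 : Nat.find hex ≠ 0 := by
          intro h; have := Nat.find_spec hex; rw [h] at this; omega
        obtain ⟨k', hk'⟩ := Nat.exists_eq_succ_of_ne_zero h1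
        have := Nat.find_min hex (m := k') (by omega)
        rw [hk', Nat.succ_mul]
        omega
      refine ⟨k + 1, ?_⟩
      rw [pow_succ', Module.End.mul_apply, LieAlgebra.ad_apply, ← lie_skew]
      rw [ih (j + k * s - m) (by omega) (by omega) _ (hk k).1 ?_ x hx, neg_zero]
      rw [(hk k).2]
      congr 1
      conv_lhs => rw [show j + k * s = (j + k * s - m) + m by omega, pow_add, hζ.pow_eq_one, mul_one]
  obtain ⟨t, ht, -⟩ := JD.exist (F := F) x
  have htM := hM.jc x hx t ht
  have htZ : ∀ y ∈ M, ⁅t, y⁆ = 0 := by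
    intro y hy
    obtain ⟨a, ha⟩ := hnil y hy
    obtain ⟨b, hb⟩ := ht.nil
    apply ht.ss.diag.engel
    refine (LieSubalgebra.mem_engel_iff F t y).2 ⟨a + b, ?_⟩
    have hc : Commute (LieAlgebra.ad F L x : Module.End F L) (LieAlgebra.ad F L (x - t)) := by
      apply ad_commute
      rw [lie_sub, lie_self, ← lie_skew, ht.comm]; simp
    have := comm_nil hc ha hb
    rw [← map_sub] at this
    simpa using this
  have hnM : x - t ∈ M := sub_mem hx htM
  have hqt := ht.eigen q _ hxs
  have hnq : q (x - t) = ζ ^ s • (x - t) := by rw [map_sub, hxs, hqt, smul_sub]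
  have hn0 : x - t = 0 := by
    apply hM.nd _ hnM
    refine eig_ind hq hm hqm hζ _ (by simp) (fun u v hu hv => by rw [map_add, hu, hv, add_zero]) ?_
    intro y hy j hj hyj
    by_cases hsj : s + j = m
    · have hcM : ⁅x - t, y⁆ ∈ M := M.lie_mem hnM hy
      have hqc : q ⁅x - t, y⁆ = ⁅x - t, y⁆ := by
        rw [LieEquiv.map_lie, hnq, hyj, smul_lie, lie_smul, smul_smul, ← pow_add, hsj, hζ.pow_eq_one, one_smul]
      have hcZ := hZ _ hcM hqc
      have hcn : IsNilpotent (LieAlgebra.ad F L ⁅x - t, y⁆ : Module.End F L) := by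
        refine jacobson (LieAlgebra.ad F L (x - t)) (LieAlgebra.ad F L y) _ ?_ ?_ ?_
        · ext z
          simp only [LinearMap.sub_apply, Module.End.mul_apply, LieAlgebra.ad_apply]
          rw [lie_lie]
        · exact (ad_commute (hcZ _ hnM)).symm
        · exact (ad_commute (hcZ _ hy)).symm
      have hc0 : ⁅x - t, y⁆ = 0 := hM.nd _ hcM fun z hz => kap_zero (hcZ z hz) hcn
      exact kap_zero hc0 ht.nil
    · have h1 := LieAlgebra.killingForm_of_equiv_apply q (x - t) y
      rw [hnq, hyj, map_smul, map_smul, LinearMap.smul_apply, smul_smul, ← pow_add, smul_eq_mul] at h1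
      have h2 : (ζ ^ (j + s) - 1) * killingForm F L (x - t) y = 0 := by rw [sub_mul, h1, one_mul, sub_self]
      refine (mul_eq_zero.1 h2).resolve_left fun h3 => ?_
      obtain ⟨c, hc⟩ := (hζ.pow_eq_one_iff_dvd _).1 (sub_eq_zero.1 h3)
      have : c < 2 := by by_contra hc2; push Not at hc2; nlinarith
      interval_cases c <;> omega
  intro y hy
  rw [sub_eq_zero.1 hn0]
  exact htZ y hy

lemma Good.toral {M : LieSubalgebra F L} (hM : Good M) (hab : ∀ x ∈ M, ∀ y ∈ M, ⁅x, y⁆ = 0) : ∀ x ∈ M, SS F x := by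
  intro x hx
  obtain ⟨t, ht, -⟩ := JD.exist (F := F) x
  have htM := hM.jc x hx t ht
  have : x - t = 0 := hM.nd _ (sub_mem hx htM) fun y hy => kap_zero (hab _ (sub_mem hx htM) y hy) ht.nil
  rw [sub_eq_zero.1 this]
  exact ht.ss

theorem lemmaB {M : LieSubalgebra F L} (hM : Good M) {q : L ≃ₗ⁅F⁆ L} (hq : ∀ x ∈ M, q x ∈ M) {m : ℕ} (hm : 0 < m)
    (hqm : ∀ x, q^[m] x = x) : ∃ x ∈ M, q x = x ∧ SS F x ∧ Good (cenIn M x) ∧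
      ∀ a ∈ cenIn M x, ∀ b ∈ cenIn M x, ⁅a, b⁆ = 0 := by
  obtain ⟨x, ⟨hxM, hqx, hxs⟩, hmin⟩ := min_lemma (F := F) (fun x : L => x ∈ M ∧ q x = x ∧ SS F x) M.toSubmodule (fun x h => h.2.2)
    ⟨0, zero_mem M, map_zero q, by unfold SS; rw [map_zero]; exact isSemisimple_zero⟩
    (fun x s t hx hs h => ⟨add_mem hx.1 (M.smul_mem t hs.1), by rw [map_add, map_smul, hx.2.1, hs.2.1],
      hx.2.2.add (hs.2.2.smul t) (by rw [lie_smul, h, smul_zero])⟩)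
  refine ⟨x, hxM, hqx, hxs, hM.cen hxM hxs, ?_⟩
  have hc := hM.cen hxM hxs
  set c := cenIn M x with hcd
  have hqc : ∀ a ∈ c, q a ∈ c := fun a ha => ⟨hq a ha.1, by rw [← hqx, ← LieEquiv.map_lie, ha.2, map_zero]⟩
  have hP := hc.fix hqc hm hqm
  set P := fixIn c q with hPd
  have hPss : ∀ s ∈ P, SS F s → ∀ v ∈ c, ⁅s, v⁆ = 0 := fun s hs hss v hv =>
    hmin s ⟨hs.1.1, hs.2, hss⟩ hs.1.2 v hv.1 hv.2
  have hnil : LieRing.IsNilpotent P := by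
    rw [LieAlgebra.isNilpotent_iff_forall (R := F)]
    rintro ⟨a, ha⟩
    obtain ⟨t, ht, -⟩ := JD.exist (F := F) a
    have htP := hP.jc a ha t ht
    have e : LieAlgebra.ad F P ⟨a, ha⟩ = LieAlgebra.ad F P ⟨a - t, sub_mem ha htP⟩ := by
      ext z
      have := hPss t htP ht.ss z z.2.1
      simp [this]
    rw [e]
    exact LieSubalgebra.isNilpotent_ad_of_isNilpotent_ad P (x := ⟨a - t, sub_mem ha htP⟩) ht.nil
  have hab : IsLieAbelian P := by
    apply LieModule.isLieAbelian_of_ker_traceForm_eq_bot F P L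
    rw [LinearMap.ker_eq_bot']
    rintro ⟨a, ha⟩ h
    have : a = 0 := hP.nd a ha fun y hy => LinearMap.congr_fun h ⟨y, hy⟩
    exact Subtype.ext this
  have hPab : ∀ a ∈ P, ∀ b ∈ P, ⁅a, b⁆ = 0 := fun a ha b hb => congrArg Subtype.val (hab.trivial ⟨a, ha⟩ ⟨b, hb⟩)
  exact lemmaN hc hqc hm hqm fun a ha hqa y hy => hPss a ⟨ha, hqa⟩ (hP.toral hPab a ⟨ha, hqa⟩) y hy

lemma lemmaG {k : LieSubalgebra F L} (hab : ∀ x ∈ k, ∀ y ∈ k, ⁅x, y⁆ = 0) (hss : ∀ x ∈ k, SS F x) :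
    ∃ y ∈ k, ∀ v : L, ⁅y, v⁆ = 0 → ∀ s ∈ k, ⁅s, v⁆ = 0 := by
  obtain ⟨x, hx, h⟩ := min_lemma (F := F) (fun x : L => x ∈ k) ⊤ hss ⟨0, zero_mem k⟩
    (fun x s t hx hs _ => add_mem hx (k.smul_mem t hs))
  exact ⟨x, hx, fun v hv s hs => h s hs (hab x hx s hs) v trivial hv⟩

end B2
end E8P

namespace E8P
open Module.End

section A1
variable {F : Type*} [Field F] [CharZero F]
variable {L : Type*} [LieRing L] [LieAlgebra F L]

/-- Chevalley generators of type E8 with Serre relations -/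
structure E8D (F : Type*) [Field F] {L : Type*} [LieRing L] [LieAlgebra F L] (e f h : Fin 8 → L) : Prop where
  hh : ∀ i j, ⁅h i, h j⁆ = 0
  efd : ∀ i, ⁅e i, f i⁆ = h i
  ef : ∀ i j, i ≠ j → ⁅e i, f j⁆ = 0
  he : ∀ i j, ⁅h i, e j⁆ = (CartanMatrix.E₈ i j : F) • e j
  hf : ∀ i j, ⁅h i, f j⁆ = -((CartanMatrix.E₈ i j : F) • f j)
  se : ∀ i j, i ≠ j → ⁅e i, ⁅e i, e j⁆⁆ = 0
  sf : ∀ i j, i ≠ j → ⁅f i, ⁅f i, f j⁆⁆ = 0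
  gen : LieSubalgebra.lieSpan F L (Set.range e ∪ Set.range f) = ⊤

variable {e f h : Fin 8 → L}

lemma E8_diag (i) : CartanMatrix.E₈ i i = 2 := by fin_cases i <;> rfl

lemma E8D.fe (D : E8D F e f h) (i j) (hij : i ≠ j) : ⁅f i, e j⁆ = 0 := by
  rw [← lie_skew, D.ef j i hij.symm, neg_zero]
lemma E8D.fed (D : E8D F e f h) (i) : ⁅f i, e i⁆ = -h i := by
  rw [← lie_skew, D.efd]
lemma E8D.eh (D : E8D F e f h) (i j) : ⁅e j, h i⁆ = -((CartanMatrix.E₈ i j : F) • e j) := by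
  rw [← lie_skew, D.he]
lemma E8D.fh (D : E8D F e f h) (i j) : ⁅f j, h i⁆ = (CartanMatrix.E₈ i j : F) • f j := by
  rw [← lie_skew, D.hf, neg_neg]

lemma E8D.symm (D : E8D F e f h) : E8D F f e (fun i => - h i) where
  hh i j := by simp [D.hh]
  efd i := D.fed i
  ef i j hij := D.fe i j hij
  he i j := by rw [neg_lie, D.hf, neg_neg]
  hf i j := by rw [neg_lie, D.he]
  se := D.sf
  sf := D.se
  gen := by rw [Set.union_comm]; exact D.gen

lemma E8D.map (D : E8D F e f h) (g : L ≃ₗ⁅F⁆ L) : E8D F (fun i => g (e i)) (fun i => g (f i)) (fun i => g (h i)) where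
  hh i j := by rw [← LieEquiv.map_lie, D.hh, map_zero]
  efd i := by rw [← LieEquiv.map_lie, D.efd]
  ef i j hij := by rw [← LieEquiv.map_lie, D.ef i j hij, map_zero]
  he i j := by rw [← LieEquiv.map_lie, D.he, map_smul]
  hf i j := by rw [← LieEquiv.map_lie, D.hf, map_neg, map_smul]
  se i j hij := by rw [← LieEquiv.map_lie, ← LieEquiv.map_lie, D.se i j hij, map_zero]
  sf i j hij := by rw [← LieEquiv.map_lie, ← LieEquiv.map_lie, D.sf i j hij, map_zero]
  gen := by
    rw [eq_top_iff]
    have key : (⊤ : LieSubalgebra F L) ≤ (LieSubalgebra.lieSpan F L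
        (Set.range (fun i => g (e i)) ∪ Set.range fun i => g (f i))).comap g.toLieHom := by
      rw [← D.gen, LieSubalgebra.lieSpan_le]
      rintro _ (⟨i, rfl⟩ | ⟨i, rfl⟩)
      · exact LieSubalgebra.subset_lieSpan (Or.inl ⟨i, rfl⟩)
      · exact LieSubalgebra.subset_lieSpan (Or.inr ⟨i, rfl⟩)
    intro x _
    have := key (LieSubalgebra.mem_top (g.symm x))
    rw [LieSubalgebra.mem_comap] at this
    change g (g.symm x) ∈ (LieSubalgebra.lieSpan F L (Set.range (fun i => g (e i)) ∪ Set.range fun i => g (f i))) at this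
    rwa [LieEquiv.apply_symm_apply] at this

lemma E8D.induct (D : E8D F e f h) (T : LieSubalgebra F L) (h1 : ∀ i, e i ∈ T) (h2 : ∀ i, f i ∈ T) (x : L) : x ∈ T := by
  have : (⊤ : LieSubalgebra F L) ≤ T := by
    rw [← D.gen, LieSubalgebra.lieSpan_le]
    rintro _ (⟨i, rfl⟩ | ⟨i, rfl⟩)
    · exact h1 i
    · exact h2 i
  exact this (LieSubalgebra.mem_top x)

/-- weight spaces -/
def wt (F : Type*) [Field F] {L : Type*} [LieRing L] [LieAlgebra F L] (h : Fin 8 → L) (l : Fin 8 → ℤ) : Submodule F L where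
  carrier := {x | ∀ i, ⁅h i, x⁆ = (cc l i : F) • x}
  add_mem' := fun ha hb i => by rw [lie_add, ha i, hb i, smul_add]
  zero_mem' := fun i => by simp
  smul_mem' := fun c x hx i => by rw [lie_smul, hx i, smul_comm]

lemma mem_wt {l : Fin 8 → ℤ} {x : L} : x ∈ wt F h l ↔ ∀ i, ⁅h i, x⁆ = (cc l i : F) • x := Iff.rfl

lemma wt_neg (l : Fin 8 → ℤ) : wt F (fun i => - h i) l = wt F h (-l) := by
  ext x
  rw [mem_wt, mem_wt]
  refine forall_congr' fun i => ?_
  rw [neg_lie, cc_neg, Pi.neg_apply, Int.cast_neg, neg_smul, neg_eq_iff_eq_neg]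

lemma wt_lie {l m : Fin 8 → ℤ} {x y : L} (hx : x ∈ wt F h l) (hy : y ∈ wt F h m) : ⁅x, y⁆ ∈ wt F h (l + m) := by
  intro i
  rw [leibniz_lie, hx i, hy i, smul_lie, lie_smul, ← add_smul, cc_add, Pi.add_apply, Int.cast_add]

lemma E8D.h_wt (D : E8D F e f h) (i) : h i ∈ wt F h 0 := fun j => by simp [D.hh, cc_zero]
lemma E8D.e_wt (D : E8D F e f h) (i) : e i ∈ wt F h (al i) := fun j => by rw [D.he, cc_al]
lemma E8D.f_wt (D : E8D F e f h) (i) : f i ∈ wt F h (-al i) := fun j => by rw [D.hf, cc_neg, Pi.neg_apply, cc_al]; simp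

lemma cc_inj : Function.Injective cc := fun a b hab => by
  rw [← sub_eq_zero]; apply bil_nondeg; intro i; rw [cc_sub, hab, sub_self]; rfl

lemma ad_commute' {x y : L} (h : ⁅x, y⁆ = 0) :
    Commute (LieAlgebra.ad F L x : Module.End F L) (LieAlgebra.ad F L y) := by
  apply LinearMap.ext
  intro z
  change ⁅x, ⁅y, z⁆⁆ = ⁅y, ⁅x, z⁆⁆
  rw [leibniz_lie, h, zero_lie, zero_add]

lemma indep_aux {V : Type*} [AddCommGroup V] [Module F V] (A : Fin 8 → Module.End F V) (hA : ∀ i j, Commute (A i) (A j))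
    {ι : Type*} (g : ι → Fin 8 → F) (hg : Function.Injective g) (W : ι → Submodule F V)
    (hW : ∀ l, ∀ x ∈ W l, ∀ i, A i x = g l i • x) : iSupIndep W := by
  have h1 := independent_iInf_maxGenEigenspace_of_forall_mapsTo A
    (fun i j φ => Module.End.mapsTo_maxGenEigenspace_of_comm (hA j i) φ)
  refine (h1.comp hg).mono fun l x hx => ?_
  rw [Function.comp, Submodule.mem_iInf]
  intro i
  have h3 : x ∈ (A i).eigenspace (g l i) := mem_eigenspace_iff.2 (hW l x hx i)
  exact Module.End.genEigenspace_le_maximal (A i) (g l i) 1 h3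

lemma E8D.indep (D : E8D F e f h) : iSupIndep (wt F h) := by
  refine indep_aux (fun i => (LieAlgebra.ad F L (h i) : Module.End F L)) (fun i j => ad_commute' (D.hh i j))
    (fun l i => (cc l i : F)) ?_ (wt F h) (fun l x hx => hx)
  intro a b hab
  apply cc_inj
  ext i
  have h3 : (cc a i : F) = (cc b i : F) := congrFun hab i
  exact Int.cast_injective h3

/-- monomials -/
inductive Mon (e : Fin 8 → L) : (Fin 8 → ℤ) → L → Prop
  | base (i) : Mon e (al i) (e i)
  | step (i) {l x} : Mon e l x → Mon e (al i + l) ⁅e i, x⁆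

lemma Mon.pos {l x} (hm : Mon e l x) : 0 ≤ l ∧ 1 ≤ ∑ i, l i := by
  induction hm with
  | base i => exact ⟨fun j => al_apply_nonneg i j, by simp [al, Pi.single_apply]⟩
  | step i _ ih =>
    refine ⟨add_nonneg (fun j => al_apply_nonneg i j) ih.1, ?_⟩
    simp only [Pi.add_apply, Finset.sum_add_distrib]
    have : ∑ j, al i j = 1 := by simp [al, Pi.single_apply]
    omega

lemma al_inj {i j : Fin 8} (h : al i = al j) : i = j := by
  by_contra hij
  have := congrFun h i
  simp [al, Pi.single_apply, hij] at this

lemma sum_al' (i : Fin 8) : ∑ j, al i j = 1 := by simp [al, Pi.single_apply]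

lemma Mon.simple {l x} (hm : Mon e l x) : ∀ i, (l = al i → x = e i) ∧ ∀ k : ℤ, 2 ≤ k → l = k • al i → x = 0 := by
  induction hm with
  | base j =>
    refine fun i => ⟨fun h => by rw [al_inj h], fun k hk h => ?_⟩
    have := congrArg (fun v : Fin 8 → ℤ => ∑ s, v s) h
    simp only [Pi.smul_apply, smul_eq_mul, ← Finset.mul_sum, sum_al'] at this
    omega
  | @step j l x hm ih =>
    refine fun i => ⟨fun h => ?_, fun k hk h => ?_⟩
    · have := congrArg (fun v : Fin 8 → ℤ => ∑ s, v s) h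
      simp only [Pi.add_apply, Finset.sum_add_distrib, sum_al'] at this
      have := hm.pos.2
      omega
    · have hji : j = i := by
        by_contra hji
        have := congrFun h j
        have h2 := hm.pos.1 j
        simp [al, Pi.single_apply, hji] at this h2
        omega
      subst hji
      have hl : l = (k - 1) • al j := by rw [sub_smul, one_smul, ← h, add_sub_cancel_left]
      rcases eq_or_lt_of_le hk with rfl | hk
      · rw [(ih j).1 (by rw [hl]; norm_num), lie_self]
      · rw [(ih j).2 (k - 1) (by omega) hl, lie_zero]

lemma E8D.mon_wt (D : E8D F e f h) {l x} (hm : Mon e l x) : x ∈ wt F h l := by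
  induction hm with
  | base i => exact D.e_wt i
  | step i _ ih => exact wt_lie (D.e_wt i) ih

/-- lower part -/
def bo (F : Type*) [Field F] {L : Type*} [LieRing L] [LieAlgebra F L] (f h : Fin 8 → L) : Submodule F L :=
  Submodule.span F ({x | ∃ l, Mon f l x} ∪ Set.range h)

lemma bo_mon {l x} (hm : Mon f l x) : x ∈ bo F f h := Submodule.subset_span (Or.inl ⟨l, hm⟩)
lemma bo_h (i) : h i ∈ bo F f h := Submodule.subset_span (Or.inr ⟨i, rfl⟩)

lemma E8D.bo_f (D : E8D F e f h) (i) {x : L} (hx : x ∈ bo F f h) : ⁅f i, x⁆ ∈ bo F f h := by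
  induction hx using Submodule.span_induction with
  | mem x hx =>
    rcases hx with ⟨l, hl⟩ | ⟨j, rfl⟩
    · exact bo_mon (Mon.step i hl)
    · rw [D.fh]; exact Submodule.smul_mem _ _ (bo_mon (Mon.base i))
  | zero => rw [lie_zero]; exact zero_mem _
  | add x y _ _ hx hy => rw [lie_add]; exact add_mem hx hy
  | smul c x _ hx => rw [lie_smul]; exact Submodule.smul_mem _ _ hx

lemma E8D.mon_e (D : E8D F e f h) (j) {l x} (hm : Mon f l x) : ⁅e j, x⁆ ∈ bo F f h := by
  induction hm with
  | base i =>
    by_cases hij : j = i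
    · subst hij; rw [D.efd]; exact bo_h j
    · rw [D.ef j i hij]; exact zero_mem _
  | @step i l x hm ih =>
    rw [leibniz_lie]
    refine add_mem ?_ (D.bo_f i ih)
    by_cases hij : j = i
    · subst hij
      have h1 := D.symm.mon_wt hm j
      rw [D.efd, ← neg_neg (h j), neg_lie, h1]
      exact neg_mem (Submodule.smul_mem _ _ (bo_mon hm))
    · rw [D.ef j i hij, zero_lie]; exact zero_mem _

lemma bo_symm : bo F f (fun i => - h i) = bo F f h := by
  apply le_antisymm
  · rw [bo, Submodule.span_le]
    rintro _ (⟨l, hl⟩ | ⟨j, rfl⟩)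
    · exact bo_mon hl
    · exact neg_mem (bo_h j)
  · rw [bo, Submodule.span_le]
    rintro _ (⟨l, hl⟩ | ⟨j, rfl⟩)
    · exact bo_mon hl
    · rw [← neg_neg (h j)]; exact neg_mem (bo_h (h := fun i => - h i) j)

lemma E8D.tri_e (D : E8D F e f h) (j) {x : L} (hx : x ∈ bo F e h ⊔ bo F f h) : ⁅e j, x⁆ ∈ bo F e h ⊔ bo F f h := by
  obtain ⟨y, hy, z, hz, rfl⟩ := Submodule.mem_sup.1 hx
  rw [lie_add]
  refine add_mem (Submodule.mem_sup_left ?_) ?_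
  · rw [← bo_symm] at hy ⊢
    exact D.symm.bo_f j hy
  · clear hx
    induction hz using Submodule.span_induction with
    | mem x hx =>
      rcases hx with ⟨l, hl⟩ | ⟨i, rfl⟩
      · exact Submodule.mem_sup_right (D.mon_e j hl)
      · rw [D.eh]; exact neg_mem (Submodule.smul_mem _ _ (Submodule.mem_sup_left (bo_mon (Mon.base j))))
    | zero => rw [lie_zero]; exact zero_mem _
    | add x y _ _ hx hy => rw [lie_add]; exact add_mem hx hy
    | smul c x _ hx => rw [lie_smul]; exact Submodule.smul_mem _ _ hx

lemma E8D.tri (D : E8D F e f h) (x : L) : x ∈ bo F e h ⊔ bo F f h := by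
  set T := bo F e h ⊔ bo F f h with hT
  have hf : ∀ j, ∀ x ∈ T, ⁅f j, x⁆ ∈ T := by
    intro j x hx
    have := D.symm.tri_e j (x := x)
    rw [bo_symm, bo_symm, sup_comm, ← hT] at this
    exact this hx
  have h1 : ∀ y : L, ∀ x ∈ T, ⁅y, x⁆ ∈ T := by
    let S : LieSubalgebra F L :=
      { carrier := {y | ∀ x ∈ T, ⁅y, x⁆ ∈ T}
        add_mem' := fun ha hb x hx => by rw [add_lie]; exact add_mem (ha x hx) (hb x hx)
        zero_mem' := fun x _ => by rw [zero_lie]; exact zero_mem _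
        smul_mem' := fun c a ha x hx => by rw [smul_lie]; exact T.smul_mem _ (ha x hx)
        lie_mem' := fun {a b} ha hb x hx => by
          rw [lie_lie]; exact sub_mem (ha _ (hb x hx)) (hb _ (ha x hx)) }
    exact D.induct S (fun i x hx => D.tri_e i hx) hf
  let S : LieSubalgebra F L := { T with lie_mem' := fun {a b} _ hb => h1 a b hb }
  exact D.induct S (fun i => Submodule.mem_sup_left (bo_mon (Mon.base i)))
    (fun i => Submodule.mem_sup_right (bo_mon (Mon.base i))) x

/-- span of monomials of given weight -/
def sm (F : Type*) [Field F] {L : Type*} [LieRing L] [LieAlgebra F L] (e f h : Fin 8 → L) (l : Fin 8 → ℤ) : Submodule F L :=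
  Submodule.span F {x | Mon e l x ∨ Mon f (-l) x ∨ (l = 0 ∧ x ∈ Set.range h)}

lemma E8D.sm_eq (D : E8D F e f h) : sm F e f h = wt F h := by
  apply (D.indep.le_iff_eq_of_iSup_eq_top ?_).1
  · intro l
    rw [sm, Submodule.span_le]
    rintro x (hx | hx | ⟨rfl, ⟨i, rfl⟩⟩)
    · exact D.mon_wt hx
    · have := D.symm.mon_wt hx
      rwa [wt_neg, neg_neg] at this
    · exact D.h_wt i
  · rw [eq_top_iff]
    intro x _
    have hle : bo F e h ⊔ bo F f h ≤ ⨆ l, sm F e f h l := by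
      refine sup_le ?_ ?_ <;> rw [bo, Submodule.span_le] <;> rintro _ (⟨l, hl⟩ | ⟨j, rfl⟩)
      · exact Submodule.mem_iSup_of_mem l (Submodule.subset_span (Or.inl hl))
      · exact Submodule.mem_iSup_of_mem 0 (Submodule.subset_span (Or.inr (Or.inr ⟨rfl, j, rfl⟩)))
      · exact Submodule.mem_iSup_of_mem (-l) (Submodule.subset_span (Or.inr (Or.inl (by rwa [neg_neg]))))
      · exact Submodule.mem_iSup_of_mem 0 (Submodule.subset_span (Or.inr (Or.inr ⟨rfl, j, rfl⟩)))
    exact hle (D.tri x)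

lemma E8D.iSup_wt (D : E8D F e f h) : ⨆ l, wt F h l = ⊤ := by
  rw [eq_top_iff]
  intro x _
  have hle : bo F e h ⊔ bo F f h ≤ ⨆ l, wt F h l := by
    refine sup_le ?_ ?_ <;> rw [bo, Submodule.span_le] <;> rintro _ (⟨l, hl⟩ | ⟨j, rfl⟩)
    · exact Submodule.mem_iSup_of_mem l (D.mon_wt hl)
    · exact Submodule.mem_iSup_of_mem 0 (D.h_wt j)
    · refine Submodule.mem_iSup_of_mem (-l) ?_
      have := D.symm.mon_wt hl
      rwa [wt_neg] at this
    · exact Submodule.mem_iSup_of_mem 0 (D.h_wt j)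
  exact hle (D.tri x)

lemma E8D.wt_zero (D : E8D F e f h) : wt F h 0 = Submodule.span F (Set.range h) := by
  rw [← D.sm_eq, sm]
  congr 1
  ext x
  constructor
  · rintro (hx | hx | ⟨-, hx⟩)
    · have := hx.pos.2; simp at this
    · have := hx.pos.2; simp at this
    · exact hx
  · exact fun hx => Or.inr (Or.inr ⟨rfl, hx⟩)

lemma E8D.wt_al (D : E8D F e f h) (i) {x : L} (hx : x ∈ wt F h (al i)) : ∃ c : F, x = c • e i := by
  have : wt F h (al i) ≤ Submodule.span F {e i} := by
    rw [← D.sm_eq, sm, Submodule.span_le]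
    rintro x (hx | hx | ⟨h0, -⟩)
    · rw [(hx.simple i).1 rfl]; exact Submodule.mem_span_singleton_self _
    · have := hx.pos.2; simp [sum_al'] at this
    · have := congrArg (fun v : Fin 8 → ℤ => ∑ s, v s) h0
      simp [sum_al'] at this
  obtain ⟨c, hc⟩ := Submodule.mem_span_singleton.1 (this hx)
  exact ⟨c, hc.symm⟩

lemma E8D.wt_mul (D : E8D F e f h) (i) {k : ℤ} (hk : 2 ≤ k) {x : L} (hx : x ∈ wt F h (k • al i)) : x = 0 := by
  have : wt F h (k • al i) ≤ ⊥ := by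
    rw [← D.sm_eq, sm, Submodule.span_le]
    rintro x (hx | hx | ⟨h0, -⟩)
    · exact (hx.simple i).2 k hk rfl
    · have := hx.pos.2; simp [sum_al', ← Finset.mul_sum] at this; omega
    · have := congrArg (fun v : Fin 8 → ℤ => ∑ s, v s) h0
      simp [sum_al', ← Finset.mul_sum] at this; omega
  exact this hx

lemma E8D.wt_sign (D : E8D F e f h) {l : Fin 8 → ℤ} {x : L} (hx : x ∈ wt F h l) (h0 : x ≠ 0) : 0 ≤ l ∨ l ≤ 0 := by
  by_contra hcon
  push Not at hcon
  have : wt F h l ≤ ⊥ := by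
    rw [← D.sm_eq, sm, Submodule.span_le]
    rintro x (hx | hx | ⟨h0, -⟩)
    · exact absurd hx.pos.1 hcon.1
    · exact absurd (neg_nonneg.1 hx.pos.1) hcon.2
    · exact absurd h0.le hcon.2
  exact h0 (this hx)

lemma E8D.locnil (D : E8D F e f h) (i) : LocNil (LieAlgebra.ad F L (e i) : L →ₗ[F] L) := by
  intro x
  have : x ∈ LieSubalgebra.engel F (e i) := by
    refine D.induct _ (fun j => ?_) (fun j => ?_) x
    · rw [LieSubalgebra.mem_engel_iff]
      by_cases hij : i = j
      · subst hij; exact ⟨1, by simp⟩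
      · exact ⟨2, by simp [pow_two, D.se i j hij]⟩
    · rw [LieSubalgebra.mem_engel_iff]
      by_cases hij : i = j
      · subst hij; exact ⟨3, by simp [pow_succ, D.efd, D.eh]⟩
      · exact ⟨1, by simp [D.ef i j hij]⟩
  exact (LieSubalgebra.mem_engel_iff F _ _).1 this

end A1
end E8P

namespace E8P
open Module.End

section A2
variable {F : Type*} [Field F] [CharZero F]
variable {L : Type*} [LieRing L] [LieAlgebra F L]
variable {e f h : Fin 8 → L}

/-- exponential of ad -/
lemma exists_exp {x : L} (hx : LocNil (LieAlgebra.ad F L x : L →ₗ[F] L)) (c : F) :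
    ∃ g : L ≃ₗ⁅F⁆ L, (∀ a, ⁅x, a⁆ = 0 → g a = a) ∧ (∀ a, ⁅x, ⁅x, a⁆⁆ = 0 → g a = a + c • ⁅x, a⁆) ∧
      (∀ a, ⁅x, ⁅x, ⁅x, a⁆⁆⁆ = 0 → g a = a + c • ⁅x, a⁆ + (c ^ 2 / 2) • ⁅x, ⁅x, a⁆⁆) := by
  have hD : ((c • LieDerivation.ad F L x : LieDerivation F L L) : L →ₗ[F] L) = c • LieAlgebra.ad F L x := by
    ext x; simp
  have hl : LocNil ((c • LieDerivation.ad F L x : LieDerivation F L L) : L →ₗ[F] L) := by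
    intro y
    obtain ⟨n, hn⟩ := hx y
    refine ⟨n, ?_⟩
    rw [hD, smul_pow, LinearMap.smul_apply, hn, smul_zero]
  refine ⟨expAut _ hl, fun a ha => ?_, fun a ha => ?_, fun a ha => ?_⟩
  · rw [expAut_apply, expFun_eq (n := 1)]
    · simp
    · rw [hD]; simp [ha]
  · rw [expAut_apply, expFun_eq (n := 2)]
    · rw [hD]; simp [Finset.sum_range_succ]
    · rw [hD, smul_pow, LinearMap.smul_apply]
      have : ((LieAlgebra.ad F L x : Module.End F L) ^ 2) a = 0 := by simp [pow_two, ha]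
      rw [this, smul_zero]
  · rw [expAut_apply, expFun_eq (n := 3)]
    · rw [hD]
      have h2 : ((c • (LieAlgebra.ad F L x : Module.End F L)) ^ 2) a = c ^ 2 • ⁅x, ⁅x, a⁆⁆ := by
        rw [smul_pow, LinearMap.smul_apply]; simp [pow_two]
      simp only [Finset.sum_range_succ, Finset.sum_range_zero, h2, pow_zero, pow_one, Module.End.one_apply]
      simp [Nat.factorial, smul_smul]
      congr 1
      field_simp
    · rw [hD, smul_pow, LinearMap.smul_apply]
      have : ((LieAlgebra.ad F L x : Module.End F L) ^ 3) a = 0 := by simp [pow_succ, ha]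
      rw [this, smul_zero]

lemma E8D.refl (D : E8D F e f h) (i) : ∃ g : L ≃ₗ⁅F⁆ L, ∀ j, g (h j) = h j - (CartanMatrix.E₈ j i : F) • h i := by
  obtain ⟨g1, ha, hb, -⟩ := exists_exp (D.locnil i) 1
  obtain ⟨g2, -, hd, hc⟩ := exists_exp (D.symm.locnil i) (-1)
  refine ⟨(g1.trans g2).trans g1, fun j => ?_⟩
  rw [LieEquiv.trans_apply, LieEquiv.trans_apply]
  set a : F := (CartanMatrix.E₈ j i : F) with haa
  have h2 : (CartanMatrix.E₈ i i : F) = 2 := by rw [E8_diag]; norm_num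
  have e1 : ∀ j, g1 (h j) = h j - (CartanMatrix.E₈ j i : F) • e i := by
    intro j; rw [hb _ (by rw [D.eh]; simp), D.eh]; simp [sub_eq_add_neg]
  have e2 : g2 (h j) = h j - a • f i := by
    rw [hd _ (by rw [D.fh]; simp), D.fh]; simp [sub_eq_add_neg, haa]
  have e3 : g2 (e i) = e i + h i - f i := by
    rw [hc _ (by rw [D.fed, lie_neg, D.fh]; simp), D.fed, lie_neg, D.fh, h2]
    simp [smul_smul, sub_eq_add_neg]
  have e4 : g1 (e i) = e i := ha _ (lie_self _)
  rw [e1, map_sub, map_smul, e2, e3]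
  have : h j - a • f i - a • (e i + h i - f i) = h j - a • e i - a • h i := by module
  rw [this, map_sub, map_sub, map_smul, map_smul, e1, e1, e4, h2]
  module

lemma E8D.refl_wt (D : E8D F e f h) (i) : ∃ g : L ≃ₗ⁅F⁆ L, ∀ l x, x ∈ wt F h l ↔ g x ∈ wt F h (rfl' (al i) l) := by
  obtain ⟨g, hg⟩ := D.refl i
  have h2 : (CartanMatrix.E₈ i i : F) = 2 := by rw [E8_diag]; norm_num
  have hg2 : ∀ j, g (g (h j)) = h j := by
    intro j; rw [hg, map_sub, map_smul, hg, hg, h2]; module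
  have hcc : ∀ l j, cc (rfl' (al i) l) j = cc l j - CartanMatrix.E₈ j i * cc l i := by
    intro l j
    rw [rfl', bil_al_right, cc_sub, cc_smul, Pi.sub_apply, Pi.smul_apply, cc_al, smul_eq_mul, mul_comm]
  have key : ∀ l x, x ∈ wt F h l → g x ∈ wt F h (rfl' (al i) l) := by
    intro l x hx j
    rw [hcc, ← hg2 j, ← LieEquiv.map_lie, hg, sub_lie, smul_lie, hx, hx, smul_smul, ← sub_smul, map_smul]
    push_cast; rfl
  have key2 : ∀ l x, g x ∈ wt F h l → x ∈ wt F h (rfl' (al i) l) := by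
    intro l x hx j
    apply g.injective
    change g ⁅h j, x⁆ = g (((cc (rfl' (al i) l) j : ℤ) : F) • x)
    rw [LieEquiv.map_lie, hg, sub_lie, smul_lie, hx, hx, smul_smul, ← sub_smul, map_smul, hcc]
    push_cast; rfl
  refine ⟨g, fun l x => ⟨key l x, fun hx => ?_⟩⟩
  have := key2 _ _ hx
  rwa [rfl'_rfl' (isRt_al i)] at this

lemma rfl'_neg (r v) : rfl' r (-v) = - rfl' r v := by
  simp only [rfl', bil_neg_left]; module

lemma E8D.desc (D : E8D F e f h) : ∀ n : ℕ, ∀ l : Fin 8 → ℤ, 0 ≤ l → ∑ i, l i ≤ (n : ℤ) → l ≠ 0 → ∀ x ∈ wt F h l, x ≠ 0 → IsRt l := by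
  intro n
  induction n with
  | zero =>
    intro l h0 hs hl
    exfalso; apply hl
    have := (Finset.sum_eq_zero_iff_of_nonneg (fun i _ => h0 i)).1 (le_antisymm (by exact_mod_cast hs) (Finset.sum_nonneg fun i _ => h0 i))
    ext i; exact this i (Finset.mem_univ i)
  | succ n ih =>
    intro l h0 hs hl x hx hx0
    have hpos : 0 < bil l l := by rw [bil_self]; have := hn_pos l hl; omega
    obtain ⟨i, -, hi⟩ := Finset.exists_lt_of_sum_lt (s := Finset.univ) (f := fun _ => (0:ℤ)) (g := fun i => l i * cc l i)
      (by simpa [bil] using hpos)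
    have hli : 0 < l i := by
      rcases (h0 i).lt_or_eq with h | h
      · exact h
      · rw [← h] at hi; simp at hi
    have hci : 0 < cc l i := by
      by_contra h; push Not at h; nlinarith
    obtain ⟨g, hg⟩ := D.refl_wt i
    have hgx := (hg l x).1 hx
    have hgx0 : g x ≠ 0 := by simpa using hx0
    have hr : rfl' (al i) l = l - cc l i • al i := by rw [rfl', bil_al_right]
    have hrl : rfl' (al i) (rfl' (al i) l) = l := rfl'_rfl' (isRt_al i) l
    have hr0 : rfl' (al i) l ≠ 0 := by
      intro h; rw [h] at hrl; apply hl; rw [← hrl]; simp [rfl', bil]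
    rcases D.wt_sign hgx hgx0 with h1 | h1
    · have := ih _ h1 ?_ hr0 _ hgx hgx0
      · rw [← hrl]; exact (isRt_al i).rfl' this
      · rw [hr]
        simp only [Pi.sub_apply, Pi.smul_apply, Finset.sum_sub_distrib, smul_eq_mul, ← Finset.mul_sum, sum_al']
        push_cast at hs; omega
    · have hk : l = l i • al i := by
        ext j
        by_cases hj : j = i
        · subst hj; simp [al]
        · have h2 := h1 j
          have h3 := h0 j
          rw [hr] at h2
          simp [al, hj] at h2 h3 ⊢
          omega
      rcases (show 1 ≤ l i from hli).eq_or_lt with h3 | h3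
      · rw [hk, ← h3, one_smul]; exact isRt_al i
      · rw [hk] at hx
        exact absurd (D.wt_mul i h3 hx) hx0

lemma E8D.isRt (D : E8D F e f h) {l x} (hx : x ∈ wt F h l) (hx0 : x ≠ 0) (hl : l ≠ 0) : IsRt l := by
  rcases D.wt_sign hx hx0 with h0 | h0
  · exact D.desc (∑ i, l i).toNat l h0 (Int.self_le_toNat _) hl x hx hx0
  · rw [← isRt_neg]
    refine D.symm.desc (∑ i, (-l) i).toNat (-l) (by simpa using h0) (Int.self_le_toNat _) (by simpa using hl) x ?_ hx0
    rwa [wt_neg, neg_neg]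

/-- root vectors -/
lemma E8D.rootvec (D : E8D F e f h) (he : ∀ i, e i ≠ 0) : ∀ l, IsRt l → ∃ x y, x ≠ 0 ∧ x ∈ wt F h l ∧ y ∈ wt F h (-l) ∧
    ⁅⁅x, y⁆, x⁆ = (2:F) • x ∧ ∀ z ∈ wt F h l, ∃ c : F, z = c • x := by
  apply rt_induction
  · intro i
    refine ⟨e i, f i, he i, D.e_wt i, D.f_wt i, ?_, fun z hz => D.wt_al i hz⟩
    rw [D.efd, D.he, E8_diag]; norm_num
  · rintro i v - ⟨x, y, hx0, hx, hy, hxy, hz⟩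
    obtain ⟨g, hg⟩ := D.refl_wt i
    refine ⟨g x, g y, by simpa using hx0, (hg _ _).1 hx, by rw [← rfl'_neg]; exact (hg _ _).1 hy,
      by rw [← LieEquiv.map_lie, ← LieEquiv.map_lie, hxy, map_smul], fun z hz' => ?_⟩
    obtain ⟨c, hc⟩ := hz (g.symm z) ((hg _ _).2 (by rwa [LieEquiv.apply_symm_apply]))
    refine ⟨c, ?_⟩
    rw [← map_smul, ← hc, LieEquiv.apply_symm_apply]

lemma E8_conn (P : Fin 8 → Prop) (hP : ∀ i j, CartanMatrix.E₈ i j = -1 → P i → P j) (i : Fin 8) (hi : P i) : ∀ j, P j := by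
  have h3 : P 3 := by
    fin_cases i
    · exact hP 2 3 rfl (hP 0 2 rfl hi)
    · exact hP 1 3 rfl hi
    · exact hP 2 3 rfl hi
    · exact hi
    · exact hP 4 3 rfl hi
    · exact hP 4 3 rfl (hP 5 4 rfl hi)
    · exact hP 4 3 rfl (hP 5 4 rfl (hP 6 5 rfl hi))
    · exact hP 4 3 rfl (hP 5 4 rfl (hP 6 5 rfl (hP 7 6 rfl hi)))
  have h2 := hP 3 2 rfl h3
  have h4 := hP 3 4 rfl h3
  have h5 := hP 4 5 rfl h4
  have h6 := hP 5 6 rfl h5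
  have h7 := hP 6 7 rfl h6
  have h1 := hP 3 1 rfl h3
  have h0 := hP 2 0 rfl h2
  intro j
  fin_cases j <;> assumption

lemma E8D.e_ne (D : E8D F e f h) [Nontrivial L] (i) : e i ≠ 0 := by
  intro hi
  have hall : ∀ j, e j = 0 ∧ h j = 0 := by
    refine E8_conn (fun j => e j = 0 ∧ h j = 0) ?_ i ⟨hi, by rw [← D.efd, hi, zero_lie]⟩
    rintro a b hab ⟨-, hb⟩
    have := D.he a b
    rw [hb, zero_lie, hab] at this
    have : e b = 0 := by simpa using this
    exact ⟨this, by rw [← D.efd, this, zero_lie]⟩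
  have hf : ∀ j, f j = 0 := by
    intro j
    have := D.hf j j
    rw [(hall j).2, zero_lie, E8_diag] at this
    simpa using this
  obtain ⟨x, hx⟩ := exists_ne (0 : L)
  apply hx
  exact D.induct ⊥ (fun i => (hall i).1) hf x

/-- element of the Cartan subalgebra -/
noncomputable def hc (h : Fin 8 → L) (c : Fin 8 → F) : L := ∑ i, c i • h i

/-- weight evaluation -/
def ev (c : Fin 8 → F) (l : Fin 8 → ℤ) : F := ∑ i, c i * (cc l i : F)

lemma ev_add (c : Fin 8 → F) (l m) : ev c (l + m) = ev c l + ev c m := by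
  simp [ev, cc_add, mul_add, Finset.sum_add_distrib]
lemma ev_zero (c : Fin 8 → F) : ev c 0 = 0 := by simp [ev, cc_zero]

lemma hc_lie (c : Fin 8 → F) {l x} (hx : x ∈ wt F h l) : ⁅hc h c, x⁆ = ev c l • x := by
  rw [hc, sum_lie, ev, Finset.sum_smul]
  refine Finset.sum_congr rfl fun i _ => ?_
  rw [smul_lie, hx i, smul_smul]

lemma E8D.hc_mem (D : E8D F e f h) (c : Fin 8 → F) : hc h c ∈ wt F h 0 :=
  sum_mem fun i _ => Submodule.smul_mem _ _ (D.h_wt i)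

lemma E8D.exists_hc (D : E8D F e f h) {x} (hx : x ∈ wt F h 0) : ∃ c : Fin 8 → F, x = hc h c := by
  rw [D.wt_zero] at hx
  obtain ⟨c, hc⟩ := (Submodule.mem_span_range_iff_exists_fun F).1 hx
  exact ⟨c, hc.symm⟩

lemma E8D.hc_zero (D : E8D F e f h) [Nontrivial L] {c : Fin 8 → F} (h0 : ∀ i, ⁅hc h c, e i⁆ = 0) : c = 0 := by
  have h1 : ∀ i, ev c (al i) = 0 := fun i => by
    have := h0 i
    rw [hc_lie c (D.e_wt i)] at this
    exact (smul_eq_zero.1 this).resolve_right (D.e_ne i)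
  have h2 : ∀ l, ev c l = 0 := by
    intro l
    let E : (Fin 8 → ℤ) →+ F := ⟨⟨ev c, ev_zero c⟩, ev_add c⟩
    change E l = 0
    rw [← sum_al l, map_sum]
    refine Finset.sum_eq_zero fun i _ => ?_
    rw [map_zsmul]
    change l i • ev c (al i) = 0
    rw [h1, smul_zero]
  ext k
  have := h2 (om k)
  simpa [ev, cc_om, al, Pi.single_apply] using this

lemma rt_abs {l} (hl : IsRt l) (i) : |l i| ≤ 6 := by
  rw [abs_le]
  rcases hl.sign with h0 | h0
  · have h4 : l i ≤ hi i := hl.le_hi h0 i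
    have := hi_le i
    have h3 : 0 ≤ l i := h0 i
    constructor <;> omega
  · have h4 : -l i ≤ hi i := (isRt_neg.2 hl).le_hi (by simpa using h0) i
    have := hi_le i
    have h3 : l i ≤ 0 := h0 i
    constructor <;> omega

lemma rt_finite : {l | l = 0 ∨ IsRt l}.Finite := by
  refine (Set.finite_Icc (fun _ => (-6:ℤ)) (fun _ : Fin 8 => (6:ℤ))).subset ?_
  rintro l (rfl | hl)
  · constructor <;> intro i <;> simp
  · exact ⟨fun i => (abs_le.1 (rt_abs hl i)).1, fun i => (abs_le.1 (rt_abs hl i)).2⟩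

lemma E8D.iSup' (D : E8D F e f h) : ⨆ l : {l | l = 0 ∨ IsRt l}, wt F h l = ⊤ := by
  rw [eq_top_iff, ← D.iSup_wt]
  refine iSup_le fun l x hx => ?_
  by_cases hx0 : x = 0
  · rw [hx0]; exact zero_mem _
  by_cases hl : l = 0
  · exact Submodule.mem_iSup_of_mem (⟨l, Or.inl hl⟩ : {l | l = 0 ∨ IsRt l}) hx
  · exact Submodule.mem_iSup_of_mem (⟨l, Or.inr (D.isRt hx hx0 hl)⟩ : {l | l = 0 ∨ IsRt l}) hx

lemma E8D.finite (D : E8D F e f h) [Nontrivial L] : Module.Finite F L := by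
  have : Finite {l | l = 0 ∨ IsRt l} := rt_finite
  have hfg : ∀ l : {l | l = 0 ∨ IsRt l}, (wt F h l).FG := by
    rintro ⟨l, rfl | hl⟩
    · rw [D.wt_zero]; exact Submodule.fg_span (Set.finite_range h)
    · obtain ⟨x, y, -, hx, -, -, hz⟩ := D.rootvec D.e_ne l hl
      have : wt F h l = Submodule.span F {x} := by
        apply le_antisymm
        · intro z hz'
          obtain ⟨c, rfl⟩ := hz z hz'
          exact Submodule.smul_mem _ _ (Submodule.mem_span_singleton_self x)
        · rw [Submodule.span_singleton_le_iff_mem]; exact hx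
      rw [this]
      exact Submodule.fg_span_singleton x
  have := Submodule.fg_iSup _ hfg
  rw [D.iSup'] at this
  exact ⟨this⟩

/-- generic coefficients -/
def gco (F : Type*) [Field F] : Fin 8 → F := fun i => ((∑ k : Fin 8, 13 ^ (k : ℕ) * om k i : ℤ) : F)

lemma ev_gco (l) : ev (gco F) l = ((∑ k : Fin 8, 13 ^ (k : ℕ) * l k : ℤ) : F) := by
  have : (∑ i, (∑ k : Fin 8, 13 ^ (k : ℕ) * om k i) * cc l i : ℤ) = ∑ k : Fin 8, 13 ^ (k : ℕ) * l k := by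
    simp only [Finset.sum_mul]
    rw [Finset.sum_comm]
    refine Finset.sum_congr rfl fun k _ => ?_
    rw [← bil_om k l, bil, Finset.mul_sum]
    refine Finset.sum_congr rfl fun i _ => by ring
  rw [← this, ev, Int.cast_sum]
  refine Finset.sum_congr rfl fun i _ => ?_
  rw [gco, Int.cast_mul]

lemma gco_inj {l m} (hl : l = 0 ∨ IsRt l) (hm : m = 0 ∨ IsRt m) (h : ev (gco F) l = ev (gco F) m) : l = m := by
  rw [ev_gco, ev_gco] at h
  have h := Int.cast_injective h
  have bd : ∀ l : Fin 8 → ℤ, l = 0 ∨ IsRt l → ∀ i, -6 ≤ l i ∧ l i ≤ 6 := by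
    rintro l (rfl | hl) i
    · simp
    · exact abs_le.1 (rt_abs hl i)
  have b1 := bd l hl
  have b2 := bd m hm
  simp [Fin.sum_univ_eight] at h
  have := b1 0; have := b1 1; have := b1 2; have := b1 3; have := b1 4; have := b1 5; have := b1 6; have := b1 7
  have := b2 0; have := b2 1; have := b2 2; have := b2 3; have := b2 4; have := b2 5; have := b2 6; have := b2 7
  have e0 : l 0 = m 0 := by omega
  have e1 : l 1 = m 1 := by omega
  have e2 : l 2 = m 2 := by omega
  have e3 : l 3 = m 3 := by omega
  have e4 : l 4 = m 4 := by omega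
  have e5 : l 5 = m 5 := by omega
  have e6 : l 6 = m 6 := by omega
  have e7 : l 7 = m 7 := by omega
  ext i
  fin_cases i <;> assumption

/-- generic element -/
noncomputable def hs (F : Type*) [Field F] {L : Type*} [LieRing L] [LieAlgebra F L] (h : Fin 8 → L) : L := hc h (gco F)

lemma E8D.eig (D : E8D F e f h) {x : L} {c : F} (hx : ⁅hs F h, x⁆ = c • x) (hx0 : x ≠ 0) :
    ∃ l, (l = 0 ∨ IsRt l) ∧ x ∈ wt F h l ∧ c = ev (gco F) l := by
  set A : Module.End F L := LieAlgebra.ad F L (hs F h) with hA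
  let N : {l | l = 0 ∨ IsRt l} → F := fun l => ev (gco F) l
  have hN : Function.Injective N := fun l m hlm => Subtype.ext (gco_inj l.2 m.2 hlm)
  have hle : (fun l : {l | l = 0 ∨ IsRt l} => wt F h l) ≤ fun l => A.eigenspace (N l) := fun l x hx =>
    mem_eigenspace_iff.2 (hc_lie _ hx)
  have hind := A.eigenspaces_iSupIndep.comp hN
  have heq := (hind.le_iff_eq_of_iSup_eq_top D.iSup').1 hle
  by_cases hc : ∃ l, N l = c
  · obtain ⟨l, rfl⟩ := hc
    refine ⟨l, l.2, ?_, rfl⟩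
    have := congrFun heq l
    change wt F h l = A.eigenspace (N l) at this
    rw [this]; exact mem_eigenspace_iff.2 hx
  · exfalso
    have h1 := A.eigenspaces_iSupIndep c
    have h2 : (⊤ : Submodule F L) ≤ ⨆ (j) (_ : j ≠ c), A.eigenspace j := by
      rw [← D.iSup']
      refine iSup_le fun l => (hle l).trans ?_
      exact le_iSup₂_of_le (N l) (fun h => hc ⟨l, h⟩) le_rfl
    exact hx0 (Submodule.disjoint_def.1 h1 x (mem_eigenspace_iff.2 hx) (h2 trivial))

lemma E8D.eig_wt (D : E8D F e f h) {x : L} {c : Fin 8 → F} (hx : ∀ i, ⁅h i, x⁆ = c i • x) (hx0 : x ≠ 0) :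
    ∃ l, (l = 0 ∨ IsRt l) ∧ x ∈ wt F h l := by
  have key : ⁅hs F h, x⁆ = (∑ i, gco F i * c i) • x := by
    rw [hs, hc, sum_lie, Finset.sum_smul]
    refine Finset.sum_congr rfl fun i _ => ?_
    rw [smul_lie, hx i, smul_smul]
  obtain ⟨l, h1, h2, -⟩ := D.eig key hx0
  exact ⟨l, h1, h2⟩

/-- decomposition principle -/
lemma E8D.decomp [Module.Finite F L] (D : E8D F e f h) (p : Submodule F L) (hp : ∀ x ∈ p, ⁅hs F h, x⁆ ∈ p) (P : L → Prop) (h0 : P 0)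
    (hadd : ∀ x y, P x → P y → P (x + y)) (hw : ∀ l, (l = 0 ∨ IsRt l) → ∀ x ∈ p, x ∈ wt F h l → P x) : ∀ x ∈ p, P x := by
  intro x hx
  set A : Module.End F L := LieAlgebra.ad F L (hs F h) with hA
  have htop : ⨆ μ : F, A.genEigenspace μ 1 = ⊤ := by
    rw [eq_top_iff, ← D.iSup']
    exact iSup_le fun l y hy => Submodule.mem_iSup_of_mem (ev (gco F) l) (mem_eigenspace_iff.2 (hc_lie _ hy))
  have h1 := Submodule.inf_iSup_genEigenspace (f := A) (p := p) hp (k := 1)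
  rw [htop, inf_top_eq] at h1
  rw [h1] at hx
  induction hx using Submodule.iSup_induction' with
  | mem μ z hz =>
    by_cases hz0 : z = 0
    · rw [hz0]; exact h0
    obtain ⟨l, hl, hzl, -⟩ := D.eig (mem_eigenspace_iff.1 hz.2) hz0
    exact hw l hl z hz.1 hzl
  | zero => exact h0
  | add x y _ _ hx hy => exact hadd _ _ hx hy

lemma E8D.cen_hs (D : E8D F e f h) {x : L} : ⁅hs F h, x⁆ = 0 ↔ x ∈ wt F h 0 := by
  constructor
  · intro hx
    by_cases hx0 : x = 0
    · rw [hx0]; exact zero_mem _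
    obtain ⟨l, h1, h2, h3⟩ := D.eig (x := x) (c := 0) (by rw [hx, zero_smul]) hx0
    have : l = 0 := gco_inj (F := F) h1 (Or.inl rfl) (by rw [← h3, ev_zero])
    rwa [this] at h2
  · intro hx
    rw [hs, hc_lie _ hx, ev_zero, zero_smul]

lemma E8D.wt0_comm (D : E8D F e f h) {x y : L} (hx : x ∈ wt F h 0) (hy : y ∈ wt F h 0) : ⁅x, y⁆ = 0 := by
  obtain ⟨c, rfl⟩ := D.exists_hc hx
  rw [hc_lie c hy, ev_zero, zero_smul]

lemma wt_disj (D : E8D F e f h) {l m} (hlm : l ≠ m) {x : L} (h1 : x ∈ wt F h l) (h2 : x ∈ wt F h m) : x = 0 :=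
  Submodule.disjoint_def.1 (D.indep.pairwiseDisjoint hlm) x h1 h2

end A2
end E8P

namespace E8P
open Module.End

section A3
variable {F : Type*} [Field F] [CharZero F]
variable {L : Type*} [LieRing L] [LieAlgebra F L]
variable {e f h : Fin 8 → L}

/-- semisimplicity criterion for subalgebras containing the Cartan subalgebra -/
lemma E8D.ssm [Nontrivial L] (D : E8D F e f h) (M : LieSubalgebra F L) (hH : ∀ i, h i ∈ M)
    (hneg : ∀ l x, IsRt l → x ∈ M → x ∈ wt F h l → x ≠ 0 → ∀ y ∈ wt F h (-l), y ∈ M)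
    (hz : ∀ z ∈ wt F h 0, z ∈ M → (∀ a ∈ M, ⁅z, a⁆ = 0) → z = 0) : LieAlgebra.HasTrivialRadical F M := by
  have := D.finite
  rw [LieAlgebra.hasTrivialRadical_iff_no_abelian_ideals]
  intro I hI
  have hsM : hs F h ∈ M := by
    unfold hs hc
    exact sum_mem fun i _ => M.smul_mem _ (hH i)
  let p : Submodule F L := I.toSubmodule.map (M.toSubmodule.subtype)
  have hpM : ∀ x ∈ p, x ∈ M := by
    rintro _ ⟨x, -, rfl⟩; exact x.2
  have hpI : ∀ x ∈ p, ∃ x' : M, x' ∈ I ∧ (x' : L) = x := by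
    rintro _ ⟨x, hx, rfl⟩; exact ⟨x, hx, rfl⟩
  have hab : ∀ x ∈ p, ∀ y ∈ p, ⁅x, y⁆ = 0 := by
    intro x hx y hy
    obtain ⟨x', hx', rfl⟩ := hpI x hx
    obtain ⟨y', hy', rfl⟩ := hpI y hy
    have h1 := hI.trivial ⟨x', hx'⟩ ⟨y', hy'⟩
    have h2 : ⁅x', y'⁆ = 0 := congrArg Subtype.val h1
    exact congrArg Subtype.val h2
  have hid : ∀ a ∈ M, ∀ x ∈ p, ⁅a, x⁆ ∈ p := by
    intro a ha x hx
    obtain ⟨x', hx', rfl⟩ := hpI x hx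
    exact ⟨⁅(⟨a, ha⟩ : M), x'⁆, lie_mem_right F M I _ _ hx', rfl⟩
  have hroot : ∀ l, IsRt l → ∀ x ∈ p, x ∈ wt F h l → x = 0 := by
    intro l hl x hx hxl
    by_contra hx0
    obtain ⟨x0, y0, h1, h2, h3, h4, h5⟩ := D.rootvec D.e_ne l hl
    obtain ⟨c, rfl⟩ := h5 x hxl
    have hc : c ≠ 0 := fun hc => hx0 (by rw [hc, zero_smul])
    have hy := hneg l _ hl (hpM _ hx) hxl hx0 y0 h3
    have h6 : ⁅c • x0, y0⁆ ∈ p := by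
      rw [← lie_skew]; exact neg_mem (hid _ hy _ hx)
    have h7 := hab _ h6 _ hx
    rw [lie_smul, smul_lie, smul_lie, h4, smul_smul, smul_smul] at h7
    have : c * c * 2 ≠ 0 := by simp [hc]
    rcases smul_eq_zero.1 h7 with h8 | h8
    · exact this h8
    · exact h1 h8
  have hzero : ∀ x ∈ p, x ∈ wt F h 0 → x = 0 := by
    intro x hx hx0
    refine hz x hx0 (hpM x hx) ?_
    refine D.decomp M.toSubmodule (fun a ha => M.lie_mem hsM ha) (fun a => ⁅x, a⁆ = 0) (lie_zero _)
      (fun a b ha hb => by rw [lie_add, ha, hb, add_zero]) ?_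
    rintro l (rfl | hl) a ha hal
    · exact D.wt0_comm hx0 hal
    · have h1 := wt_lie hx0 hal
      rw [zero_add] at h1
      refine hroot l hl _ ?_ h1
      rw [← lie_skew]; exact neg_mem (hid _ ha _ hx)
  have hall : ∀ x ∈ p, x = 0 := by
    refine D.decomp p (fun x hx => hid _ hsM x hx) (fun x => x = 0) rfl (fun a b ha hb => by rw [ha, hb, add_zero]) ?_
    rintro l (rfl | hl) x hx hxl
    · exact hzero x hx hxl
    · exact hroot l hl x hx hxl
  rw [LieSubmodule.eq_bot_iff]
  intro x hx
  exact Subtype.ext (hall x ⟨x, hx, rfl⟩)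

lemma E8D.killing [Nontrivial L] (D : E8D F e f h) : LieAlgebra.IsKilling F L := by
  have := D.finite
  have := D.ssm ⊤ (fun _ => LieSubalgebra.mem_top _) (fun _ _ _ _ _ _ _ _ => LieSubalgebra.mem_top _) (by
    intro z hz _ ha
    obtain ⟨c, rfl⟩ := D.exists_hc hz
    have := D.hc_zero (c := c) fun i => ha _ (LieSubalgebra.mem_top _)
    rw [this]; simp [hc])
  exact LieAlgebra.isKilling_of_equiv (LieSubalgebra.topEquiv (R := F) (L := L))

lemma E8D.hc_diag [Module.Finite F L] (D : E8D F e f h) (c : Fin 8 → F) : Diag F (hc h c) := by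
  classical
  set s : Module.End F L := LieAlgebra.ad F L (hc h c)
  have htop : ⨆ μ : F, s.eigenspace μ = ⊤ := by
    rw [eq_top_iff, ← D.iSup']
    exact iSup_le fun l y hy => Submodule.mem_iSup_of_mem (ev c l) (mem_eigenspace_iff.2 (hc_lie _ hy))
  let eigenDecomp := DirectSum.isInternal_submodule_of_iSupIndep_of_iSup_eq_top
    s.eigenspaces_iSupIndep htop
  let I := (ν : F) × Fin (Module.finrank F (s.eigenspace ν))
  let v : Module.Basis I F L := eigenDecomp.collectedBasis fun μ ↦ Module.finBasis F (s.eigenspace μ)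
  have : Fintype I := FiniteDimensional.fintypeBasisIndex v
  have hsv (i : I) : s (v i) = i.1 • v i :=
    mem_eigenspace_iff.mp (eigenDecomp.collectedBasis_mem _ i)
  refine ⟨Fintype.card I, v.reindex (Fintype.equivFin I), fun i => ((Fintype.equivFin I).symm i).1, fun i => ?_⟩
  rw [Module.Basis.reindex_apply]
  exact hsv _

lemma mem_wt_map (g : L ≃ₗ⁅F⁆ L) {l x} : x ∈ wt F (fun i => g (h i)) l ↔ g.symm x ∈ wt F h l := by
  refine forall_congr' fun i => ?_
  rw [← g.injective.eq_iff (a := ⁅h i, g.symm x⁆)]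
  change _ ↔ g ⁅h i, g.symm x⁆ = g ((cc l i : F) • g.symm x)
  rw [LieEquiv.map_lie, map_smul, LieEquiv.apply_symm_apply]

/-- Cartan subalgebras given by a regular semisimple element have Chevalley generators. -/
lemma E8D.exists_adapted [IsAlgClosed F] [Module.Finite F L] (D : E8D F e f h) {y : L} (hy : Diag F y)
    (hab : ∀ a b : L, ⁅y, a⁆ = 0 → ⁅y, b⁆ = 0 → ⁅a, b⁆ = 0) :
    ∃ e' f' h' : Fin 8 → L, E8D F e' f' h' ∧ ∀ a, ⁅y, a⁆ = 0 ↔ a ∈ wt F h' 0 := by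
  obtain ⟨g, hg⟩ := conj_thm hy (show Diag F (hs F h) from D.hc_diag (gco F)) hab (fun a b ha hb => D.wt0_comm (D.cen_hs.1 ha) (D.cen_hs.1 hb))
  refine ⟨_, _, _, D.map g.symm, fun a => ?_⟩
  rw [mem_wt_map, hg, D.cen_hs]
  rfl
end A3
end E8P

namespace E8P
open Module.End

section A4
variable {F : Type*} [Field F] [CharZero F]
variable {L : Type*} [LieRing L] [LieAlgebra F L]
variable {e f h : Fin 8 → L}

/-- weight evaluation as a homomorphism -/
def evH (c : Fin 8 → F) : (Fin 8 → ℤ) →+ F := ⟨⟨ev c, ev_zero c⟩, ev_add c⟩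

lemma addHom_ext {A : Type*} [AddCommGroup A] {a b : (Fin 8 → ℤ) →+ A} (h : ∀ i, a (al i) = b (al i)) : a = b := by
  refine DFunLike.ext _ _ fun l => ?_
  rw [← sum_al l, map_sum, map_sum]
  refine Finset.sum_congr rfl fun i _ => ?_
  rw [map_zsmul, map_zsmul, h]

lemma al_ne (i) : al i ≠ 0 := by
  intro h
  have := congrFun h i
  simp [al] at this

lemma rt_ne {l} (hl : IsRt l) : l ≠ 0 := by
  rintro rfl
  have : bil 0 0 = 2 := hl
  simp [bil] at this

lemma exists_addHom {A : Type*} [AddCommGroup A] (μ : Fin 8 → A) : ∃ w : (Fin 8 → ℤ) →+ A, ∀ i, w (al i) = μ i := by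
  refine ⟨⟨⟨fun l => ∑ i, l i • μ i, by simp⟩, fun a b => by simp [add_smul, Finset.sum_add_distrib]⟩, fun i => ?_⟩
  change ∑ j, al i j • μ j = μ i
  simp [al, Pi.single_apply]

lemma symm_wt0 {q : L ≃ₗ⁅F⁆ L} (hq : ∀ x, x ∈ wt F h 0 ↔ q x ∈ wt F h 0) : ∀ x, x ∈ wt F h 0 ↔ q.symm x ∈ wt F h 0 := by
  intro x
  rw [hq (q.symm x), LieEquiv.apply_symm_apply]

lemma E8D.lemmaW0 [Nontrivial L] (D : E8D F e f h) (q : L ≃ₗ⁅F⁆ L) (hq : ∀ x, x ∈ wt F h 0 ↔ q x ∈ wt F h 0) :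
    ∃ w : (Fin 8 → ℤ) →+ (Fin 8 → ℤ), ∀ l, ∀ x ∈ wt F h l, q x ∈ wt F h (w l) := by
  have h1 : ∀ j, ∃ c : Fin 8 → F, q.symm (h j) = hc h c := fun j => D.exists_hc ((symm_wt0 hq _).1 (D.h_wt j))
  choose c hcc using h1
  have h2 : ∀ l x, x ∈ wt F h l → ∀ j, ⁅h j, q x⁆ = ev (c j) l • q x := by
    intro l x hx j
    rw [← LieEquiv.apply_symm_apply q (h j), hcc, ← LieEquiv.map_lie, hc_lie _ hx, map_smul]
  have hne : ∀ i, q (e i) ≠ 0 := fun i => by simpa using D.e_ne i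
  have h3 : ∀ i, ∃ m, q (e i) ∈ wt F h m := fun i => by
    obtain ⟨m, -, hm⟩ := D.eig_wt (h2 _ _ (D.e_wt i)) (hne i)
    exact ⟨m, hm⟩
  choose μ hμ using h3
  obtain ⟨w, hw⟩ := exists_addHom μ
  refine ⟨w, fun l x hx j => ?_⟩
  rw [h2 l x hx j]
  congr 1
  let a : (Fin 8 → ℤ) →+ F := evH (c j)
  let cj : (Fin 8 → ℤ) →+ F := ⟨⟨fun l => ((cc l j : ℤ) : F), by simp [cc_zero]⟩, fun a b => by simp [cc_add]⟩
  have : a = cj.comp w := by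
    refine addHom_ext fun i => ?_
    change ev (c j) (al i) = (cc (w (al i)) j : F)
    have h4 := h2 _ _ (D.e_wt i) j
    rw [hμ i j] at h4
    rw [hw]
    exact (smul_left_injective F (hne i) h4).symm
  exact DFunLike.congr_fun this l

lemma E8D.lemmaW [Nontrivial L] (D : E8D F e f h) (q : L ≃ₗ⁅F⁆ L) (hq : ∀ x, x ∈ wt F h 0 ↔ q x ∈ wt F h 0) :
    ∃ w : (Fin 8 → ℤ) ≃+ (Fin 8 → ℤ), (∀ l, IsRt l ↔ IsRt (w l)) ∧ ∀ l, ∀ x ∈ wt F h l, q x ∈ wt F h (w l) := by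
  obtain ⟨w, hw⟩ := D.lemmaW0 q hq
  obtain ⟨w', hw'⟩ := D.lemmaW0 q.symm (symm_wt0 hq)
  have h1 : w'.comp w = AddMonoidHom.id _ := by
    refine addHom_ext fun i => ?_
    by_contra hne
    refine D.e_ne i (wt_disj D hne ?_ (D.e_wt i))
    have := hw' _ _ (hw _ _ (D.e_wt i))
    rwa [LieEquiv.symm_apply_apply] at this
  have h2 : w.comp w' = AddMonoidHom.id _ := by
    refine addHom_ext fun i => ?_
    by_contra hne
    refine D.e_ne i (wt_disj D hne ?_ (D.e_wt i))
    have := hw _ _ (hw' _ _ (D.e_wt i))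
    rwa [LieEquiv.apply_symm_apply] at this
  have g1 : ∀ l, w' (w l) = l := fun l => DFunLike.congr_fun h1 l
  have g2 : ∀ l, w (w' l) = l := fun l => DFunLike.congr_fun h2 l
  have key : ∀ l, IsRt l → l ≠ 0 := fun l hl => rt_ne hl
  refine ⟨⟨⟨w, w', g1, g2⟩, map_add w⟩, fun l => ⟨fun hl => ?_, fun hl => ?_⟩, hw⟩
  · obtain ⟨x, -, hx0, hx, -⟩ := D.rootvec D.e_ne l hl
    refine D.isRt (hw _ _ hx) (by simpa using hx0) ?_
    intro h0
    apply key l hl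
    have h0 : w l = 0 := h0
    rw [← g1 l, h0, map_zero]
  · have hl : IsRt (w l) := hl
    obtain ⟨x, -, hx0, hx, -⟩ := D.rootvec D.e_ne _ hl
    have := hw' _ _ hx
    rw [g1] at this
    refine D.isRt this (by simpa using hx0) ?_
    rintro rfl
    exact key _ hl (map_zero w)

/-- a finite order automorphism trivial on the Cartan subalgebra is toral -/
lemma E8D.lemmaT [Nontrivial L] (D : E8D F e f h) {t : L ≃ₗ⁅F⁆ L} (ht : ∀ x ∈ wt F h 0, t x = x) {m : ℕ} (hm : 0 < m)
    (htm : ∀ x, t^[m] x = x) {ζ : F} (hζ : IsPrimitiveRoot ζ m) :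
    ∃ v : Fin 8 → ℤ, ∀ l, ∀ x ∈ wt F h l, t x = ζ ^ (bil v l) • x := by
  have hζ0 : ζ ≠ 0 := hζ.ne_zero hm.ne'
  have h1 : ∀ l x, x ∈ wt F h l → t x ∈ wt F h l := by
    intro l x hx j
    rw [← ht _ (D.h_wt j), ← LieEquiv.map_lie, hx j, map_smul]
  have h2 : ∀ i, ∃ n : ℕ, t (e i) = ζ ^ n • e i := by
    intro i
    obtain ⟨c, hc⟩ := D.wt_al i (h1 _ _ (D.e_wt i))
    have hk : ∀ k, t^[k] (e i) = c ^ k • e i := by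
      intro k
      induction k with
      | zero => simp
      | succ k ih => rw [Function.iterate_succ_apply', ih, map_smul, hc, smul_smul, pow_succ]
    have h3 : c ^ m = 1 := by
      have := hk m
      rw [htm] at this
      exact (smul_left_injective F (D.e_ne i) (by simpa using this)).symm
    have : NeZero m := ⟨hm.ne'⟩
    obtain ⟨n, -, hn⟩ := hζ.eq_pow_of_pow_eq_one h3
    exact ⟨n, by rw [hn, hc]⟩
  choose n hn using h2
  obtain ⟨v, hv⟩ : ∃ v : Fin 8 → ℤ, ∀ i, bil v (al i) = n i := by
    refine ⟨∑ k, (n k : ℤ) • om k, fun i => ?_⟩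
    let B : (Fin 8 → ℤ) →+ ℤ := ⟨⟨fun u => bil u (al i), by simp [bil]⟩, fun a b => bil_add_left a b _⟩
    change B (∑ k, (n k : ℤ) • om k) = n i
    rw [map_sum]
    have : ∀ k, B ((n k : ℤ) • om k) = n k * al i k := fun k => by
      change bil _ _ = _
      rw [bil_smul_left, bil_om]
    simp only [this]
    simp [al, Pi.single_apply]
  refine ⟨v, ?_⟩
  have he : ∀ i, t (e i) = ζ ^ (bil v (al i)) • e i := fun i => by rw [hv, hn, zpow_natCast]
  have hne : ∀ i, h i ≠ 0 := by
    intro i h0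
    have := D.he i i
    rw [h0, zero_lie, E8_diag] at this
    rcases smul_eq_zero.1 this.symm with h | h
    · norm_num at h
    · exact D.e_ne i h
  have hf : ∀ i, t (f i) = ζ ^ (bil v (-al i)) • f i := fun i => by
    have h3 := h1 _ _ (D.f_wt i)
    rw [← wt_neg] at h3
    obtain ⟨d, hd⟩ := D.symm.wt_al i h3
    have h4 := ht _ (D.h_wt i)
    rw [← D.efd, LieEquiv.map_lie, he, hd, smul_lie, lie_smul, smul_smul, D.efd] at h4
    have h5 : ζ ^ (bil v (al i)) * d = 1 := smul_left_injective F (hne i) (by simpa using h4)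
    rw [hd, bil_neg_right, zpow_neg, ← eq_inv_of_mul_eq_one_right h5]
  let T : (Fin 8 → ℤ) → Submodule F L := fun l =>
    { carrier := {x | x ∈ wt F h l ∧ t x = ζ ^ (bil v l) • x}
      add_mem' := fun ha hb => ⟨add_mem ha.1 hb.1, by rw [map_add, ha.2, hb.2, smul_add]⟩
      zero_mem' := ⟨zero_mem _, by simp⟩
      smul_mem' := fun c x hx => ⟨Submodule.smul_mem _ _ hx.1, by rw [map_smul, hx.2, smul_comm]⟩ }
  have hTw : T ≤ wt F h := fun l x hx => hx.1
  let S : LieSubalgebra F L :=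
    { toSubmodule := ⨆ l, T l
      lie_mem' := by
        intro x y hx hy
        change x ∈ ⨆ l, T l at hx
        change y ∈ ⨆ l, T l at hy
        change ⁅x, y⁆ ∈ ⨆ l, T l
        induction hx using Submodule.iSup_induction' with
        | zero => rw [zero_lie]; exact zero_mem _
        | add a b _ _ ha hb => rw [add_lie]; exact add_mem ha hb
        | mem l a ha =>
          induction hy using Submodule.iSup_induction' with
          | zero => rw [lie_zero]; exact zero_mem _
          | add a b _ _ ha hb => rw [lie_add]; exact add_mem ha hb
          | mem l' b hb =>
            refine Submodule.mem_iSup_of_mem (l + l') ⟨wt_lie ha.1 hb.1, ?_⟩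
            rw [LieEquiv.map_lie, ha.2, hb.2, smul_lie, lie_smul, smul_smul, bil_add_right, zpow_add₀ hζ0] }
  have htop : ⨆ l, T l = ⊤ := by
    rw [eq_top_iff]
    intro x _
    exact D.induct S (fun i => Submodule.mem_iSup_of_mem (al i) ⟨D.e_wt i, he i⟩)
      (fun i => Submodule.mem_iSup_of_mem (-al i) ⟨D.f_wt i, hf i⟩) x
  have heq := (D.indep.le_iff_eq_of_iSup_eq_top htop).1 hTw
  intro l x hx
  rw [← congrFun heq l] at hx
  exact hx.2

/-- clearing denominators -/
lemma clear_den {ι : Type*} [Finite ι] (r : ι → ℚ) : ∃ N : ℕ, 0 < N ∧ ∀ i, ∃ n : ℤ, (N : ℚ) * r i = n := by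
  have := Fintype.ofFinite ι
  refine ⟨∏ i, (r i).den, Finset.prod_pos fun i _ => (r i).pos, fun i => ?_⟩
  obtain ⟨k, hk⟩ := Finset.dvd_prod_of_mem (fun i => (r i).den) (Finset.mem_univ i)
  refine ⟨k * (r i).num, ?_⟩
  have h1 : ((r i).den : ℚ) * r i = (r i).num := Rat.den_mul_eq_num (r i)
  change ((∏ i, (r i).den : ℕ) : ℚ) * r i = _
  rw [hk]
  push_cast
  rw [← h1]; ring

lemma lemmaINT (c : Fin 8 → F) : ∃ v : Fin 8 → ℤ, (∀ l, ev c l = 0 → bil v l = 0) ∧ ∀ l, IsRt l → bil v l = 0 → ev c l = 0 := by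
  have : Finite {l : Fin 8 → ℤ | IsRt l ∧ ev c l ≠ 0} :=
    rt_finite.subset fun l hl => Or.inr hl.1
  obtain ⟨φ, hφ⟩ := Module.exists_dual_forall_apply_ne_zero (K := ℚ) (M := F)
    (fun l : {l : Fin 8 → ℤ | IsRt l ∧ ev c l ≠ 0} => ev c l) (fun l => l.2.2)
  obtain ⟨N, hN, hn⟩ := clear_den (fun i => φ (ev c (al i)))
  choose n hn using hn
  refine ⟨∑ k, n k • om k, ?_⟩
  have key : ∀ l, ((bil (∑ k, n k • om k) l : ℤ) : ℚ) = N * φ (ev c l) := by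
    intro l
    have h1 : bil (∑ k, n k • om k) l = ∑ k, n k * l k := by
      let B : (Fin 8 → ℤ) →+ ℤ := ⟨⟨fun u => bil u l, by simp [bil]⟩, fun a b => bil_add_left a b _⟩
      change B _ = _
      rw [map_sum]
      refine Finset.sum_congr rfl fun k _ => ?_
      change bil _ _ = _
      rw [bil_smul_left, bil_om]
    have h2 : ev c l = ∑ k, l k • ev c (al k) := by
      change evH c l = _
      conv_lhs => rw [← sum_al l, map_sum]
      refine Finset.sum_congr rfl fun k _ => ?_
      rw [map_zsmul]; rfl
    rw [h1, h2, map_sum, Finset.mul_sum]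
    push_cast
    refine Finset.sum_congr rfl fun k _ => ?_
    rw [← hn, map_zsmul]; simp; ring
  constructor
  · intro l hl
    have := key l
    rw [hl, map_zero, mul_zero] at this
    exact_mod_cast this
  · intro l hl h0
    by_contra hne
    have := key l
    rw [h0, Int.cast_zero] at this
    rcases mul_eq_zero.1 this.symm with h1 | h1
    · exact hN.ne' (by exact_mod_cast h1)
    · exact hφ ⟨l, hl, hne⟩ h1


lemma E8D.lemmaR [Nontrivial L] (D : E8D F e f h) {t q : L ≃ₗ⁅F⁆ L} (ht : ∀ x ∈ wt F h 0, t x = x) {m : ℕ} (hm : 0 < m)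
    (htm : ∀ x, t^[m] x = x) {ζ : F} (hζ : IsPrimitiveRoot ζ m) (htq : ∀ x, t (q x) = q (t x))
    (hq : ∀ x, x ∈ wt F h 0 ↔ q x ∈ wt F h 0) {x : L} (hx : x ∈ wt F h 0) (hqx : q x = x)
    (hc0 : ∀ a, t a = a → ⁅x, a⁆ = 0 → a ∈ wt F h 0) : ∀ a ∈ wt F h 0, q a = a := by
  have hζ0 : ζ ≠ 0 := hζ.ne_zero hm.ne'
  obtain ⟨v, hv⟩ := D.lemmaT ht hm htm hζ
  obtain ⟨c, rfl⟩ := D.exists_hc hx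
  obtain ⟨y, hy1, hy2⟩ := lemmaINT c
  obtain ⟨w, hw1, hw2⟩ := D.lemmaW q hq
  obtain ⟨B, hB0, hB⟩ : ∃ B : ℤ, 0 < B ∧ ∀ l, IsRt l → |bil y l| < B := by
    obtain ⟨B, hB⟩ := (rt_finite.image fun l => |bil y l|).bddAbove
    refine ⟨max B 0 + 1, by positivity, fun l hl => ?_⟩
    have := hB ⟨l, Or.inr hl, rfl⟩
    have : |bil y l| ≤ B := this
    have := le_max_left B 0
    omega
  have hmB : (0:ℤ) < m * B := by positivity
  have hbv : ∀ l, bil (B • v + y) l = B * bil v l + bil y l := fun l => by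
    rw [bil_add_left, bil_smul_left]
  have hwid : ∀ l, w l = l := by
    refine c1 hmB (B • v + y) w hw1 ?_ ?_
    · intro l hl hd
      rw [hbv] at hd
      have h1 : bil y l = 0 := by
        have h2 : B ∣ bil y l := by
          have h3 : B ∣ B * bil v l + bil y l := (Dvd.intro_left _ rfl).trans hd
          exact (Int.dvd_add_right (Dvd.intro _ rfl)).1 h3
        exact Int.eq_zero_of_abs_lt_dvd h2 (hB l hl)
      rw [h1, add_zero, mul_comm (m:ℤ) B] at hd
      have h3 : (m:ℤ) ∣ bil v l := Int.dvd_of_mul_dvd_mul_left hB0.ne' hd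
      have h4 : ev c l = 0 := hy2 l hl h1
      obtain ⟨a, -, ha0, ha, -⟩ := D.rootvec D.e_ne l hl
      have h5 : a ∈ wt F h 0 := by
        apply hc0
        · rw [hv l a ha, (hζ.zpow_eq_one_iff_dvd _).2 h3, one_smul]
        · rw [hc_lie _ ha, h4, zero_smul]
      exact ha0 (wt_disj D (rt_ne hl) ha h5)
    · intro l hl
      obtain ⟨a, -, ha0, ha, -⟩ := D.rootvec D.e_ne l hl
      have hqa : q a ≠ 0 := by simpa using ha0
      have h1 : bil y (w l) - bil y l = 0 := by
        rw [← bil_sub_right]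
        apply hy1
        change evH c (w l - l) = 0
        rw [map_sub, sub_eq_zero]
        have h2 := hc_lie c (hw2 l a ha)
        rw [← hqx, ← LieEquiv.map_lie, hc_lie c ha, map_smul] at h2
        exact (smul_left_injective F hqa h2).symm
      have h2 : (m:ℤ) ∣ bil v (w l) - bil v l := by
        have h3 := htq a
        rw [hv _ _ (hw2 l a ha), hv l a ha, map_smul] at h3
        have h4 : ζ ^ (bil v (w l)) = ζ ^ (bil v l) := smul_left_injective F hqa h3
        rw [← hζ.zpow_eq_one_iff_dvd, zpow_sub₀ hζ0, h4, div_self (zpow_ne_zero _ hζ0)]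
      have h3 : bil (B • v + y) (w l) - bil (B • v + y) l = (bil v (w l) - bil v l) * B := by
        rw [hbv, hbv]; linear_combination h1
      rw [h3]
      exact mul_dvd_mul_right h2 B
  intro a ha
  have h1 : q a - a ∈ wt F h 0 := sub_mem ((hq a).1 ha) ha
  obtain ⟨d, hd⟩ := D.exists_hc h1
  have h2 : d = 0 := by
    refine D.hc_zero fun i => ?_
    rw [← hd]
    obtain ⟨s, hs⟩ := D.exists_hc ha
    have h3 := hw2 _ _ (D.e_wt i)
    rw [hwid] at h3
    obtain ⟨r, hr⟩ := D.wt_al i h3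
    have hr0 : r ≠ 0 := by
      rintro rfl
      rw [zero_smul] at hr
      exact D.e_ne i (by simpa using hr)
    have h4 : ⁅q a, q (e i)⁆ = ⁅a, q (e i)⁆ := by
      rw [← LieEquiv.map_lie, hs, hc_lie _ (D.e_wt i), map_smul, hc_lie _ h3]
    rw [hr, lie_smul, lie_smul] at h4
    rw [sub_lie, sub_eq_zero]
    exact smul_right_injective L hr0 h4
  rw [h2] at hd
  have : q a - a = 0 := by rw [hd]; simp [hc]
  exact sub_eq_zero.1 this

end A4
end E8P

namespace E8P
open Module.End

section A5
variable {F : Type*} [Field F] [CharZero F] [IsAlgClosed F]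
variable {L : Type*} [LieRing L] [LieAlgebra F L] [Module.Finite F L] [LieAlgebra.IsKilling F L] [Nontrivial L]
variable {e f h : Fin 8 → L}

lemma exists_zeta (F : Type*) [Field F] [CharZero F] [IsAlgClosed F] {m : ℕ} (hm : 0 < m) : ∃ ζ : F, IsPrimitiveRoot ζ m := by
  have : NeZero (m : F) := ⟨by exact_mod_cast hm.ne'⟩
  exact HasEnoughRootsOfUnity.exists_primitiveRoot F m

lemma E8D.stepA (D : E8D F e f h) {t : L ≃ₗ⁅F⁆ L} {y : L} (hy : Diag F y) (hty : t y = y)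
    (hab : ∀ a b : L, ⁅y, a⁆ = 0 → ⁅y, b⁆ = 0 → ⁅a, b⁆ = 0) : ∀ a, ⁅y, a⁆ = 0 → t a = a := by
  obtain ⟨e', f', h', D', hD'⟩ := D.exists_adapted hy hab
  have := D'.lemmaR (t := (LieEquiv.refl : L ≃ₗ⁅F⁆ L)) (q := t) (fun x _ => rfl) (m := 1) one_pos (fun x => rfl)
    (ζ := 1) IsPrimitiveRoot.one (fun x => rfl) (fun x => by
      rw [← hD', ← hD']
      conv_rhs => rw [← hty, ← LieEquiv.map_lie]
      simp) ((hD' y).1 (lie_self y)) hty (fun a _ ha => (hD' a).1 ha)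
  exact fun a ha => this a ((hD' a).1 ha)

lemma E8D.stepB (D : E8D F e f h) {t q : L ≃ₗ⁅F⁆ L} {m : ℕ} (hm : 0 < m) (htm : ∀ x, t^[m] x = x)
    {n : ℕ} (hn : 0 < n) (hqn : ∀ x, q^[n] x = x) (htq : ∀ x, t (q x) = q (t x)) :
    ∃ e' f' h' : Fin 8 → L, E8D F e' f' h' ∧ (∀ x ∈ wt F h' 0, t x = x) ∧ (∀ x ∈ wt F h' 0, q x = x) ∧
      ∀ z, (∀ a, t a = a → ⁅a, z⁆ = 0) → z ∈ wt F h' 0 := by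
  have gM : Good (fixIn (F := F) (⊤ : LieSubalgebra F L) t) := good_top.fix (fun _ _ => LieSubalgebra.mem_top _) hm htm
  set M := fixIn (F := F) (⊤ : LieSubalgebra F L) t with hM
  have mM : ∀ a, a ∈ M ↔ t a = a := fun a => ⟨fun ha => ha.2, fun ha => ⟨LieSubalgebra.mem_top _, ha⟩⟩
  have qM : ∀ a ∈ M, q a ∈ M := fun a ha => by rw [mM, htq, (mM a).1 ha]
  obtain ⟨x, hxM, hqx, hxs, gk, kab⟩ := lemmaB gM qM hn hqn
  set k := cenIn M x with hk
  have mk : ∀ a, a ∈ k ↔ t a = a ∧ ⁅x, a⁆ = 0 := fun a => ⟨fun ha => ⟨(mM a).1 ha.1, ha.2⟩, fun ha => ⟨(mM a).2 ha.1, ha.2⟩⟩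
  have kss := gk.toral kab
  obtain ⟨y, hy, hyg⟩ := lemmaG kab kss
  have hty := ((mk y).1 hy).1
  have hxk : x ∈ k := ⟨hxM, lie_self x⟩
  have hab : ∀ a ∈ cenIn (⊤ : LieSubalgebra F L) y, ∀ b ∈ cenIn (⊤ : LieSubalgebra F L) y, ⁅a, b⁆ = 0 := by
    refine lemmaN (good_top.cen (LieSubalgebra.mem_top y) (kss y hy)) (q := t) ?_ hm htm ?_
    · intro a ha
      refine ⟨LieSubalgebra.mem_top _, ?_⟩
      rw [← hty, ← LieEquiv.map_lie, ha.2, map_zero]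
    · intro a ha hta b hb
      exact hyg b hb.2 a ((mk a).2 ⟨hta, hyg a ha.2 x hxk⟩)
  have hab' : ∀ a b : L, ⁅y, a⁆ = 0 → ⁅y, b⁆ = 0 → ⁅a, b⁆ = 0 := fun a b ha hb =>
    hab a ⟨LieSubalgebra.mem_top _, ha⟩ b ⟨LieSubalgebra.mem_top _, hb⟩
  have hyd := (kss y hy).diag
  have htK := D.stepA hyd hty hab'
  obtain ⟨e', f', h', D', hD'⟩ := D.exists_adapted hyd hab'
  have hwk : ∀ a, a ∈ wt F h' 0 ↔ a ∈ k := fun a => by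
    rw [← hD']
    exact ⟨fun ha => (mk a).2 ⟨htK a ha, hyg a ha x hxk⟩, fun ha => kab y hy a ha⟩
  have hqk : ∀ a, a ∈ k ↔ q a ∈ k := fun a => by
    rw [mk, mk, htq]
    have : ⁅x, q a⁆ = q ⁅x, a⁆ := by rw [LieEquiv.map_lie, hqx]
    rw [this]
    simp
  have ht0 : ∀ x ∈ wt F h' 0, t x = x := fun a ha => ((mk a).1 ((hwk a).1 ha)).1
  obtain ⟨ζ, hζ⟩ := exists_zeta F hm
  refine ⟨e', f', h', D', ht0, ?_, ?_⟩
  · exact D'.lemmaR ht0 hm htm hζ htq (fun a => by rw [hwk, hwk, hqk]) ((hwk x).2 hxk) hqx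
      (fun a ha hxa => (hwk a).2 ((mk a).2 ⟨ha, hxa⟩))
  · intro z hz
    rw [← hD']
    exact hz y hty

lemma E8D.stepC (D : E8D F e f h) {t : L ≃ₗ⁅F⁆ L} {m : ℕ} (hm : 0 < m) (htm : ∀ x, t^[m] x = x)
    (hz : ∀ z, t z = z → (∀ a, t a = a → ⁅a, z⁆ = 0) → z = 0) :
    LieAlgebra.HasTrivialRadical F (fixIn (F := F) (⊤ : LieSubalgebra F L) t) ∧ ∃ j : ℕ, 1 ≤ j ∧ j ≤ 6 ∧ ∀ x, t^[j] x = x := by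
  obtain ⟨e', f', h', D', ht, -, -⟩ := D.stepB hm htm hm htm (fun _ => rfl)
  obtain ⟨ζ, hζ⟩ := exists_zeta F hm
  obtain ⟨v, hv⟩ := D'.lemmaT ht hm htm hζ
  have hdv : ∀ l x, x ∈ wt F h' l → x ≠ 0 → t x = x → (m:ℤ) ∣ bil v l := by
    intro l x hx hx0 htx
    rw [hv l x hx] at htx
    rw [← hζ.zpow_eq_one_iff_dvd]
    exact smul_left_injective F hx0 (by simpa using htx)
  constructor
  · refine D'.ssm _ (fun i => ⟨LieSubalgebra.mem_top _, ht _ (D'.h_wt i)⟩) ?_ ?_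
    · intro l x _ hxM hx hx0 y hy
      refine ⟨LieSubalgebra.mem_top _, ?_⟩
      have := hdv l x hx hx0 hxM.2
      rw [hv _ y hy, bil_neg_right, (hζ.zpow_eq_one_iff_dvd _).2 ((dvd_neg).2 this), one_smul]
    · intro z hz0 hzM ha
      refine hz z hzM.2 fun a hta => ?_
      rw [← lie_skew, ha a ⟨LieSubalgebra.mem_top _, hta⟩, neg_zero]
  · obtain ⟨j, h1, h6, hj⟩ := c2 (m := m) (by exact_mod_cast hm) v (by
      intro u hu
      have hev : ∀ l, ev (fun i => (u i : F)) l = (bil u l : F) := fun l => by simp [ev, bil]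
      have hz0 := D'.hc_mem (fun i => (u i : F))
      have hz1 : hc h' (fun i => (u i : F)) = 0 := by
        refine hz _ (ht _ hz0) ?_
        have := D'.decomp (fixIn (F := F) (⊤ : LieSubalgebra F L) t).toSubmodule
          (fun a ha => ⟨LieSubalgebra.mem_top _, by
            have h3 : t a = a := ha.2
            change t ⁅hs F h', a⁆ = ⁅hs F h', a⁆
            rw [LieEquiv.map_lie, h3, ht (hs F h') (D'.hc_mem _)]⟩)
          (fun a => ⁅a, hc h' (fun i => (u i : F))⁆ = 0) (zero_lie _) (fun a b ha hb => by rw [add_lie, ha, hb, add_zero]) (by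
            rintro l (rfl | hl) a ha hal
            · exact D'.wt0_comm hal hz0
            · by_cases ha0 : a = 0
              · rw [ha0, zero_lie]
              · rw [← lie_skew, hc_lie _ hal, hev, hu l hl (hdv l a hal ha0 ha.2)]
                simp)
        intro a hta
        exact this a ⟨LieSubalgebra.mem_top _, hta⟩
      have h2 := D'.hc_zero (c := fun i => (u i : F)) (fun i => by rw [hz1, zero_lie])
      ext i
      have := congrFun h2 i
      simpa using this)
    refine ⟨j, h1, h6, ?_⟩
    have hit : ∀ k : ℕ, ∀ l x, x ∈ wt F h' l → t^[k] x = ζ ^ ((k : ℤ) * bil v l) • x := by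
      intro k l x hx
      induction k with
      | zero => simp
      | succ k ih =>
        rw [Function.iterate_succ_apply', ih, map_smul, hv l x hx, smul_smul, ← zpow_add₀ (hζ.ne_zero hm.ne')]
        congr 2; push_cast; ring
    intro x
    have hx : x ∈ ⨆ l, wt F h' l := by rw [D'.iSup_wt]; trivial
    induction hx using Submodule.iSup_induction' with
    | zero => exact Function.iterate_fixed (map_zero t) j
    | add a b _ _ ha hb => 
      have : ∀ k : ℕ, t^[k] (a + b) = t^[k] a + t^[k] b := by
        intro k
        induction k with
        | zero => rfl
        | succ k ih => rw [Function.iterate_succ_apply', ih, map_add, Function.iterate_succ_apply', Function.iterate_succ_apply']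
      rw [this, ha, hb]
    | mem l x hx =>
      rw [hit j l x hx, (hζ.zpow_eq_one_iff_dvd _).2 (hj l), one_smul]

lemma stepD {z : L} (hz : Diag F z) {x0 : L} (hx0 : ⁅z, x0⁆ ≠ 0) :
    ∃ g : L ≃ₗ⁅F⁆ L, (∀ q : L ≃ₗ⁅F⁆ L, q z = z → ∀ x, q (g x) = g (q x)) ∧ ∀ n : ℕ, 0 < n → ∃ x, g^[n] x ≠ x := by
  obtain ⟨N, b, μ, hb⟩ := hz
  obtain ⟨i0, hi0⟩ : ∃ i, μ i ≠ 0 := by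
    by_contra hcon
    push Not at hcon
    apply hx0
    have : (LieAlgebra.ad F L z : Module.End F L) = 0 := b.ext fun i => by
      change ⁅z, b i⁆ = 0
      rw [hb, hcon, zero_smul]
    exact DFunLike.congr_fun this x0
  obtain ⟨φ, hφ⟩ := Module.exists_dual_forall_apply_ne_zero (K := ℚ) (M := F) (fun _ : Unit => μ i0) (fun _ => hi0)
  have hφ := hφ ()
  obtain ⟨K, hK, hn⟩ := clear_den (fun i => φ (μ i))
  let κ : F → ℤ := fun a => ⌊(K : ℚ) * φ a⌋
  have hκ : ∀ i, (κ (μ i) : ℚ) = K * φ (μ i) := fun i => by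
    obtain ⟨n, hn⟩ := hn i
    simp only [κ]; rw [hn, Int.floor_intCast]
  have hκadd : ∀ i j, κ (μ i + μ j) = κ (μ i) + κ (μ j) := fun i j => by
    have : (K : ℚ) * φ (μ i + μ j) = ((κ (μ i) + κ (μ j) : ℤ) : ℚ) := by
      rw [map_add, mul_add, ← hκ, ← hκ]; push_cast; rfl
    change ⌊(K : ℚ) * φ (μ i + μ j)⌋ = _
    rw [this, Int.floor_intCast]
  have h2 : (2 : F) ≠ 0 := two_ne_zero
  let G : (Fin N → ℤ) → L →ₗ[F] L := fun s => b.constr F fun i => (2 : F) ^ (s i) • b i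
  have hG : ∀ s i, G s (b i) = (2 : F) ^ (s i) • b i := fun s i => b.constr_basis _ _ _
  let s0 : Fin N → ℤ := fun i => κ (μ i)
  have hGinv : ∀ s, (G s).comp (G (-s)) = LinearMap.id := fun s => b.ext fun i => by
    simp only [LinearMap.comp_apply, hG, map_smul, smul_smul, LinearMap.id_apply, Pi.neg_apply]
    rw [← zpow_add₀ h2]; simp
  have hGinv' : ∀ s, (G (-s)).comp (G s) = LinearMap.id := fun s => by
    have := hGinv (-s); rwa [neg_neg] at this
  have hE : ∀ a x, ⁅z, x⁆ = a • x → G s0 x = (2 : F) ^ (κ a) • x := by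
    intro a x hx
    have hzx : ∀ i, b.repr ⁅z, x⁆ i = μ i * b.repr x i := by
      intro i
      conv_lhs => rw [← b.sum_repr x, lie_sum]
      simp only [lie_smul, hb, map_sum, map_smul, Module.Basis.repr_self, Finsupp.coe_finset_sum, Finset.sum_apply,
        Finsupp.coe_smul, Pi.smul_apply, Finsupp.single_apply, smul_eq_mul]
      simp [mul_comm]
    conv_lhs => rw [← b.sum_repr x, map_sum]
    conv_rhs => rw [← b.sum_repr x, Finset.smul_sum]
    refine Finset.sum_congr rfl fun i _ => ?_
    rw [map_smul, hG]
    by_cases h0 : b.repr x i = 0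
    · rw [h0]; simp
    · have h3 := hzx i
      rw [hx, map_smul, Finsupp.smul_apply, smul_eq_mul] at h3
      have h4 : μ i = a := (mul_right_cancel₀ h0 h3).symm
      rw [← h4, smul_comm]
  have hlie : ∀ x y, G s0 ⁅x, y⁆ = ⁅G s0 x, G s0 y⁆ := by
    intro x y
    have key : ((LieModule.toEnd F L L : L →ₗ[F] Module.End F L).compr₂ (G s0)) =
        (LieModule.toEnd F L L : L →ₗ[F] Module.End F L).compl₁₂ (G s0) (G s0) := by
      refine b.ext fun i => b.ext fun j => ?_
      change G s0 ⁅b i, b j⁆ = ⁅G s0 (b i), G s0 (b j)⁆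
      rw [hE (μ i + μ j), hG, hG, smul_lie, lie_smul, smul_smul, hκadd, zpow_add₀ h2]
      rw [leibniz_lie, hb, hb, smul_lie, lie_smul, add_smul]
    exact DFunLike.congr_fun (DFunLike.congr_fun key x) y
  let g0 : L ≃ₗ[F] L := LinearEquiv.ofLinear (G s0) (G (-s0)) (hGinv s0) (hGinv' s0)
  let g : L ≃ₗ⁅F⁆ L :=
    { g0 with map_lie' := fun {x y} => hlie x y }
  have hg : ∀ x, g x = G s0 x := fun x => rfl
  refine ⟨g, fun q hq x => ?_, fun n hn' => ⟨b i0, ?_⟩⟩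
  · have : (q.toLinearEquiv : L →ₗ[F] L).comp (G s0) = (G s0).comp (q.toLinearEquiv : L →ₗ[F] L) := b.ext fun i => by
      change q (G s0 (b i)) = G s0 (q (b i))
      rw [hG, map_smul, hE (μ i)]
      rw [← hq, ← LieEquiv.map_lie, hb, map_smul]
    exact DFunLike.congr_fun this x
  · have hit : ∀ k : ℕ, g^[k] (b i0) = (2:F) ^ (k * κ (μ i0)) • b i0 := by
      intro k
      induction k with
      | zero => simp
      | succ k ih =>
        rw [Function.iterate_succ_apply', ih, map_smul, hg, hG, smul_smul, ← zpow_add₀ h2]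
        congr 2; push_cast; ring
    rw [hit]
    intro hcon
    have h3 : (2:F) ^ ((n:ℤ) * κ (μ i0)) = 1 := smul_left_injective F (b.ne_zero i0) (by simpa using hcon)
    have h4 : (2:ℚ) ^ ((n:ℤ) * κ (μ i0)) = 1 := by
      have : (algebraMap ℚ F) ((2:ℚ) ^ ((n:ℤ) * κ (μ i0))) = algebraMap ℚ F 1 := by
        rw [map_zpow₀, map_one]; simpa using h3
      exact (algebraMap ℚ F).injective this
    rw [zpow_eq_one_iff_right₀ (by norm_num) (by norm_num)] at h4
    rcases mul_eq_zero.1 h4 with h5 | h5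
    · omega
    · have := hκ i0
      rw [h5, Int.cast_zero] at this
      rcases mul_eq_zero.1 this.symm with h6 | h6
      · exact hK.ne' (by exact_mod_cast h6)
      · exact hφ h6

end A5
end E8P

namespace E8P
section A6
variable {F : Type*} [Field F] [CharZero F] [IsAlgClosed F]
variable {L : Type*} [LieRing L] [LieAlgebra F L]
variable {e f h : Fin 8 → L}

/-- automorphism as a Lie equivalence -/
def toLE (t : lieAut F L) : L ≃ₗ⁅F⁆ L := { t.1 with map_lie' := fun {x y} => t.2 x y }

/-- Lie equivalence as an element of the automorphism group -/
def ofLE (g : L ≃ₗ⁅F⁆ L) : lieAut F L := ⟨g.toLinearEquiv, fun x y => LieEquiv.map_lie g x y⟩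

lemma toLE_iter (t : lieAut F L) (k : ℕ) (x : L) : (toLE t)^[k] x = toLE (t ^ k) x := by
  induction k with
  | zero => rfl
  | succ k ih => rw [Function.iterate_succ_apply', ih, pow_succ']; rfl

lemma lieAut_ext {s t : lieAut F L} (h : ∀ x, toLE s x = toLE t x) : s = t :=
  Subtype.ext (LinearEquiv.ext h)

lemma closure_comm {G : Type*} [Group G] (S : Set G) (hS : ∀ a ∈ S, ∀ b ∈ S, a * b = b * a) :
    ∀ a b, a ∈ Subgroup.closure S → b ∈ Subgroup.closure S → a * b = b * a := by
  have h1 : Subgroup.closure S ≤ Subgroup.centralizer S := by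
    rw [Subgroup.closure_le]
    intro a ha
    rw [SetLike.mem_coe, Subgroup.mem_centralizer_iff]
    exact fun b hb => hS b hb a ha
  have h2 : Subgroup.closure S ≤ Subgroup.centralizer (Subgroup.closure S : Set G) := by
    rw [Subgroup.closure_le]
    intro a ha
    rw [SetLike.mem_coe, Subgroup.mem_centralizer_iff]
    intro b hb
    exact ((Subgroup.mem_centralizer_iff.1 (h1 hb)) a ha).symm
  intro a b ha hb
  exact (Subgroup.mem_centralizer_iff.1 (h2 hb)) a ha

lemma ss_of_htr {L : Type*} [LieRing L] [LieAlgebra F L] [Module.Finite F L] (h : LieAlgebra.HasTrivialRadical F L) :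
    LieAlgebra.IsSemisimple F L := by
  have : LieAlgebra.IsKilling F L := inferInstance
  infer_instance

lemma E8D.centre_zero [Nontrivial L] [Module.Finite F L] [LieAlgebra.IsKilling F L] (D : E8D F e f h) (Q : Subgroup (lieAut F L)) (hQ : IsMaximalFiniteAbelian Q) (t : lieAut F L)
    (ht : t ∈ Q) : ∀ z, toLE t z = z → (∀ a, toLE t a = a → ⁅a, z⁆ = 0) → z = 0 := by
  intro z htz hz
  obtain ⟨hfin, hcomm, hmax⟩ := hQ
  have hm : 0 < Nat.card Q := Nat.card_pos
  have hpow : ∀ q ∈ Q, q ^ Nat.card Q = 1 := fun q hq => by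
    have := pow_card_eq_one' (x := (⟨q, hq⟩ : Q))
    exact congrArg Subtype.val this
  have hit : ∀ q ∈ Q, ∀ x, (toLE q)^[Nat.card Q] x = x := fun q hq x => by
    rw [toLE_iter, hpow q hq]; rfl
  have hq : ∀ q ∈ Q, toLE q z = z := fun q hq => by
    obtain ⟨e', f', h', D', -, h2, h3⟩ := D.stepB hm (hit t ht) hm (hit q hq)
      (fun x => congrArg (fun s => toLE s x) (hcomm t q ht hq))
    exact h2 z (h3 z hz)
  by_contra hz0
  obtain ⟨e', f', h', D', -, -, h3⟩ := D.stepB hm (hit t ht) hm (hit t ht) (fun x => rfl)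
  have hzw := h3 z hz
  obtain ⟨c, rfl⟩ := D'.exists_hc hzw
  obtain ⟨x0, hx0⟩ : ∃ x0 : L, ⁅hc h' c, x0⁆ ≠ (0 : L) := by
    by_contra hcon
    push Not at hcon
    have := D'.hc_zero (c := c) (fun i => hcon _)
    apply hz0
    rw [this]; simp [hc]
  obtain ⟨g, hg1, hg2⟩ := stepD (D'.hc_diag c) hx0
  have hgt : ∀ x, toLE (ofLE g) x = g x := fun x => rfl
  have hgQ : ∀ q ∈ Q, q * ofLE g = ofLE g * q := fun q hqQ => lieAut_ext fun x => hg1 (toLE q) (hq q hqQ) x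
  have hcl := closure_comm ((Q : Set (lieAut F L)) ∪ {ofLE g}) (by
    rintro a (ha | rfl) b (hb | rfl)
    · exact hcomm a b ha hb
    · exact hgQ a ha
    · exact (hgQ b hb).symm
    · rfl)
  have hQ' := hmax _ hcl (fun a ha => Subgroup.subset_closure (Or.inl ha))
  have hgmem : ofLE g ∈ Q := by
    rw [← hQ']; exact Subgroup.subset_closure (Or.inr rfl)
  obtain ⟨x, hx⟩ := hg2 _ hm
  exact hx (hit _ hgmem x)

theorem E8D.main (D : E8D F e f h) (Q : Subgroup (lieAut F L)) (hQ : IsMaximalFiniteAbelian Q) :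
    ((∃ p ∈ ({2, 3, 5} : Set ℕ), ∀ g ∈ Q, g ^ p = 1) ∨
      Monoid.exponent Q = 4 ∨ Monoid.exponent Q = 6) ∧
    ∀ θ : lieAut F L, θ ∈ Q → LieAlgebra.IsSemisimple F ↥(fixedSubalgebra θ) := by
  rcases subsingleton_or_nontrivial L with hL | hL
  · refine ⟨Or.inl ⟨2, by simp, fun g _ => lieAut_ext fun x => Subsingleton.elim _ _⟩, fun θ _ => ?_⟩
    have : Subsingleton (fixedSubalgebra θ) := ⟨fun a b => Subtype.ext (Subsingleton.elim _ _)⟩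
    apply ss_of_htr
    rw [LieAlgebra.hasTrivialRadical_iff_no_abelian_ideals]
    intro I _
    rw [LieSubmodule.eq_bot_iff]
    exact fun x _ => Subsingleton.elim _ _
  have := D.finite
  have := D.killing
  have hfin := hQ.1
  have hm : 0 < Nat.card Q := Nat.card_pos
  have hit : ∀ q ∈ Q, ∀ x, (toLE q)^[Nat.card Q] x = x := fun q hq x => by
    rw [toLE_iter]
    have h1 := pow_card_eq_one' (x := (⟨q, hq⟩ : Q))
    have h2 : q ^ Nat.card Q = 1 := congrArg Subtype.val h1
    rw [h2]; rfl
  have key := fun q (hq : q ∈ Q) => D.stepC hm (hit q hq) (D.centre_zero Q hQ q hq)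
  refine ⟨?_, fun θ hθ => ?_⟩
  · have hj : ∀ q ∈ Q, ∃ j : ℕ, 1 ≤ j ∧ j ≤ 6 ∧ q ^ j = 1 := fun q hq => by
      obtain ⟨-, j, h1, h6, hj⟩ := key q hq
      refine ⟨j, h1, h6, lieAut_ext fun x => ?_⟩
      rw [← toLE_iter, hj]; rfl
    have hexp : ∃ q : Q, orderOf q = Monoid.exponent Q := by
      letI : CommGroup Q := { (inferInstance : Group Q) with
        mul_comm := fun a b => Subtype.ext (hQ.2.1 a b a.2 b.2) }
      exact Monoid.exists_orderOf_eq_exponent Monoid.ExponentExists.of_finite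
    obtain ⟨q, hq⟩ := hexp
    have hle : 1 ≤ Monoid.exponent Q ∧ Monoid.exponent Q ≤ 6 := by
      obtain ⟨j, h1, h6, hj⟩ := hj q q.2
      have hd : orderOf q ∣ j := orderOf_dvd_of_pow_eq_one (Subtype.ext hj)
      rw [← hq]
      exact ⟨Nat.pos_of_dvd_of_pos hd h1, (Nat.le_of_dvd h1 hd).trans h6⟩
    have hpw : ∀ p, Monoid.exponent Q ∣ p → ∀ g ∈ Q, g ^ p = 1 := fun p hp g hg => by
      have : (⟨g, hg⟩ : Q) ^ p = 1 := Monoid.exponent_dvd_iff_forall_pow_eq_one.1 hp _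
      exact congrArg Subtype.val this
    generalize Monoid.exponent Q = n at hle hpw
    obtain ⟨h1, h6⟩ := hle
    interval_cases n
    · exact Or.inl ⟨2, by simp, hpw 2 (by norm_num)⟩
    · exact Or.inl ⟨2, by simp, hpw 2 (by norm_num)⟩
    · exact Or.inl ⟨3, by simp, hpw 3 (by norm_num)⟩
    · exact Or.inr (Or.inl rfl)
    · exact Or.inl ⟨5, by simp, hpw 5 (by norm_num)⟩
    · exact Or.inr (Or.inr rfl)
  · have h1 := (key θ hθ).1
    have h2 : fixIn (F := F) (⊤ : LieSubalgebra F L) (toLE θ) = fixedSubalgebra θ := by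
      ext x
      exact ⟨fun hx => hx.2, fun hx => ⟨LieSubalgebra.mem_top _, hx⟩⟩
    rw [h2] at h1
    exact ss_of_htr h1

end A6

section A7
variable (F : Type*) [Field F] [CharZero F]

lemma E8_off (i j : Fin 8) (hij : i ≠ j) : CartanMatrix.E₈ i j = 0 ∨ CartanMatrix.E₈ i j = -1 := by
  fin_cases i <;> fin_cases j <;> first | exact absurd rfl hij | exact Or.inl rfl | exact Or.inr rfl

/-- projection from the free Lie algebra -/
noncomputable def pr : FreeLieAlgebra F (CartanMatrix.Generators (Fin 8)) →ₗ⁅F⁆ LieAlgebra.e₈ F where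
  toFun x := (LieSubmodule.Quotient.mk x : FreeLieAlgebra F (CartanMatrix.Generators (Fin 8)) ⧸
    CartanMatrix.Relations.toIdeal F CartanMatrix.E₈)
  map_add' _ _ := rfl
  map_smul' _ _ := rfl
  map_lie' := rfl

lemma pr_surj (x : LieAlgebra.e₈ F) : ∃ y, pr F y = x := Submodule.Quotient.mk_surjective _ x

lemma pr_zero {x} (hx : x ∈ CartanMatrix.Relations.toSet F CartanMatrix.E₈) : pr F x = 0 :=
  (LieSubmodule.Quotient.mk_eq_zero (CartanMatrix.Relations.toIdeal F CartanMatrix.E₈)).2 (LieSubmodule.subset_lieSpan hx)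

open CartanMatrix Relations in
lemma e8D : E8D F (fun i => pr F (FreeLieAlgebra.of F (Generators.E i))) (fun i => pr F (FreeLieAlgebra.of F (Generators.F i)))
    (fun i => pr F (FreeLieAlgebra.of F (Generators.H i))) where
  hh i j := by
    rw [← LieHom.map_lie]
    exact pr_zero F (Or.inl (Or.inl (Or.inl (Or.inl (Or.inl ⟨(i, j), rfl⟩)))))
  efd i := by
    have := pr_zero F (Or.inl (Or.inl (Or.inl (Or.inl (Or.inr ⟨(i, i), rfl⟩)))))
    simp only [EF, Function.uncurry_apply_pair, if_true, map_sub, LieHom.map_lie] at this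
    exact sub_eq_zero.1 this
  ef i j hij := by
    have := pr_zero F (Or.inl (Or.inl (Or.inl (Or.inl (Or.inr ⟨(i, j), rfl⟩)))))
    simp only [EF, Function.uncurry_apply_pair, if_neg hij, LieHom.map_lie] at this
    exact this
  he i j := by
    have := pr_zero F (Or.inl (Or.inl (Or.inl (Or.inr ⟨(i, j), rfl⟩))))
    simp only [HE, Function.uncurry_apply_pair, map_sub, LieHom.map_lie, map_zsmul] at this
    rw [Int.cast_smul_eq_zsmul]
    exact sub_eq_zero.1 this
  hf i j := by
    have := pr_zero F (Or.inl (Or.inl (Or.inr ⟨(i, j), rfl⟩)))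
    simp only [HF, Function.uncurry_apply_pair, map_add, LieHom.map_lie, map_zsmul] at this
    rw [Int.cast_smul_eq_zsmul]
    exact eq_neg_of_add_eq_zero_left this
  se i j hij := by
    have := pr_zero F (Or.inl (Or.inr ⟨(i, j), rfl⟩))
    rcases E8_off i j hij with h0 | h0
    · simp [adE, h0] at this
      rw [this, lie_zero]
    · simpa [adE, h0] using this
  sf i j hij := by
    have := pr_zero F (Or.inr ⟨(i, j), rfl⟩)
    rcases E8_off i j hij with h0 | h0
    · simp [adF, h0] at this
      rw [this, lie_zero]
    · simpa [adF, h0] using this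
  gen := by
    set T := LieSubalgebra.lieSpan F (LieAlgebra.e₈ F) (Set.range (fun i => pr F (FreeLieAlgebra.of F (Generators.E i))) ∪
      Set.range (fun i => pr F (FreeLieAlgebra.of F (Generators.F i)))) with hT
    have hE : ∀ i, pr F (FreeLieAlgebra.of F (Generators.E i)) ∈ T := fun i => LieSubalgebra.subset_lieSpan (Or.inl ⟨i, rfl⟩)
    have hF : ∀ i, pr F (FreeLieAlgebra.of F (Generators.F i)) ∈ T := fun i => LieSubalgebra.subset_lieSpan (Or.inr ⟨i, rfl⟩)
    have hg : ∀ g, pr F (FreeLieAlgebra.of F g) ∈ T := by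
      intro g
      cases g with
      | E i => exact hE i
      | F i => exact hF i
      | H i =>
        have := pr_zero F (Or.inl (Or.inl (Or.inl (Or.inl (Or.inr ⟨(i, i), rfl⟩)))))
        simp only [EF, Function.uncurry_apply_pair, if_true, map_sub, LieHom.map_lie] at this
        rw [sub_eq_zero] at this
        simp only [Function.comp] at this
        rw [← this]
        exact T.lie_mem (hE i) (hF i)
    let φ : FreeLieAlgebra F (Generators (Fin 8)) →ₗ⁅F⁆ T := FreeLieAlgebra.lift F fun g => ⟨_, hg g⟩
    have hφ : T.incl.comp φ = pr F := FreeLieAlgebra.hom_ext fun g => by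
      rw [LieHom.comp_apply]
      simp [φ]
    rw [eq_top_iff]
    intro x _
    obtain ⟨y, rfl⟩ := pr_surj F x
    rw [← hφ]
    exact (φ y).2
end A7
end E8P

theorem stmt2 (F : Type) [Field F] [IsAlgClosed F] [CharZero F]
    (Q : Subgroup ↥(lieAut F (LieAlgebra.e₈ F))) (hQ : IsMaximalFiniteAbelian Q) :
    ((∃ p ∈ ({2, 3, 5} : Set ℕ), ∀ g ∈ Q, g ^ p = 1) ∨
      Monoid.exponent Q = 4 ∨ Monoid.exponent Q = 6) ∧
    ∀ θ : ↥(lieAut F (LieAlgebra.e₈ F)), θ ∈ Q →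
      LieAlgebra.IsSemisimple F ↥(fixedSubalgebra θ) := by
  exact (E8P.e8D F).main Q hQ
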